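/- arXiv:math/0210252 — 2 statements merged into one kernel-verified Lean document; each statement's English description precedes it below -/
import Mathlib

section
/- Let m denote the normalized Haar (probability) measure on the special orthogonal group SO(3) = {A ∈ Matrix (Fin 3) (Fin 3) ℝ : Aᵀ·A = 1 and det A = 1}. Then for every t ∈ [0, π], the m-measure of the set {A ∈ SO(3) : trace(A) ≥ 1 + 2·cos t} equals (t − sin t)/π. (Equivalently, the rotation angle θ(A) ∈ [0,π], defined by trace A = 1 + 2 cos θ(A), is distributed with density (1 − cos θ)/π on [0, π].) -/
open MeasureTheory

noncomputable instance : MeasurableSpace (Matrix (Fin 3) (Fin 3) ℝ) := borel _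
instance : BorelSpace (Matrix (Fin 3) (Fin 3) ℝ) := ⟨rfl⟩

/-- `SO(3)`: the set of 3×3 real matrices `A` with `Aᵀ * A = 1` and `det A = 1`. -/
def SO3 : Set (Matrix (Fin 3) (Fin 3) ℝ) :=
  {A | A.transpose * A = 1 ∧ A.det = 1}

open scoped Matrix


def rotQ (q : Fin 4 → ℝ) : Matrix (Fin 3) (Fin 3) ℝ :=
  !![q 0^2+q 1^2-q 2^2-q 3^2, 2*(q 1*q 2-q 0*q 3), 2*(q 1*q 3+q 0*q 2);
     2*(q 1*q 2+q 0*q 3), q 0^2-q 1^2+q 2^2-q 3^2, 2*(q 2*q 3-q 0*q 1);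
     2*(q 1*q 3-q 0*q 2), 2*(q 2*q 3+q 0*q 1), q 0^2-q 1^2-q 2^2+q 3^2]

def nsq (q : Fin 4 → ℝ) : ℝ := q 0^2+q 1^2+q 2^2+q 3^2

/-- matrix of right multiplication by p -/
def rmulM (p : Fin 4 → ℝ) : Matrix (Fin 4) (Fin 4) ℝ :=
  !![p 0, -p 1, -p 2, -p 3;
     p 1, p 0, p 3, -p 2;
     p 2, -p 3, p 0, p 1;
     p 3, p 2, -p 1, p 0]

lemma rotQ_mul (q p : Fin 4 → ℝ) : rotQ (rmulM p *ᵥ q) = rotQ q * rotQ p := by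
  ext i j
  fin_cases i <;> fin_cases j <;>
    simp [rotQ, rmulM, Matrix.mul_apply, Fin.sum_univ_succ, Matrix.mulVec, dotProduct] <;> ring

lemma nsq_mul (q p : Fin 4 → ℝ) : nsq (rmulM p *ᵥ q) = nsq q * nsq p := by
  simp [nsq, rmulM, Fin.sum_univ_succ, Matrix.mulVec, dotProduct]; ring

lemma det_rmulM (p : Fin 4 → ℝ) : (rmulM p).det = nsq p ^ 2 := by
  simp [rmulM, nsq, Matrix.det_succ_row_zero, Fin.sum_univ_succ, Fin.succAbove]; ring

lemma rotQ_smul (r : ℝ) (p : Fin 4 → ℝ) : rotQ (r • p) = r^2 • rotQ p := by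
  ext i j
  fin_cases i <;> fin_cases j <;> simp [rotQ] <;> ring

lemma nsq_smul (r : ℝ) (p : Fin 4 → ℝ) : nsq (r • p) = r^2 * nsq p := by
  simp [nsq]; ring

lemma rotQ_SO3 (q : Fin 4 → ℝ) (h : nsq q = 1) : rotQ q ∈ SO3 := by
  have h2 : nsq q ^ 2 = 1 := by rw [h]; norm_num
  have h3 : nsq q ^ 3 = 1 := by rw [h]; norm_num
  unfold nsq at h2 h3
  constructor
  · ext i j
    fin_cases i <;> fin_cases j <;>
      simp [rotQ, Matrix.mul_apply, Fin.sum_univ_succ] <;> first | linear_combination h2 | ring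
  · rw [Matrix.det_fin_three]; simp [rotQ]; linear_combination h3

lemma SO3_entries {A : Matrix (Fin 3) (Fin 3) ℝ} (hA : A ∈ SO3) :
    A.transpose * A = 1 ∧ A * A.transpose = 1 ∧ A.adjugate = A.transpose := by
  obtain ⟨h1, h2⟩ := hA
  have h3 : A * A.transpose = 1 := mul_eq_one_comm.mp h1
  refine ⟨h1, h3, ?_⟩
  have := Matrix.mul_adjugate A
  rw [h2, one_smul] at this
  calc A.adjugate = (A.transpose * A) * A.adjugate := by rw [h1, one_mul]
    _ = A.transpose := by rw [mul_assoc, this, mul_one]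

lemma SO3_surj_aux {A : Matrix (Fin 3) (Fin 3) ℝ} (hA : A ∈ SO3) (ht : 1 + A.trace ≠ 0) :
    ∃ p, nsq p = 1 ∧ rotQ p = A := by
  obtain ⟨h1, h2, h3⟩ := SO3_entries hA
  set p : Fin 4 → ℝ := ![1 + A.trace, A 2 1 - A 1 2, A 0 2 - A 2 0, A 1 0 - A 0 1] with hp
  have e1 : ∀ i j, (A.transpose * A) i j = (1 : Matrix (Fin 3) (Fin 3) ℝ) i j := by simp [h1]
  have e2 : ∀ i j, (A * A.transpose) i j = (1 : Matrix (Fin 3) (Fin 3) ℝ) i j := by simp [h2]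
  have e3 : ∀ i j, A.adjugate i j = A j i := by simp [h3]
  simp only [Fin.forall_fin_succ, Matrix.mul_apply, Fin.sum_univ_succ, Matrix.adjugate_fin_three] at e1 e2 e3
  simp at e1 e2 e3
  have hn : nsq p = 4 * (1 + A.trace) := by
    simp [hp, nsq, Matrix.trace, Fin.sum_univ_succ]
    linarith
  have hr : rotQ p = (4 * (1 + A.trace)) • A := by
    ext i j
    fin_cases i <;> fin_cases j <;>
    simp [hp, rotQ, Matrix.trace, Fin.sum_univ_succ] <;> linarith
  have hpos : 0 < 4 * (1 + A.trace) := by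
    rcases lt_or_gt_of_ne ht with h | h
    · have : 0 ≤ nsq p := by unfold nsq; positivity
      linarith
    · linarith
  have hs : (Real.sqrt (4 * (1 + A.trace)))⁻¹ ^ 2 = (4 * (1 + A.trace))⁻¹ := by
    rw [inv_pow, Real.sq_sqrt hpos.le]
  refine ⟨(Real.sqrt (4 * (1 + A.trace)))⁻¹ • p, ?_, ?_⟩
  · rw [nsq_smul, hs, hn, inv_mul_cancel₀ hpos.ne']
  · rw [rotQ_smul, hs, hr, smul_smul, inv_mul_cancel₀ hpos.ne', one_smul]

lemma SO3_mul {A B : Matrix (Fin 3) (Fin 3) ℝ} (hA : A ∈ SO3) (hB : B ∈ SO3) : A * B ∈ SO3 := by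
  refine ⟨?_, by rw [Matrix.det_mul, hA.2, hB.2, one_mul]⟩
  rw [Matrix.transpose_mul, mul_assoc, ← mul_assoc A.transpose, hA.1, one_mul, hB.1]

lemma SO3_surj {A : Matrix (Fin 3) (Fin 3) ℝ} (hA : A ∈ SO3) :
    ∃ p, nsq p = 1 ∧ rotQ p = A := by
  have key : ∀ e : Fin 4 → ℝ, nsq e = 1 → rotQ e * rotQ e = 1 → 1 + (A * rotQ e).trace ≠ 0 →
      ∃ p, nsq p = 1 ∧ rotQ p = A := by
    intro e he hee ht
    obtain ⟨p, hp, hpA⟩ := SO3_surj_aux (SO3_mul hA (rotQ_SO3 e he)) ht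
    refine ⟨rmulM e *ᵥ p, by rw [nsq_mul, hp, he, one_mul], ?_⟩
    rw [rotQ_mul, hpA, mul_assoc, hee, mul_one]
  by_contra hcon
  have k : ∀ e : Fin 4 → ℝ, nsq e = 1 → rotQ e * rotQ e = 1 → 1 + (A * rotQ e).trace = 0 := by
    intro e h1 h2
    by_contra h3
    exact hcon (key e h1 h2 h3)
  have k0 := k ![1,0,0,0] (by simp [nsq]) (by
    ext i j; fin_cases i <;> fin_cases j <;> simp [rotQ, Matrix.mul_apply, Fin.sum_univ_succ])
  have k1 := k ![0,1,0,0] (by simp [nsq]) (by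
    ext i j; fin_cases i <;> fin_cases j <;> simp [rotQ, Matrix.mul_apply, Fin.sum_univ_succ])
  have k2 := k ![0,0,1,0] (by simp [nsq]) (by
    ext i j; fin_cases i <;> fin_cases j <;> simp [rotQ, Matrix.mul_apply, Fin.sum_univ_succ])
  have k3 := k ![0,0,0,1] (by simp [nsq]) (by
    ext i j; fin_cases i <;> fin_cases j <;> simp [rotQ, Matrix.mul_apply, Fin.sum_univ_succ])
  simp [rotQ, Matrix.trace, Matrix.mul_apply, Fin.sum_univ_succ] at k0 k1 k2 k3
  linarith

lemma vol3 (r : ℝ) (hr : 0 ≤ r) : volume {v : Fin 3 → ℝ | v 0^2 + v 1^2 + v 2^2 ≤ r^2}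
    = ENNReal.ofReal (4 * Real.pi / 3 * r^3) := by
  have h := (PiLp.volume_preserving_toLp (Fin 3)).measure_preimage
    (s := Metric.closedBall (0 : EuclideanSpace ℝ (Fin 3)) r) measurableSet_closedBall.nullMeasurableSet
  rw [EuclideanSpace.volume_closedBall_fin_three] at h
  have e : {v : Fin 3 → ℝ | v 0^2 + v 1^2 + v 2^2 ≤ r^2} =
      (WithLp.toLp 2) ⁻¹' (Metric.closedBall (0 : EuclideanSpace ℝ (Fin 3)) r) := by
    rw [EuclideanSpace.closedBall_zero_eq _ hr]
    ext v
    simp [Fin.sum_univ_succ, add_assoc]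
  rw [e, h, ← ENNReal.ofReal_pow hr, ← ENNReal.ofReal_mul (by positivity)]
  congr 1; ring

lemma vol4 : volume {q : Fin 4 → ℝ | q 0^2 + q 1^2 + q 2^2 + q 3^2 ≤ 1}
    = ENNReal.ofReal (Real.pi ^ 2 / 2) := by
  have h := (PiLp.volume_preserving_toLp (Fin 4)).measure_preimage
    (s := Metric.closedBall (0 : EuclideanSpace ℝ (Fin 4)) 1) measurableSet_closedBall.nullMeasurableSet
  rw [InnerProductSpace.volume_closedBall_of_dim_even (k := 2) (by simp)] at h
  have e : {q : Fin 4 → ℝ | q 0^2 + q 1^2 + q 2^2 + q 3^2 ≤ 1} =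
      (WithLp.toLp 2) ⁻¹' (Metric.closedBall (0 : EuclideanSpace ℝ (Fin 4)) 1) := by
    rw [EuclideanSpace.closedBall_zero_eq _ zero_le_one]
    ext v
    simp [Fin.sum_univ_succ, add_assoc]
  rw [e, h]
  simp [Nat.factorial]

lemma integ (t : ℝ) (ht0 : 0 ≤ t) (ht : t < Real.pi) :
    ∫ a in (0:ℝ)..1, (min (Real.tan (t/2) * a) (Real.sqrt (1 - a^2)))^3 = 3/16 * (t - Real.sin t) := by
  have hc : 0 < Real.cos (t/2) := Real.cos_pos_of_mem_Ioo ⟨by linarith, by linarith⟩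
  have hs : 0 ≤ Real.sin (t/2) := Real.sin_nonneg_of_nonneg_of_le_pi (by linarith) (by linarith)
  have hsc := Real.sin_sq_add_cos_sq (t/2)
  have hc1 := Real.cos_le_one (t/2)
  have htan : Real.tan (t/2) * Real.cos (t/2) = Real.sin (t/2) := Real.tan_mul_cos hc.ne'
  have htan0 : 0 ≤ Real.tan (t/2) := by rw [Real.tan_eq_sin_div_cos]; positivity
  have hcont : Continuous fun a : ℝ => (min (Real.tan (t/2) * a) (Real.sqrt (1 - a^2)))^3 := by fun_prop
  rw [← intervalIntegral.integral_add_adjacent_intervals (b := Real.cos (t/2))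
    (hcont.intervalIntegrable _ _) (hcont.intervalIntegrable _ _)]
  have I1 : ∫ a in (0:ℝ)..Real.cos (t/2), (min (Real.tan (t/2) * a) (Real.sqrt (1 - a^2)))^3
      = Real.sin (t/2)^3 * Real.cos (t/2) / 4 := by
    have : ∫ a in (0:ℝ)..Real.cos (t/2), (min (Real.tan (t/2) * a) (Real.sqrt (1 - a^2)))^3
       = ∫ a in (0:ℝ)..Real.cos (t/2), Real.tan (t/2)^3 * a^3 := by
      apply intervalIntegral.integral_congr
      intro a ha
      rw [Set.uIcc_of_le hc.le] at ha
      have : Real.tan (t/2) * a ≤ Real.sqrt (1 - a^2) := by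
        calc _ ≤ Real.tan (t/2) * Real.cos (t/2) := by gcongr; exact ha.2
          _ = Real.sin (t/2) := htan
          _ ≤ _ := by
            apply Real.le_sqrt_of_sq_le
            nlinarith [ha.1, ha.2]
      simp only [min_eq_left this]; ring
    rw [this, intervalIntegral.integral_const_mul, integral_pow, ← htan]
    norm_num; ring
  have I2 : ∫ a in Real.cos (t/2)..1, (min (Real.tan (t/2) * a) (Real.sqrt (1 - a^2)))^3
      = ∫ x in (0:ℝ)..(t/2), Real.sin x ^ 4 := by
    have : ∫ a in Real.cos (t/2)..1, (min (Real.tan (t/2) * a) (Real.sqrt (1 - a^2)))^3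
        = ∫ a in Real.cos (t/2)..1, (Real.sqrt (1 - a^2))^3 := by
      apply intervalIntegral.integral_congr
      intro a ha
      rw [Set.uIcc_of_le hc1] at ha
      have : Real.sqrt (1 - a^2) ≤ Real.tan (t/2) * a := by
        calc _ ≤ Real.sin (t/2) := by
              rw [Real.sqrt_le_left hs]
              nlinarith [ha.1, ha.2]
          _ = Real.tan (t/2) * Real.cos (t/2) := htan.symm
          _ ≤ _ := by gcongr; exact ha.1
      simp only [min_eq_right this]
    rw [this]
    have hsub := intervalIntegral.integral_comp_mul_deriv (a := 0) (b := t/2) (f := Real.cos)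
      (f' := fun x => - Real.sin x) (g := fun a : ℝ => (Real.sqrt (1 - a^2))^3)
      (fun x _ => Real.hasDerivAt_cos x) (by fun_prop) (by fun_prop)
    rw [Real.cos_zero] at hsub
    rw [intervalIntegral.integral_symm, ← hsub, ← intervalIntegral.integral_neg]
    apply intervalIntegral.integral_congr
    intro x hx
    rw [Set.uIcc_of_le (by linarith)] at hx
    have h1 : 0 ≤ Real.sin x := Real.sin_nonneg_of_nonneg_of_le_pi hx.1 (by linarith [hx.2])
    have : Real.sqrt (1 - Real.cos x^2) = Real.sin x := by
      rw [← Real.sin_sq, Real.sqrt_sq h1]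
    simp only [Function.comp, this]; ring
  rw [I1, I2, integral_sin_pow, integral_sin_sq]
  have : Real.sin t = 2 * Real.sin (t/2) * Real.cos (t/2) := by
    rw [← Real.sin_two_mul]; congr 1; ring
  rw [this]
  simp
  ring

lemma volV (t : ℝ) (ht0 : 0 ≤ t) (ht : t < Real.pi) :
    volume {q : Fin 4 → ℝ | q 0^2 + q 1^2 + q 2^2 + q 3^2 ≤ 1 ∧
      q 1^2 + q 2^2 + q 3^2 ≤ Real.tan (t/2)^2 * q 0^2}
    = ENNReal.ofReal (Real.pi / 2 * (t - Real.sin t)) := by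
  have hc : 0 < Real.cos (t/2) := Real.cos_pos_of_mem_Ioo ⟨by linarith, by linarith⟩
  have hs : 0 ≤ Real.sin (t/2) := Real.sin_nonneg_of_nonneg_of_le_pi (by linarith) (by linarith)
  have htan0 : 0 ≤ Real.tan (t/2) := by rw [Real.tan_eq_sin_div_cos]; positivity
  set τ := Real.tan (t/2) with hτ
  set W : Set (ℝ × (Fin 3 → ℝ)) := {x | x.1^2 + x.2 0^2 + x.2 1^2 + x.2 2^2 ≤ 1 ∧
      x.2 0^2 + x.2 1^2 + x.2 2^2 ≤ τ^2 * x.1^2} with hW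
  have hWm : MeasurableSet W := by
    have h1 : Measurable fun x : ℝ × (Fin 3 → ℝ) => x.1^2 + x.2 0^2 + x.2 1^2 + x.2 2^2 := by fun_prop
    have h2 : Measurable fun x : ℝ × (Fin 3 → ℝ) => x.2 0^2 + x.2 1^2 + x.2 2^2 := by fun_prop
    have h3 : Measurable fun x : ℝ × (Fin 3 → ℝ) => τ^2 * x.1^2 := by fun_prop
    exact (measurableSet_le h1 measurable_const).inter (measurableSet_le h2 h3)
  have hpre := (volume_preserving_piFinSuccAbove (fun _ : Fin 4 => ℝ) 0).measure_preimage
    hWm.nullMeasurableSet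
  have e : {q : Fin 4 → ℝ | q 0^2 + q 1^2 + q 2^2 + q 3^2 ≤ 1 ∧
      q 1^2 + q 2^2 + q 3^2 ≤ τ^2 * q 0^2} =
      (MeasurableEquiv.piFinSuccAbove (fun _ : Fin 4 => ℝ) 0) ⁻¹' W := by
    ext q
    rfl
  rw [e, hpre, Measure.volume_eq_prod, Measure.prod_apply hWm]
  have hslice : ∀ a : ℝ, volume (Prod.mk a ⁻¹' W) =
      ENNReal.ofReal (4 * Real.pi / 3 * (min (τ * |a|) (Real.sqrt (1 - |a|^2)))^3) := by
    intro a
    by_cases ha : a^2 ≤ 1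
    · rw [← vol3 _ (by positivity)]
      congr 1
      ext v
      have h1 : 0 ≤ 1 - |a|^2 := by rw [sq_abs]; linarith
      have hh : (min (τ * |a|) (Real.sqrt (1 - |a|^2)))^2 = min (τ^2 * a^2) (1 - a^2) := by
        rcases le_total (τ * |a|) (Real.sqrt (1 - |a|^2)) with h | h
        · rw [min_eq_left h, min_eq_left, mul_pow, sq_abs]
          rw [Real.le_sqrt (by positivity) h1, mul_pow, sq_abs] at h
          exact h
        · rw [min_eq_right h, min_eq_right, Real.sq_sqrt h1, sq_abs]
          rw [Real.sqrt_le_left (by positivity), mul_pow, sq_abs] at h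
          exact h
      simp only [hW, Set.mem_preimage, Set.mem_ofPred_eq, hh, le_min_iff]
      constructor
      · rintro ⟨h1, h2⟩; exact ⟨h2, by linarith⟩
      · rintro ⟨h1, h2⟩; exact ⟨by linarith, h1⟩
    · push Not at ha
      have h0 : Real.sqrt (1 - |a|^2) = 0 := Real.sqrt_eq_zero_of_nonpos (by rw [sq_abs]; linarith)
      rw [h0, min_eq_right (by positivity)]
      have : Prod.mk a ⁻¹' W = ∅ := by
        ext v
        simp only [hW, Set.mem_preimage, Set.mem_ofPred_eq, Set.mem_empty_iff_false, iff_false]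
        rintro ⟨h1, -⟩
        nlinarith [sq_nonneg (v 0), sq_nonneg (v 1), sq_nonneg (v 2)]
      rw [this]; simp
  simp_rw [hslice]
  have hz : ∀ a : ℝ, 1 ≤ a → 4 * Real.pi / 3 * (min (τ * a) (Real.sqrt (1 - a^2)))^3 = 0 := by
    intro a ha
    have h0 : Real.sqrt (1 - a^2) = 0 := Real.sqrt_eq_zero_of_nonpos (by nlinarith)
    have : 0 ≤ τ * a := by positivity
    rw [h0, min_eq_right this]; simp
  have hint : Integrable (fun a : ℝ => 4 * Real.pi / 3 * (min (τ * |a|) (Real.sqrt (1 - |a|^2)))^3) := by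
    apply Continuous.integrable_of_hasCompactSupport (by fun_prop)
    apply HasCompactSupport.intro (isCompact_Icc (a := (-1:ℝ)) (b := 1))
    intro x hx
    apply hz
    by_contra h
    push Not at h
    exact hx ⟨(abs_le.mp h.le).1, (abs_le.mp h.le).2⟩
  rw [← ofReal_integral_eq_lintegral_ofReal hint (Filter.Eventually.of_forall fun a => by positivity)]
  congr 1
  rw [integral_comp_abs (f := fun a => 4 * Real.pi / 3 * (min (τ * a) (Real.sqrt (1 - a^2)))^3)]
  have : ∫ a in Set.Ioi (0:ℝ), 4 * Real.pi / 3 * (min (τ * a) (Real.sqrt (1 - a^2)))^3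
      = ∫ a in Set.Ioc (0:ℝ) 1, 4 * Real.pi / 3 * (min (τ * a) (Real.sqrt (1 - a^2)))^3 := by
    apply setIntegral_eq_of_subset_of_forall_sdiff_eq_zero measurableSet_Ioi
      Set.Ioc_subset_Ioi_self
    intro x hx
    apply hz
    by_contra h
    push Not at h
    exact hx.2 ⟨hx.1, h.le⟩
  rw [this, ← intervalIntegral.integral_of_le zero_le_one, intervalIntegral.integral_const_mul,
    integ t ht0 ht]
  ring

lemma trace_rotQ (q : Fin 4 → ℝ) :
    (rotQ q).trace = 3 * q 0^2 - q 1^2 - q 2^2 - q 3^2 := by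
  simp [rotQ, Matrix.trace, Fin.sum_univ_succ]; ring

lemma volT (t : ℝ) (ht0 : 0 ≤ t) (ht : t ≤ Real.pi) :
    volume {q : Fin 4 → ℝ | nsq q ≤ 1 ∧ (1 + 2 * Real.cos t) * nsq q ≤ (rotQ q).trace}
    = ENNReal.ofReal (Real.pi / 2 * (t - Real.sin t)) := by
  rcases ht.lt_or_eq with h | rfl
  · rw [← volV t ht0 h]
    congr 1
    ext q
    simp only [Set.mem_ofPred_eq, trace_rotQ, nsq]
    refine and_congr_right fun _ => ?_
    have hc : 0 < Real.cos (t/2) := Real.cos_pos_of_mem_Ioo ⟨by linarith, by linarith⟩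
    have hsc := Real.sin_sq_add_cos_sq (t/2)
    have hct : Real.cos t = 2 * Real.cos (t/2)^2 - 1 := by
      rw [← Real.cos_two_mul]; congr 1; ring
    have hc2 : 0 < Real.cos (t/2)^2 := by positivity
    rw [Real.tan_eq_sin_div_cos, div_pow, div_mul_eq_mul_div, le_div_iff₀ hc2, hct]
    have hs : Real.sin (t/2)^2 = 1 - Real.cos (t/2)^2 := by linarith
    rw [hs]
    constructor <;> intro h <;> nlinarith
  · rw [Real.sin_pi]
    convert vol4 using 2
    · ext q
      simp only [Set.mem_ofPred_eq, trace_rotQ, nsq, Real.cos_pi]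
      refine ⟨fun h => h.1, fun h => ⟨h, ?_⟩⟩
      nlinarith [sq_nonneg (q 0)]
    · ring

lemma vol_rmul (p : Fin 4 → ℝ) (hp : nsq p = 1) (s : Set (Fin 4 → ℝ)) (hs : MeasurableSet s) :
    volume ((fun q => rmulM p *ᵥ q) ⁻¹' s) = volume s := by
  have hd : (rmulM p).det = 1 := by rw [det_rmulM, hp, one_pow]
  have h := Real.map_matrix_volume_pi_eq_smul_volume_pi (M := rmulM p) (by rw [hd]; exact one_ne_zero)
  rw [hd] at h
  simp only [inv_one, abs_one, ENNReal.ofReal_one, one_smul] at h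
  have hm : Measurable (Matrix.toLin' (rmulM p)) :=
    (LinearMap.continuous_of_finiteDimensional _).measurable
  conv_rhs => rw [← h, Measure.map_apply hm hs]
  rfl

instance : SecondCountableTopology (Matrix (Fin 3) (Fin 3) ℝ) :=
  inferInstanceAs (SecondCountableTopology (Fin 3 → Fin 3 → ℝ))

lemma cont_rotQ : Continuous rotQ := by
  refine continuous_matrix fun i j => ?_
  fin_cases i <;> fin_cases j <;> simp [rotQ] <;> fun_prop

lemma cont_nsq : Continuous nsq := by unfold nsq; fun_prop

/-- Let `m` be the normalized Haar probability measure on `SO(3)`, characterized as the unique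
Borel probability measure supported on `SO(3)` that is invariant under left translation by
every element of `SO(3)`.  Then for every `t ∈ [0, π]`, the `m`-measure of
`{A ∈ SO(3) : trace A ≥ 1 + 2 cos t}` equals `(t - sin t)/π`. -/
theorem so3_haar_trace_distribution
    (m : Measure (Matrix (Fin 3) (Fin 3) ℝ)) [IsProbabilityMeasure m]
    (hsupp : m SO3ᶜ = 0)
    (hinv : ∀ g ∈ SO3, Measure.map (fun A => g * A) m = m)
    (t : ℝ) (ht0 : 0 ≤ t) (htpi : t ≤ Real.pi) :
    m {A | A ∈ SO3 ∧ 1 + 2 * Real.cos t ≤ A.trace} =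
      ENNReal.ofReal ((t - Real.sin t) / Real.pi) := by
  set k := 1 + 2 * Real.cos t with hk
  set S : Set (Matrix (Fin 3) (Fin 3) ℝ) := {A | k ≤ A.trace} with hS
  have hSm : MeasurableSet S :=
    (isClosed_le continuous_const (continuous_id.matrix_trace)).measurableSet
  have hae : ∀ᵐ A ∂m, A ∈ SO3 := hsupp
  have hmS : m {A | A ∈ SO3 ∧ k ≤ A.trace} = m S := by
    apply measure_congr
    filter_upwards [hae] with A hA
    exact propext ⟨fun h => h.2, fun h => ⟨hA, h⟩⟩
  rw [hmS]
  set T : Set ((Fin 4 → ℝ) × Matrix (Fin 3) (Fin 3) ℝ) :=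
    {x | nsq x.1 ≤ 1 ∧ k * nsq x.1 ≤ (rotQ x.1 * x.2).trace} with hT
  have hTm : MeasurableSet T := by
    have c1 : Continuous fun x : (Fin 4 → ℝ) × Matrix (Fin 3) (Fin 3) ℝ => nsq x.1 :=
      cont_nsq.comp continuous_fst
    have c2 : Continuous fun x : (Fin 4 → ℝ) × Matrix (Fin 3) (Fin 3) ℝ =>
        (rotQ x.1 * x.2).trace :=
      ((cont_rotQ.comp continuous_fst).matrix_mul continuous_snd).matrix_trace
    exact ((isClosed_le c1 continuous_const).inter
      (isClosed_le (continuous_const.mul c1) c2)).measurableSet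
  set B : Set (Fin 4 → ℝ) := {q | nsq q ≤ 1} with hB
  have hBm : MeasurableSet B := (isClosed_le cont_nsq continuous_const).measurableSet
  have hBv : volume B = ENNReal.ofReal (Real.pi ^ 2 / 2) := vol4
  -- first computation: integrate over matrices first
  have E1 : (volume.prod m) T = m S * volume B := by
    rw [Measure.prod_apply hTm, ← setLIntegral_const, ← lintegral_indicator hBm]
    have h0 : ∀ᵐ q : Fin 4 → ℝ, q ≠ 0 := by
      simp [ae_iff]
    apply lintegral_congr_ae
    filter_upwards [h0] with q hq
    by_cases hqB : q ∈ B
    · rw [Set.indicator_of_mem hqB]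
      have hpos : 0 < nsq q := by
        have h0 : 0 ≤ nsq q := by unfold nsq; positivity
        refine lt_of_le_of_ne h0 fun h => hq ?_
        unfold nsq at h
        ext i
        fin_cases i <;> simp <;>
          nlinarith [sq_nonneg (q 0), sq_nonneg (q 1), sq_nonneg (q 2), sq_nonneg (q 3)]
      have hs : (Real.sqrt (nsq q))⁻¹ ^ 2 = (nsq q)⁻¹ := by
        rw [inv_pow, Real.sq_sqrt hpos.le]
      have hg : rotQ ((Real.sqrt (nsq q))⁻¹ • q) ∈ SO3 :=
        rotQ_SO3 _ (by rw [nsq_smul, hs, inv_mul_cancel₀ hpos.ne'])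
      have hgm : Measurable fun A : Matrix (Fin 3) (Fin 3) ℝ =>
          rotQ ((Real.sqrt (nsq q))⁻¹ • q) * A :=
        (continuous_const.matrix_mul continuous_id).measurable
      conv_rhs => rw [← hinv _ hg, Measure.map_apply hgm hSm]
      congr 1
      ext A
      simp only [hT, hS, Set.mem_preimage, Set.mem_ofPred_eq]
      rw [rotQ_smul, hs, Matrix.smul_mul, Matrix.trace_smul, smul_eq_mul, inv_mul_eq_div,
        le_div_iff₀ hpos]
      exact ⟨fun h => h.2, fun h => ⟨hqB, h⟩⟩
    · rw [Set.indicator_of_notMem hqB]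
      have : Prod.mk q ⁻¹' T = ∅ := by
        ext A
        simp only [hT, Set.mem_preimage, Set.mem_ofPred_eq, Set.mem_empty_iff_false, iff_false]
        exact fun h => hqB h.1
      rw [this, measure_empty]
  have E2 : (volume.prod m) T = ENNReal.ofReal (Real.pi / 2 * (t - Real.sin t)) := by
    rw [Measure.prod_apply_symm hTm]
    have : ∀ᵐ A ∂m, volume ((fun q => (q, A)) ⁻¹' T) =
        ENNReal.ofReal (Real.pi / 2 * (t - Real.sin t)) := by
      filter_upwards [hae] with A hA
      obtain ⟨p, hp, rfl⟩ := SO3_surj hA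
      rw [← volT t ht0 htpi, ← vol_rmul p hp
        {q : Fin 4 → ℝ | nsq q ≤ 1 ∧ (1 + 2 * Real.cos t) * nsq q ≤ (rotQ q).trace}]
      · congr 1
        ext q
        simp only [hT, Set.mem_preimage, Set.mem_ofPred_eq, nsq_mul, hp, mul_one, rotQ_mul, hk]
      · exact ((isClosed_le cont_nsq continuous_const).inter
          (isClosed_le (continuous_const.mul cont_nsq) cont_rotQ.matrix_trace)).measurableSet
    rw [lintegral_congr_ae this]
    simp
  rw [E1, hBv] at E2
  have hpi := Real.pi_pos
  have hpos : 0 < Real.pi ^ 2 / 2 := by positivity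
  have hne : ENNReal.ofReal (Real.pi ^ 2 / 2) ≠ 0 := by
    simpa using hpos
  refine (ENNReal.mul_left_inj hne ENNReal.ofReal_ne_top).mp ?_
  rw [E2, ← ENNReal.ofReal_mul (div_nonneg (by linarith [Real.sin_le ht0]) hpi.le)]
  congr 1
  field_simp
end

section
/- Let n ≥ 1 and let μ be a Borel probability measure on the invertible n×n complex matrices such that the functions A ↦ log⁺‖A‖_op and A ↦ log⁺‖A⁻¹‖_op are μ-integrable, and such that μ is unitarily invariant: for every unitary matrix U, the pushforward of μ under A ↦ U·A equals μ. Let σ be the uniform (rotation-invariant) probability measure on the unit sphere of ℂⁿ. Then ∫ log ρ(A) dμ(A) ≥ ∫ ( ∫ log ‖A·v‖ dσ(v) ) dμ(A), where ρ(A) denotes the spectral radius of A. -/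
open MeasureTheory

noncomputable instance (n : ℕ) : MeasurableSpace (Matrix (Fin n) (Fin n) ℂ) := borel _
instance (n : ℕ) : BorelSpace (Matrix (Fin n) (Fin n) ℂ) := ⟨rfl⟩
noncomputable instance (n : ℕ) : MeasurableSpace (EuclideanSpace ℂ (Fin n)) := borel _
instance (n : ℕ) : BorelSpace (EuclideanSpace ℂ (Fin n)) := ⟨rfl⟩

/-- The operator norm of an `n×n` complex matrix acting on `ℂⁿ` with the Hermitian norm. -/
noncomputable def opNormC {n : ℕ} (A : Matrix (Fin n) (Fin n) ℂ) : ℝ :=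
  ‖Matrix.toEuclideanCLM (𝕜 := ℂ) A‖

/-- The spectral radius of an `n×n` complex matrix: the maximum modulus of its eigenvalues. -/
noncomputable def specRadC {n : ℕ} (A : Matrix (Fin n) (Fin n) ℂ) : ℝ :=
  (spectralRadius ℂ A).toReal


section mainproof

open scoped Matrix.Norms.Frobenius ENNReal

/-- Block matrix with a `1 × 1` upper left corner. -/
def bl {n : ℕ} (a : ℂ) (b c : Fin n → ℂ) (D : Matrix (Fin n) (Fin n) ℂ) :
    Matrix (Fin (n+1)) (Fin (n+1)) ℂ :=
  Matrix.of (Fin.cons (Fin.cons a b) (fun i => Fin.cons (c i) (D i)))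

section blocks
variable {n : ℕ} (a : ℂ) (b c : Fin n → ℂ) (D : Matrix (Fin n) (Fin n) ℂ)

@[simp] lemma bl_00 : bl a b c D 0 0 = a := rfl
@[simp] lemma bl_0s (j : Fin n) : bl a b c D 0 j.succ = b j := rfl
@[simp] lemma bl_s0 (i : Fin n) : bl a b c D i.succ 0 = c i := rfl
@[simp] lemma bl_ss (i j : Fin n) : bl a b c D i.succ j.succ = D i j := rfl

lemma bl_ext {A B : Matrix (Fin (n+1)) (Fin (n+1)) ℂ} (h1 : A 0 0 = B 0 0)
    (h2 : ∀ j : Fin n, A 0 j.succ = B 0 j.succ) (h3 : ∀ j : Fin n, A j.succ 0 = B j.succ 0)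
    (h4 : ∀ i j : Fin n, A i.succ j.succ = B i.succ j.succ) : A = B := by
  ext i j
  refine Fin.cases ?_ (fun i => ?_) i <;> refine Fin.cases ?_ (fun j => ?_) j
  · exact h1
  · exact h2 j
  · exact h3 i
  · exact h4 i j

lemma bl_eta (A : Matrix (Fin (n+1)) (Fin (n+1)) ℂ) :
    A = bl (A 0 0) (fun j => A 0 j.succ) (fun j => A j.succ 0)
      (Matrix.of fun i j => A i.succ j.succ) := by
  apply bl_ext <;> intros <;> simp

lemma bl_mul (a' : ℂ) (b' c' : Fin n → ℂ) (D' : Matrix (Fin n) (Fin n) ℂ) :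
    bl a b c D * bl a' b' c' D' = bl (a * a' + b ⬝ᵥ c') (a • b' + Matrix.vecMul b D')
      (a' • c + D.mulVec c') (Matrix.vecMulVec c b' + D * D') := by
  apply bl_ext <;> intros <;>
    simp [Matrix.mul_apply, Fin.sum_univ_succ, dotProduct, Matrix.vecMul, Matrix.mulVec,
      Matrix.vecMulVec, mul_comm]

lemma bl_star : star (bl a b c D) = bl (star a) (star c) (star b) (star D) := by
  apply bl_ext <;> intros <;> simp [Matrix.star_apply]

lemma bl_one : (1 : Matrix (Fin (n+1)) (Fin (n+1)) ℂ) = bl 1 0 0 1 := by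
  apply bl_ext <;> intros <;> simp [Matrix.one_apply, Fin.succ_ne_zero]
  exact (Fin.succ_ne_zero _).symm

lemma bl_sub (a' : ℂ) (b' c' : Fin n → ℂ) (D' : Matrix (Fin n) (Fin n) ℂ) :
    bl a b c D - bl a' b' c' D' = bl (a - a') (b - b') (c - c') (D - D') := by
  apply bl_ext <;> intros <;> simp

lemma bl_add (a' : ℂ) (b' c' : Fin n → ℂ) (D' : Matrix (Fin n) (Fin n) ℂ) :
    bl a b c D + bl a' b' c' D' = bl (a + a') (b + b') (c + c') (D + D') := by
  apply bl_ext <;> intros <;> simp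

lemma bl_smul (t : ℂ) : t • bl a b c D = bl (t * a) (t • b) (t • c) (t • D) := by
  apply bl_ext <;> intros <;> simp

lemma bl_det_tri : (bl a b 0 D).det = a * D.det := by
  rw [Matrix.det_succ_column_zero, Fin.sum_univ_succ]
  simp only [bl_s0, Pi.zero_apply, mul_zero, zero_mul, Finset.sum_const_zero, add_zero, bl_00]
  have : (bl a b 0 D).submatrix (Fin.succAbove 0) Fin.succ = D := by
    ext i j; simp
  rw [this]; simp

end blocks

/-- Bi-unitary invariance. -/
def BiInv {n : ℕ} (g : Matrix (Fin n) (Fin n) ℂ → ℝ≥0∞) : Prop :=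
  ∀ U V : Matrix (Fin n) (Fin n) ℂ, star U * U = 1 → star V * V = 1 → ∀ B, g (U * B * V) = g B

instance (n : ℕ) : SecondCountableTopology (Matrix (Fin n) (Fin n) ℂ) :=
  inferInstanceAs (SecondCountableTopology (Fin n → Fin n → ℂ))
instance (n : ℕ) : LocallyCompactSpace (Matrix (Fin n) (Fin n) ℂ) :=
  inferInstanceAs (LocallyCompactSpace (Fin n → Fin n → ℂ))

/-- Additive Haar measure on matrices. -/
noncomputable def volM (n : ℕ) : Measure (Matrix (Fin n) (Fin n) ℂ) := Measure.addHaar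

instance (n : ℕ) : (volM n).IsAddHaarMeasure := by unfold volM; infer_instance
instance (n : ℕ) : SigmaFinite (volM n) := inferInstance
instance (n : ℕ) : SFinite (volM n) := inferInstance

lemma pres_of_quad {E : Type*} [NormedAddCommGroup E] [NormedSpace ℝ E] [FiniteDimensional ℝ E]
    [MeasurableSpace E] [BorelSpace E] (μ : Measure E) [μ.IsAddHaarMeasure]
    (T : E →ₗ[ℝ] E) (N : E → ℝ) (hN : Continuous N) (hT : ∀ x, N (T x) = N x) (h0 : N 0 = 0)
    (hb : ∀ x, ‖x‖ ^ 2 ≤ N x) : MeasurePreserving T μ μ := by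
  have hinj : LinearMap.ker T = ⊥ := by
    rw [LinearMap.ker_eq_bot']
    intro x hx
    have := hb x
    rw [← hT, hx, h0] at this
    have h2 : ‖x‖ ^ 2 = 0 := le_antisymm this (by positivity)
    simpa using h2
  have hdet : LinearMap.det T ≠ 0 := by
    intro h
    have := LinearMap.bot_lt_ker_of_det_eq_zero h
    rw [hinj] at this
    exact lt_irrefl _ this
  have hTc : Continuous T := T.continuous_of_finiteDimensional
  set K : Set E := {x | N x < 1}
  have hKo : IsOpen K := isOpen_lt hN continuous_const
  have hK0 : μ K ≠ 0 := (hKo.measure_pos μ ⟨0, by simp [K, h0]⟩).ne'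
  have hKb : μ K ≠ ∞ := by
    have : K ⊆ Metric.closedBall 0 1 := by
      intro x hx
      have h1 := hb x
      have h2 : N x < 1 := hx
      rw [mem_closedBall_zero_iff]
      nlinarith [norm_nonneg x]
    exact ((measure_mono this).trans_lt measure_closedBall_lt_top).ne
  have hpre : T ⁻¹' K = K := by ext x; simp [K, hT]
  have h1 := Measure.addHaar_preimage_linearMap μ hdet K
  rw [hpre] at h1
  have h2 : ENNReal.ofReal |(LinearMap.det T)⁻¹| = 1 := by
    rwa [eq_comm, ENNReal.mul_eq_right hK0 hKb] at h1
  refine ⟨hTc.measurable, ?_⟩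
  rw [Measure.map_linearMap_addHaar_eq_smul_addHaar μ hdet, h2, one_smul]


section part2
variable {n : ℕ}

lemma continuous_bl : Continuous (fun p : (ℂ × (Fin n → ℂ)) × ((Fin n → ℂ) × Matrix (Fin n) (Fin n) ℂ) =>
    bl p.1.1 p.2.1 p.1.2 p.2.2) := by
  refine continuous_matrix ?_
  intro i j
  refine Fin.cases ?_ (fun i => ?_) i <;> refine Fin.cases ?_ (fun j => ?_) j
  · simp only [bl_00]; fun_prop
  · simp only [bl_0s]; fun_prop
  · simp only [bl_s0]; fun_prop
  · simp only [bl_ss]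
    exact (continuous_snd.comp continuous_snd).matrix_elem i j

/-- Block coordinates as a linear equivalence. -/
def blL (n : ℕ) : ((ℂ × (Fin n → ℂ)) × ((Fin n → ℂ) × Matrix (Fin n) (Fin n) ℂ)) ≃ₗ[ℝ]
    Matrix (Fin (n+1)) (Fin (n+1)) ℂ where
  toFun p := bl p.1.1 p.2.1 p.1.2 p.2.2
  invFun A := ((A 0 0, fun j => A j.succ 0), (fun j => A 0 j.succ, Matrix.of fun i j => A i.succ j.succ))
  map_add' p q := by simp [bl_add]
  map_smul' t p := by apply bl_ext <;> intros <;> simp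
  left_inv p := by
    rcases p with ⟨⟨a, c⟩, b, D⟩
    simp only [bl_00, bl_s0, bl_0s, bl_ss]
    rfl
  right_inv A := (bl_eta A).symm

lemma exists_kbl (n : ℕ) : ∃ k : ℝ≥0∞, ∀ f : Matrix (Fin (n+1)) (Fin (n+1)) ℂ → ℝ≥0∞,
    ∫⁻ B, f B ∂(volM (n+1)) = k * ∫⁻ p : (ℂ × (Fin n → ℂ)) × ((Fin n → ℂ) × Matrix (Fin n) (Fin n) ℂ),
      f (bl p.1.1 p.2.1 p.1.2 p.2.2)
        ∂((volume.prod volume).prod (volume.prod (volM n))) := by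
  let e := (blL n).toContinuousLinearEquiv
  let ν : Measure ((ℂ × (Fin n → ℂ)) × ((Fin n → ℂ) × Matrix (Fin n) (Fin n) ℂ)) :=
    (volume.prod volume).prod (volume.prod (volM n))
  have i1 : (Measure.prod (volume : Measure ℂ) (volume : Measure (Fin n → ℂ))).IsAddHaarMeasure :=
    Measure.prod.instIsAddHaarMeasure _ _
  have i2 : (Measure.prod (volume : Measure (Fin n → ℂ)) (volM n)).IsAddHaarMeasure :=
    Measure.prod.instIsAddHaarMeasure _ _
  have i3 : ν.IsAddHaarMeasure := Measure.prod.instIsAddHaarMeasure _ _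
  have h1 : (ν.map e).IsAddHaarMeasure := e.isAddHaarMeasure_map ν
  have h2 := Measure.isAddLeftInvariant_eq_smul (volM (n+1)) (ν.map e)
  refine ⟨((volM (n+1)).addHaarScalarFactor (ν.map e) : NNReal), fun f => ?_⟩
  conv_lhs => rw [h2]
  rw [ENNReal.smul_def, lintegral_smul_measure, smul_eq_mul]
  congr 1
  exact lintegral_map_equiv f e.toHomeomorph.toMeasurableEquiv

/-- The Haar constant. -/
noncomputable def kbl (n : ℕ) : ℝ≥0∞ := (exists_kbl n).choose

lemma lintegral_bl (f : Matrix (Fin (n+1)) (Fin (n+1)) ℂ → ℝ≥0∞) :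
    ∫⁻ B, f B ∂(volM (n+1)) = kbl n * ∫⁻ p : (ℂ × (Fin n → ℂ)) × ((Fin n → ℂ) × Matrix (Fin n) (Fin n) ℂ),
      f (bl p.1.1 p.2.1 p.1.2 p.2.2)
        ∂((volume.prod volume).prod (volume.prod (volM n))) := (exists_kbl n).choose_spec f

lemma exists_unitary_col (w : Fin (n+1) → ℂ) (hw : ∑ i, ‖w i‖ ^ 2 = 1) :
    ∃ U : Matrix (Fin (n+1)) (Fin (n+1)) ℂ, star U * U = 1 ∧ ∀ i, U i 0 = w i := by
  let v : Fin (n+1) → EuclideanSpace ℂ (Fin (n+1)) := fun _ => WithLp.toLp 2 w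
  have hv : Orthonormal ℂ (({0} : Set (Fin (n+1))).domRestrict v) := by
    constructor
    · rintro ⟨i, hi⟩
      simp [v, EuclideanSpace.norm_eq, hw]
    · rintro ⟨i, hi⟩ ⟨j, hj⟩ hij
      exact absurd (Subtype.ext (hi.trans hj.symm)) hij
  obtain ⟨b, hb⟩ := hv.exists_orthonormalBasis_extension_of_card_eq (by simp)
  refine ⟨Matrix.of fun i j => b j i, ?_, fun i => ?_⟩
  · ext i j
    have := orthonormal_iff_ite.1 b.orthonormal i j
    simp only [Matrix.mul_apply, Matrix.star_apply, Matrix.of_apply, Matrix.one_apply]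
    rw [← this, PiLp.inner_apply]
    simp [mul_comm]
  · simp [hb 0 rfl, v]

lemma abs_det_real {E : Type*} [AddCommGroup E] [Module ℂ E] [FiniteDimensional ℂ E]
    (T : E →ₗ[ℂ] E) : |LinearMap.det (T.restrictScalars ℝ)| = ‖LinearMap.det T‖ ^ 2 := by
  rw [LinearMap.det_restrictScalars]
  rw [Algebra.norm_complex_apply, Complex.normSq_eq_norm_sq]
  simp

lemma lintegral_lin {E : Type*} [NormedAddCommGroup E] [NormedSpace ℂ E] [FiniteDimensional ℂ E]
    [MeasurableSpace E] [BorelSpace E] (μ : Measure E) [μ.IsAddHaarMeasure]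
    (T : E →ₗ[ℂ] E) (hT : LinearMap.det T ≠ 0) (f : E → ℝ≥0∞) :
    ∫⁻ x, f x ∂μ = ENNReal.ofReal (‖LinearMap.det T‖ ^ 2) * ∫⁻ x, f (T x) ∂μ := by
  have : FiniteDimensional ℝ E := FiniteDimensional.complexToReal E
  have h0 := abs_det_real T
  have hT' : LinearMap.det (T.restrictScalars ℝ) ≠ 0 := by
    intro h; rw [h] at h0; simp at h0; exact hT (by simpa using h0.symm)
  have h1 := Measure.map_linearMap_addHaar_eq_smul_addHaar μ hT'
  let e' : E ≃ₜ E := ((LinearMap.equivOfDetNeZero T hT).toContinuousLinearEquiv).toHomeomorph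
  have h2 : ∫⁻ x, f x ∂(μ.map (T.restrictScalars ℝ)) = ∫⁻ x, f (T x) ∂μ :=
    lintegral_map_equiv f e'.toMeasurableEquiv
  rw [← h2, h1, abs_inv, h0, lintegral_smul_measure, smul_eq_mul, ← mul_assoc, ← ENNReal.ofReal_mul (by positivity),
    mul_inv_cancel₀ (by simpa using hT)]
  simp

end part2


section part3
variable {n : ℕ}

instance borelFrob (n : ℕ) : @BorelSpace (Matrix (Fin n) (Fin n) ℂ)
    (@UniformSpace.toTopologicalSpace _ (@PseudoMetricSpace.toUniformSpace _
      (@SeminormedAddCommGroup.toPseudoMetricSpace _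
        (@NormedAddCommGroup.toSeminormedAddCommGroup _ Matrix.frobeniusNormedAddCommGroup)))) _ :=
  ⟨rfl⟩

instance borelFrob2 (n : ℕ) : @BorelSpace ((Fin n → ℂ) × Matrix (Fin n) (Fin n) ℂ)
    (@UniformSpace.toTopologicalSpace _ (@PseudoMetricSpace.toUniformSpace _
      (@SeminormedAddCommGroup.toPseudoMetricSpace _
        (@NormedAddCommGroup.toSeminormedAddCommGroup _ Prod.normedAddCommGroup)))) _ :=
  ⟨(Prod.borelSpace (α := Fin n → ℂ) (β := Matrix (Fin n) (Fin n) ℂ)).measurable_eq⟩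

instance haarFrob (n : ℕ) : @Measure.IsAddHaarMeasure (Matrix (Fin n) (Fin n) ℂ) _
    (@UniformSpace.toTopologicalSpace _ (@PseudoMetricSpace.toUniformSpace _
      (@SeminormedAddCommGroup.toPseudoMetricSpace _
        (@NormedAddCommGroup.toSeminormedAddCommGroup _ Matrix.frobeniusNormedAddCommGroup)))) _ (volM n) :=
  inferInstanceAs (volM n).IsAddHaarMeasure

instance haarFrob2 (n : ℕ) : @Measure.IsAddHaarMeasure ((Fin n → ℂ) × Matrix (Fin n) (Fin n) ℂ) _
    (@UniformSpace.toTopologicalSpace _ (@PseudoMetricSpace.toUniformSpace _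
      (@SeminormedAddCommGroup.toPseudoMetricSpace _
        (@NormedAddCommGroup.toSeminormedAddCommGroup _ Prod.normedAddCommGroup)))) _
        ((volume : Measure (Fin n → ℂ)).prod (volM n)) :=
  Measure.prod.instIsAddHaarMeasure (volume : Measure (Fin n → ℂ)) (volM n)

/-- vectorisation as linear equivalence -/
noncomputable def vecL (n : ℕ) : Matrix (Fin n) (Fin n) ℂ ≃ₗ[ℂ] (Fin n × Fin n → ℂ) :=
  LinearEquiv.ofBijective
    { toFun := Matrix.vec, map_add' := Matrix.vec_add, map_smul' := Matrix.vec_smul }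
    Matrix.vec_bijective

/-- `C ↦ P C Q` -/
def LRmap (P Q : Matrix (Fin n) (Fin n) ℂ) : Matrix (Fin n) (Fin n) ℂ →ₗ[ℂ] Matrix (Fin n) (Fin n) ℂ where
  toFun C := P * C * Q
  map_add' := by intros; simp [mul_add, add_mul]
  map_smul' := by intros; simp

lemma det_LRmap (P Q : Matrix (Fin n) (Fin n) ℂ) :
    LinearMap.det (LRmap P Q) = Q.det ^ n * P.det ^ n := by
  rw [← LinearMap.det_conj (LRmap P Q) (vecL n)]
  have : ((vecL n : _ →ₗ[ℂ] _) ∘ₗ LRmap P Q ∘ₗ ((vecL n).symm : _ →ₗ[ℂ] _)) =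
      Matrix.toLin' (Matrix.kronecker Q.transpose P) := by
    apply LinearMap.ext
    intro x
    obtain ⟨X, rfl⟩ := (vecL n).surjective x
    simp only [LinearMap.comp_apply, LinearEquiv.coe_coe, LinearEquiv.symm_apply_apply,
      Matrix.toLin'_apply]
    have := Matrix.kronecker_mulVec_vec P X Q.transpose
    rw [Matrix.transpose_transpose] at this
    exact this.symm
  rw [this, LinearMap.det_toLin']
  have := Matrix.det_kronecker Q.transpose P
  simp at this
  exact this

lemma lintegral_LR (P Q : Matrix (Fin n) (Fin n) ℂ) (h : ‖Q.det‖ * ‖P.det‖ = 1)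
    (f : Matrix (Fin n) (Fin n) ℂ → ℝ≥0∞) :
    ∫⁻ C, f (P * C * Q) ∂(volM n) = ∫⁻ C, f C ∂(volM n) := by
  have h1 : ‖LinearMap.det (LRmap P Q)‖ = 1 := by
    rw [det_LRmap, norm_mul, norm_pow, norm_pow, ← mul_pow, h, one_pow]
  have := lintegral_lin (volM n) (LRmap P Q) (by intro h0; rw [h0] at h1; simp at h1) f
  rw [this, h1]
  simp [LRmap]

lemma norm_det_unitary {U : Matrix (Fin n) (Fin n) ℂ} (h : star U * U = 1) : ‖U.det‖ = 1 := by
  have h1 := congrArg Matrix.det h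
  rw [Matrix.det_mul, Matrix.star_eq_conjTranspose, Matrix.det_conjTranspose, Matrix.det_one] at h1
  have h2 := congrArg norm h1
  rw [norm_mul, norm_star, norm_one] at h2
  nlinarith [norm_nonneg U.det]

lemma lintegral_vecMul (V : Matrix (Fin n) (Fin n) ℂ) (hV : V.det ≠ 0) (f : (Fin n → ℂ) → ℝ≥0∞) :
    ∫⁻ b, f b = ENNReal.ofReal (‖V.det‖ ^ 2) * ∫⁻ b, f (Matrix.vecMul b V) := by
  have h0 : LinearMap.det (Matrix.toLin' V.transpose) = V.det := by
    rw [LinearMap.det_toLin', Matrix.det_transpose]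
  have := lintegral_lin (volume : Measure (Fin n → ℂ)) (Matrix.toLin' V.transpose)
    (by rwa [h0]) f
  rw [this, h0]
  simp [Matrix.toLin'_apply, Matrix.mulVec_transpose]

lemma image_ineq {E : Type*} [NormedAddCommGroup E] [NormedSpace ℝ E] [FiniteDimensional ℝ E]
    [MeasurableSpace E] [BorelSpace E] (μ : Measure E) [μ.IsAddHaarMeasure]
    (f : E → E) (f' : E → E →L[ℝ] E) (s : Set E) (hs : MeasurableSet s)
    (hf' : ∀ x, HasFDerivAt f (f' x) x) (hd : Measurable fun x => ENNReal.ofReal |(f' x).det|)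
    (u : E → ℝ≥0∞) (hu : Measurable u) (hus : ∀ x, u x ≠ 0 → x ∈ f '' s) :
    ∫⁻ x, u x ∂μ ≤ ∫⁻ x in s, ENNReal.ofReal |(f' x).det| * u (f x) ∂μ := by
  have hfc : Continuous f := continuous_iff_continuousAt.2 fun x => (hf' x).continuousAt
  set A : Set E := {x | u x ≠ 0}
  have hA : MeasurableSet A := hu (measurableSet_singleton 0).compl
  set d : E → ℝ≥0∞ := fun x => ENNReal.ofReal |(f' x).det| with hddef
  have key : μ.restrict A ≤ Measure.map f ((μ.restrict s).withDensity d) := by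
    refine Measure.le_iff.2 fun T hT => ?_
    rw [Measure.restrict_apply hT, Measure.map_apply hfc.measurable hT,
      withDensity_apply _ (hfc.measurable hT), Measure.restrict_restrict (hfc.measurable hT)]
    refine le_trans (measure_mono ?_) (addHaar_image_le_lintegral_abs_det_fderiv μ
      ((hfc.measurable hT).inter hs) (fun x _ => (hf' x).hasFDerivWithinAt))
    rintro x ⟨hxT, hxA⟩
    obtain ⟨y, hy, rfl⟩ := hus x hxA
    exact ⟨y, ⟨hxT, hy⟩, rfl⟩
  calc ∫⁻ x, u x ∂μ = ∫⁻ x in A, u x ∂μ := by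
        rw [← lintegral_indicator hA]
        congr 1; ext x
        by_cases hx : u x = 0 <;> simp [Set.indicator, A, hx]
    _ ≤ ∫⁻ x, u x ∂(Measure.map f ((μ.restrict s).withDensity d)) :=
        lintegral_mono' key le_rfl
    _ = ∫⁻ x in s, d x * u (f x) ∂μ := by
        rw [lintegral_map hu hfc.measurable,
          lintegral_withDensity_eq_lintegral_mul _ hd (g := fun x => u (f x)) (hu.comp hfc.measurable)]
        rfl

/-- Action of a matrix on the last `n` columns. -/
noncomputable def colAct (U : Matrix (Fin (n+1)) (Fin (n+1)) ℂ) :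
    ((Fin n → ℂ) × Matrix (Fin n) (Fin n) ℂ) →ₗ[ℝ] ((Fin n → ℂ) × Matrix (Fin n) (Fin n) ℂ) where
  toFun p := (fun j => (U * bl 0 p.1 0 p.2) 0 j.succ,
    Matrix.of fun i j => (U * bl 0 p.1 0 p.2) i.succ j.succ)
  map_add' p q := by
    have : bl 0 (p + q).1 0 (p + q).2 = bl 0 p.1 0 p.2 + bl 0 q.1 0 q.2 := by
      rw [bl_add]; simp
    simp only [this, mul_add]
    rfl
  map_smul' t p := by
    have : bl 0 (t • p).1 0 (t • p).2 = t • bl 0 p.1 0 p.2 := by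
      apply bl_ext <;> intros <;> simp
    simp only [this, Matrix.mul_smul]
    rfl

lemma colAct_bl (U : Matrix (Fin (n+1)) (Fin (n+1)) ℂ) (a : ℂ) (c : Fin n → ℂ)
    (p : (Fin n → ℂ) × Matrix (Fin n) (Fin n) ℂ) :
    U * bl a p.1 c p.2 = bl (U.mulVec (Fin.cons a c) 0) (colAct U p).1
      (fun i => U.mulVec (Fin.cons a c) i.succ) (colAct U p).2 := by
  apply bl_ext <;> intros <;>
    simp [colAct, Matrix.mul_apply, Fin.sum_univ_succ, Matrix.mulVec, dotProduct]

lemma sum_sq_mulVec_unitary {m : ℕ} {U : Matrix (Fin m) (Fin m) ℂ} (hU : star U * U = 1) (v : Fin m → ℂ) :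
    ∑ i, ‖(U.mulVec v) i‖ ^ 2 = ∑ i, ‖v i‖ ^ 2 := by
  have key : ∀ w : Fin m → ℂ, ((∑ i, ‖w i‖ ^ 2 : ℝ) : ℂ) = star w ⬝ᵥ w := by
    intro w
    simp only [dotProduct, Pi.star_apply]
    push_cast
    refine Finset.sum_congr rfl fun i _ => ?_
    have := Complex.conj_mul' (w i)
    rw [← this]; rfl
  have : ((∑ i, ‖(U.mulVec v) i‖ ^ 2 : ℝ) : ℂ) = ((∑ i, ‖v i‖ ^ 2 : ℝ) : ℂ) := by
    rw [key, key, Matrix.star_mulVec, Matrix.dotProduct_mulVec, Matrix.vecMul_vecMul,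
      ← Matrix.star_eq_conjTranspose, hU, Matrix.vecMul_one]
  exact_mod_cast this

lemma norm_sq_le_sum {m : ℕ} (b : Fin m → ℂ) : ‖b‖ ^ 2 ≤ ∑ j, ‖b j‖ ^ 2 := by
  have h0 : 0 ≤ ∑ j, ‖b j‖ ^ 2 := Finset.sum_nonneg fun _ _ => by positivity
  have : ‖b‖ ≤ Real.sqrt (∑ j, ‖b j‖ ^ 2) := by
    rw [pi_norm_le_iff_of_nonneg (Real.sqrt_nonneg _)]
    intro i
    apply Real.le_sqrt_of_sq_le
    exact Finset.single_le_sum (f := fun j => ‖b j‖ ^ 2) (fun _ _ => by positivity) (Finset.mem_univ i)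
  calc ‖b‖ ^ 2 ≤ Real.sqrt (∑ j, ‖b j‖ ^ 2) ^ 2 := by gcongr
    _ = _ := Real.sq_sqrt h0

lemma frob_sq {m : ℕ} (D : Matrix (Fin m) (Fin m) ℂ) : ‖D‖ ^ 2 = ∑ i, ∑ j, ‖D i j‖ ^ 2 := by
  rw [Matrix.frobenius_norm_def]
  rw [← Real.sqrt_eq_rpow, Real.sq_sqrt]
  · simp
  · positivity

lemma pres_colAct {U : Matrix (Fin (n+1)) (Fin (n+1)) ℂ} (hU : star U * U = 1) :
    MeasurePreserving (colAct U) ((volume : Measure (Fin n → ℂ)).prod (volM n))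
      ((volume : Measure (Fin n → ℂ)).prod (volM n)) := by
  refine pres_of_quad _ (colAct U) (fun p => ∑ j, (‖p.1 j‖ ^ 2 + ∑ i, ‖p.2 i j‖ ^ 2)) ?_ ?_ ?_ ?_
  · refine continuous_finsetSum _ fun j _ => Continuous.add ?_ (continuous_finsetSum _ fun i _ => ?_)
    · fun_prop
    · exact (continuous_snd.matrix_elem i j).norm.pow 2
  · intro p
    refine Finset.sum_congr rfl fun j _ => ?_
    have := sum_sq_mulVec_unitary hU (Fin.cons (p.1 j) (fun i => p.2 i j))
    rw [Fin.sum_univ_succ, Fin.sum_univ_succ] at this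
    simp only [Fin.cons_zero, Fin.cons_succ] at this
    rw [← this]
    simp [colAct, Matrix.mul_apply, Fin.sum_univ_succ, Matrix.mulVec, dotProduct]
  · simp
  · intro p
    rw [Finset.sum_add_distrib, Finset.sum_comm]
    have h1 := norm_sq_le_sum p.1
    have h2 := frob_sq p.2
    rw [Prod.norm_def]
    rcases max_cases ‖p.1‖ ‖p.2‖ with h | h <;> rw [h.1]
    · have : 0 ≤ ∑ i, ∑ j, ‖p.2 i j‖ ^ 2 := by positivity
      linarith
    · have : 0 ≤ ∑ j, ‖p.1 j‖ ^ 2 := by positivity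
      linarith

end part3


section part4
variable {n : ℕ}

/-- extended spectral radius -/
noncomputable def rho (B : Matrix (Fin n) (Fin n) ℂ) : ℝ≥0∞ := spectralRadius ℂ B

lemma mem_spec_iff (B : Matrix (Fin n) (Fin n) ℂ) (z : ℂ) :
    z ∈ spectrum ℂ B ↔ (z • 1 - B).det = 0 := by
  rw [spectrum.mem_iff, Matrix.isUnit_iff_isUnit_det, Algebra.algebraMap_eq_smul_one, isUnit_iff_ne_zero,
    not_not]

lemma rho_le_iff (B : Matrix (Fin n) (Fin n) ℂ) (s : ℝ≥0∞) :
    rho B ≤ s ↔ ∀ z : ℂ, (z • 1 - B).det = 0 → ‖z‖ₑ ≤ s := by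
  simp only [rho, spectralRadius, iSup_le_iff, mem_spec_iff]
  rfl

lemma exists_top (B : Matrix (Fin (n+1)) (Fin (n+1)) ℂ) :
    ∃ z : ℂ, (z • 1 - B).det = 0 ∧ ‖z‖ₑ = rho B := by
  obtain ⟨z, hz, h⟩ := spectrum.exists_nnnorm_eq_spectralRadius B
  exact ⟨z, (mem_spec_iff B z).1 hz, h⟩

lemma rho_ne_top (B : Matrix (Fin n) (Fin n) ℂ) : rho B ≠ ∞ := by
  cases n with
  | zero =>
    have : rho B ≤ 0 := by
      rw [rho_le_iff]; intro z h; simp at h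
    exact (this.trans_lt ENNReal.zero_lt_top).ne
  | succ n =>
    obtain ⟨z, _, h⟩ := exists_top B
    rw [← h]; simp

lemma isOpen_rho_lt (s : ℝ≥0∞) : IsOpen {B : Matrix (Fin n) (Fin n) ℂ | rho B < s} := by
  cases n with
  | zero =>
    exact isOpen_discrete _
  | succ n =>
    rw [isOpen_iff_mem_nhds]
    intro B hB
    have h := upperHemicontinuous_spectrum ℂ (Matrix (Fin (n+1)) (Fin (n+1)) ℂ)
    rw [upperHemicontinuous_iff] at h
    have h2 := h B
    rw [upperHemicontinuousAt_iff_forall_isOpen] at h2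
    have h3 := h2 {z | ‖z‖ₑ < s} (isOpen_lt continuous_enorm continuous_const) (by
      intro z hz
      exact lt_of_le_of_lt ((rho_le_iff B _).1 le_rfl z ((mem_spec_iff B z).1 hz)) hB)
    filter_upwards [h3] with A hA
    obtain ⟨z, hz, he⟩ := exists_top A
    show rho A < s
    rw [← he]
    exact hA ((mem_spec_iff A z).2 hz)

lemma measurable_rho : Measurable (rho : Matrix (Fin n) (Fin n) ℂ → ℝ≥0∞) :=
  measurable_of_Iio fun s => (isOpen_rho_lt s).measurableSet

lemma det_conj_sub {P Q C : Matrix (Fin n) (Fin n) ℂ} (h : P * Q = 1) (z : ℂ) :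
    (z • 1 - P * C * Q).det = (z • 1 - C).det := by
  have h' : Q * P = 1 := mul_eq_one_comm.1 h
  have : z • 1 - P * C * Q = P * (z • 1 - C) * Q := by
    rw [mul_sub, sub_mul]
    simp [h]
  rw [this, Matrix.det_mul, Matrix.det_mul, mul_right_comm, ← Matrix.det_mul, h, Matrix.det_one, one_mul]

lemma rho_conj {P Q C : Matrix (Fin n) (Fin n) ℂ} (h : P * Q = 1) : rho (P * C * Q) = rho C := by
  refine eq_of_forall_ge_iff fun s => ?_
  simp only [rho_le_iff, det_conj_sub h]

lemma det_sub_bl (a : ℂ) (b : Fin n → ℂ) (C : Matrix (Fin n) (Fin n) ℂ) (z : ℂ) :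
    (z • 1 - bl a b 0 C).det = (z - a) * (z • 1 - C).det := by
  rw [bl_one, bl_smul, bl_sub]
  have : z • (0 : Fin n → ℂ) - 0 = 0 := by simp
  rw [this, bl_det_tri, mul_one]

/-- Krylov matrix -/
def kry {R : Type*} [CommRing R] (B : Matrix (Fin (n+1)) (Fin (n+1)) R) : Matrix (Fin (n+1)) (Fin (n+1)) R :=
  Matrix.of fun i j => (B ^ (i : ℕ)) 0 j

lemma kry_map {R S : Type*} [CommRing R] [CommRing S] (φ : R →+* S) (B : Matrix (Fin (n+1)) (Fin (n+1)) R) :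
    (kry B).map φ = kry (B.map φ) := by
  ext i j
  have := Matrix.map_pow B φ (i : ℕ)
  simp [kry, ← this]

/-- shift -/
def shiftM (n : ℕ) : Matrix (Fin (n+1)) (Fin (n+1)) ℂ :=
  Matrix.of fun i j => if (j : ℕ) = (i : ℕ) + 1 then 1 else 0

lemma kry_shift : kry (shiftM n) = 1 := by
  have key : ∀ k : ℕ, k < n + 1 → ∀ j : Fin (n+1), (shiftM n ^ k) 0 j = if (j : ℕ) = k then 1 else 0 := by
    intro k
    induction k with
    | zero => 
      intro _ j
      simp only [pow_zero, Matrix.one_apply, Fin.ext_iff, Fin.val_zero]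
      simp only [eq_comm]
    | succ k ih =>
      intro hk j
      rw [pow_succ, Matrix.mul_apply, Finset.sum_eq_single (⟨k, by omega⟩ : Fin (n+1))]
      · rw [ih (by omega)]; simp [shiftM]
      · intro l _ hl
        rw [ih (by omega), if_neg, zero_mul]
        intro h; exact hl (Fin.ext h)
      · simp
  ext i j
  simp only [kry, Matrix.of_apply, key i i.2, Matrix.one_apply, Fin.ext_iff]
  simp only [eq_comm]

lemma kry_eig {B : Matrix (Fin (n+1)) (Fin (n+1)) ℂ} {w : Fin (n+1) → ℂ} {z : ℂ} (hw : w ≠ 0)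
    (h : B.mulVec w = z • w) (h0 : w 0 = 0) : (kry B).det = 0 := by
  rw [← Matrix.exists_mulVec_eq_zero_iff]
  refine ⟨w, hw, ?_⟩
  have key : ∀ k : ℕ, (B ^ k).mulVec w = z ^ k • w := by
    intro k
    induction k with
    | zero => simp
    | succ k ih => rw [pow_succ, ← Matrix.mulVec_mulVec, h, Matrix.mulVec_smul, ih, smul_smul, pow_succ, mul_comm]
  ext i
  have := congrFun (key i) 0
  simp only [Pi.smul_apply, h0, smul_zero] at this
  exact this

lemma continuous_kry : Continuous fun B : Matrix (Fin (n+1)) (Fin (n+1)) ℂ => (kry B).det := by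
  apply Continuous.matrix_det
  refine continuous_matrix fun i j => ?_
  exact (continuous_pow (i : ℕ)).matrix_elem 0 j

lemma kry_smul (t : ℂ) (ht : t ≠ 0) (B : Matrix (Fin (n+1)) (Fin (n+1)) ℂ) (h : (kry B).det ≠ 0) :
    (kry (t • B)).det ≠ 0 := by
  have : kry (t • B) = Matrix.diagonal (fun i : Fin (n+1) => t ^ (i : ℕ)) * kry B := by
    ext i j
    rw [Matrix.diagonal_mul]
    simp [kry, smul_pow]
  rw [this, Matrix.det_mul, Matrix.det_diagonal]
  exact mul_ne_zero (Finset.prod_ne_zero_iff.2 fun i _ => pow_ne_zero _ ht) h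

lemma kry_line (B : Matrix (Fin (n+1)) (Fin (n+1)) ℂ) :
    ∀ᵐ t : ℝ, (kry (B + (t : ℂ) • shiftM n)).det ≠ 0 := by
  let p : Polynomial ℂ := (kry (B.map Polynomial.C + (Polynomial.X : Polynomial ℂ) • (shiftM n).map Polynomial.C)).det
  have hp : ∀ t : ℂ, p.eval t = (kry (B + t • shiftM n)).det := by
    intro t
    have := RingHom.map_det (Polynomial.evalRingHom t)
      (kry (B.map Polynomial.C + (Polynomial.X : Polynomial ℂ) • (shiftM n).map Polynomial.C))
    rw [Polynomial.coe_evalRingHom] at this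
    rw [this, RingHom.mapMatrix_apply, kry_map]
    congr 2
    ext i j
    simp
    exact mul_comm _ _
  have hne : p ≠ 0 := by
    have hc : Continuous fun s : ℝ => (kry ((s : ℂ) • B + shiftM n)).det :=
      continuous_kry.comp (by fun_prop)
    have h0 : (kry (((0 : ℝ) : ℂ) • B + shiftM n)).det ≠ 0 := by simp [kry_shift]
    have h1 := (hc.continuousAt (x := 0)).eventually_ne h0
    obtain ⟨ε, hε, hb⟩ := Metric.eventually_nhds_iff.1 h1
    have h2 := hb (y := ε / 2) (by simp [abs_of_pos hε]; linarith)
    have hs : ((ε / 2 : ℝ) : ℂ) ≠ 0 := by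
      exact_mod_cast (by positivity : ε / 2 ≠ 0)
    have h3 := kry_smul ((ε / 2 : ℝ) : ℂ)⁻¹ (inv_ne_zero hs) _ h2
    rw [smul_add, smul_smul, inv_mul_cancel₀ hs, one_smul, ← hp] at h3
    intro h; rw [h] at h3; simp at h3
  have hfin : {t : ℝ | (kry (B + (t : ℂ) • shiftM n)).det = 0}.Finite := by
    have : {t : ℝ | (kry (B + (t : ℂ) • shiftM n)).det = 0} ⊆ (fun t : ℝ => (t : ℂ)) ⁻¹' (p.rootSet ℂ) := by
      intro t ht
      simp only [Set.mem_preimage, Polynomial.mem_rootSet, hne, ne_eq, not_false_eq_true, true_and]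
      simpa [hp] using ht
    exact ((Polynomial.rootSet_finite p ℂ).preimage (Complex.ofReal_injective.injOn)).subset this
  have := hfin.measure_zero volume
  rw [ae_iff]
  simpa using this

lemma kry_ae : ∀ᵐ B ∂(volM (n+1)), (kry B).det ≠ 0 := by
  let L : ℝ →ₗ[ℝ] Matrix (Fin (n+1)) (Fin (n+1)) ℂ := LinearMap.toSpanSingleton ℝ _ (shiftM n)
  refine ae_mem_of_ae_add_linearMap_mem (s := {B | (kry B).det ≠ 0}) L volume (volM (n+1)) ?_ ?_
  · exact (isOpen_ne_fun continuous_kry continuous_const).measurableSet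
  · intro B
    filter_upwards [kry_line B] with t ht
    have : L t = (t : ℂ) • shiftM n := by
      ext i j; simp [L]
    rw [this]; exact ht

end part4


section part5
variable {n : ℕ}

/-- shear -/
def shear (y : Fin n → ℂ) : Matrix (Fin (n+1)) (Fin (n+1)) ℂ := bl 1 0 y 1

/-- weight constant -/
noncomputable def cn (n : ℕ) : ℝ≥0∞ :=
  ∫⁻ y : Fin n → ℂ, (ENNReal.ofReal ((1 + ∑ i, ‖y i‖ ^ 2) ^ (n+1)))⁻¹

/-- integrate out the top row -/
noncomputable def ghat (g : Matrix (Fin (n+1)) (Fin (n+1)) ℂ → ℝ≥0∞) (a : ℂ)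
    (C : Matrix (Fin n) (Fin n) ℂ) : ℝ≥0∞ := ∫⁻ b : Fin n → ℂ, g (bl a b 0 C)

/-- conjugation invariance -/
def ConjInv (F : Matrix (Fin n) (Fin n) ℂ → ℝ≥0∞) : Prop :=
  ∀ U : Matrix (Fin n) (Fin n) ℂ, star U * U = 1 → ∀ B, F (star U * B * U) = F B

lemma shear_mul (y : Fin n → ℂ) : shear (-y) * shear y = 1 := by
  rw [shear, shear, bl_mul, bl_one]; simp

lemma shear_mul' (y : Fin n → ℂ) : shear y * shear (-y) = 1 := by
  rw [shear, shear, bl_mul, bl_one]; simp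

lemma shear_conj (y : Fin n → ℂ) (l : ℂ) (b : Fin n → ℂ) (C : Matrix (Fin n) (Fin n) ℂ) :
    shear y * bl l b 0 C * shear (-y) =
      bl (l - b ⬝ᵥ y) b (l • y - (Matrix.vecMulVec y b + C).mulVec y) (Matrix.vecMulVec y b + C) := by
  rw [shear, shear, bl_mul, bl_mul]
  simp [Matrix.mulVec_neg, sub_eq_add_neg]

lemma det_shear (y : Fin n → ℂ) : (shear y).det = 1 := by
  rw [← Matrix.det_transpose]
  have : (shear y).transpose = bl 1 y 0 1 := by
    apply bl_ext <;> intros <;> simp [shear, Matrix.one_apply, eq_comm]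
  rw [this, bl_det_tri]; simp

lemma conj_shear (y : Fin n → ℂ) : ∃ (p : ℝ) (q : Fin n → ℂ) (P Q : Matrix (Fin n) (Fin n) ℂ),
    0 < p ∧ p ^ 2 = 1 + ∑ i, ‖y i‖ ^ 2 ∧ P * Q = 1 ∧ p * ‖P.det‖ = 1 ∧
    ∀ F : Matrix (Fin (n+1)) (Fin (n+1)) ℂ → ℝ≥0∞, ConjInv F → ∀ l b C,
      F (shear y * bl l b 0 C * shear (-y)) =
        F (bl l (Matrix.vecMul ((p : ℂ) • b + Matrix.vecMul q C - l • q) Q) 0 (P * C * Q)) := by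
  have hpos : 0 < 1 + ∑ i, ‖y i‖ ^ 2 := by positivity
  set p : ℝ := Real.sqrt (1 + ∑ i, ‖y i‖ ^ 2) with hp
  have hp0 : 0 < p := Real.sqrt_pos.2 hpos
  have hp2 : p ^ 2 = 1 + ∑ i, ‖y i‖ ^ 2 := Real.sq_sqrt hpos.le
  have hpc : (p : ℂ) ≠ 0 := by exact_mod_cast hp0.ne'
  obtain ⟨V, hV, hV0⟩ := exists_unitary_col (fun i => (Fin.cons 1 y : Fin (n+1) → ℂ) i / p) (by
    rw [Fin.sum_univ_succ]
    simp only [Fin.cons_zero, Fin.cons_succ, norm_div, div_pow, norm_one, Complex.norm_real,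
      Real.norm_eq_abs, sq_abs, one_pow]
    rw [← Finset.sum_div, ← add_div, hp2, div_self hpos.ne'])
  have hV' : V * star V = 1 := mul_eq_one_comm.1 hV
  have hN1 : (star V * shear y) * (shear (-y) * V) = 1 := by
    rw [mul_assoc, ← mul_assoc (shear y), shear_mul', one_mul, hV]
  have hN2 : (shear (-y) * V) * (star V * shear y) = 1 := mul_eq_one_comm.1 hN1
  -- first column
  have hcol : ∀ i, (star V * shear y) i 0 = if i = 0 then (p : ℂ) else 0 := by
    intro i
    have h1 : ∀ j, shear y j 0 = p * V j 0 := by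
      intro j
      rw [hV0, mul_div_cancel₀ _ hpc]
      refine Fin.cases ?_ (fun j => ?_) j <;> simp [shear]
    rw [Matrix.mul_apply]
    simp only [h1]
    have h2 := congrFun (congrFun hV i) 0
    rw [Matrix.mul_apply, Matrix.one_apply] at h2
    calc ∑ j, star V i j * (p * V j 0) = p * ∑ j, star V i j * V j 0 := by
          rw [Finset.mul_sum]; exact Finset.sum_congr rfl fun j _ => by ring
      _ = _ := by rw [h2]; split_ifs <;> simp
  set N := star V * shear y with hN
  set N' := shear (-y) * V with hN'
  obtain ⟨q, P, hNb⟩ : ∃ q P, N = bl p q 0 P := by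
    refine ⟨fun j => N 0 j.succ, Matrix.of fun i j => N i.succ j.succ, ?_⟩
    apply bl_ext <;> intros <;> simp [hcol]
  obtain ⟨n0, qt, ct, Q, hNb'⟩ : ∃ n0 qt ct Q, N' = bl n0 qt ct Q := ⟨_, _, _, _, bl_eta N'⟩
  have hN2' := hN2
  rw [hNb, hNb', bl_mul, bl_one] at hN2'
  have hn0 : n0 * p = 1 := by
    have := congrFun (congrFun hN2' 0) 0
    simpa using this
  have hct : ct = 0 := by
    funext i
    have := congrFun (congrFun hN2' i.succ) 0
    simpa [hpc] using this
  subst hct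
  have hN1' := hN1
  rw [hNb, hNb', bl_mul, bl_one] at hN1'
  have hPQ : P * Q = 1 := by
    ext i j
    have := congrFun (congrFun hN1' i.succ) j.succ
    simpa using this
  have hqt : (p : ℂ) • qt + Matrix.vecMul q Q = 0 := by
    funext j
    have := congrFun (congrFun hN1' 0) j.succ
    simpa using this
  refine ⟨p, q, P, Q, hp0, hp2, hPQ, ?_, ?_⟩
  · have h1 : ‖N.det‖ = 1 := by
      rw [hN, Matrix.det_mul, det_shear, mul_one]
      exact norm_det_unitary (by rw [star_star]; exact hV')
    rw [hNb, bl_det_tri, norm_mul, Complex.norm_real, Real.norm_eq_abs, abs_of_pos hp0] at h1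
    exact h1
  · intro F hF l b C
    rw [← hF V hV]
    have : star V * (shear y * bl l b 0 C * shear (-y)) * V = N * bl l b 0 C * N' := by
      simp only [hN, hN', mul_assoc]
    rw [this, hNb, hNb', bl_mul, bl_mul]
    congr 1
    have e1 : (p : ℂ) * l + q ⬝ᵥ 0 = p * l := by simp
    rw [e1]
    have e2 : (p * l) * n0 + ((p:ℂ) • b + Matrix.vecMul q C) ⬝ᵥ 0 = l := by
      simp only [dotProduct_zero, add_zero]
      linear_combination l * hn0
    rw [e2]
    have e3 : ((p:ℂ) * l) • qt + Matrix.vecMul ((p:ℂ) • b + Matrix.vecMul q C) Q =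
        Matrix.vecMul ((p : ℂ) • b + Matrix.vecMul q C - l • q) Q := by
      rw [sub_eq_add_neg, Matrix.add_vecMul Q (_ + _), mul_comm, mul_smul, add_comm]
      congr 1
      rw [Matrix.neg_vecMul, Matrix.smul_vecMul, eq_neg_iff_add_eq_zero, ← smul_add, hqt, smul_zero]
    rw [e3]
    simp

end part5


section part6
variable {n : ℕ}

@[fun_prop]
lemma measurable_bl' {X : Type*} [MeasurableSpace X] {a : X → ℂ} {b c : X → Fin n → ℂ}
    {D : X → Matrix (Fin n) (Fin n) ℂ} (ha : Measurable a) (hb : Measurable b) (hc : Measurable c)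
    (hD : Measurable D) : Measurable fun x => bl (a x) (b x) (c x) (D x) :=
  continuous_bl.measurable.comp ((ha.prodMk hc).prodMk (hb.prodMk hD))

@[fun_prop]
lemma measurable_shear {X : Type*} [MeasurableSpace X] {y : X → Fin n → ℂ}
    (hy : Measurable y) : Measurable fun x => shear (y x) := by
  unfold shear; fun_prop

@[fun_prop]
lemma measurable_vecMulVec {X : Type*} [MeasurableSpace X] {y b : X → Fin n → ℂ}
    (hy : Measurable y) (hb : Measurable b) : Measurable fun x => Matrix.vecMulVec (y x) (b x) := by
  have : Continuous fun p : (Fin n → ℂ) × (Fin n → ℂ) => Matrix.vecMulVec p.1 p.2 :=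
    continuous_fst.matrix_vecMulVec continuous_snd
  exact this.measurable.comp (hy.prodMk hb)

@[fun_prop]
lemma measurable_dot {X : Type*} [MeasurableSpace X] {y b : X → Fin n → ℂ}
    (hy : Measurable y) (hb : Measurable b) : Measurable fun x => (y x) ⬝ᵥ (b x) := by
  simp only [dotProduct]; fun_prop

@[fun_prop]
lemma measurable_mulM {X : Type*} [MeasurableSpace X] {y b : X → Matrix (Fin n) (Fin n) ℂ}
    (hy : Measurable y) (hb : Measurable b) : Measurable fun x => (y x) * (b x) := by
  have : Continuous fun p : (Matrix (Fin n) (Fin n) ℂ) × (Matrix (Fin n) (Fin n) ℂ) => p.1 * p.2 :=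
    continuous_fst.matrix_mul continuous_snd
  exact this.measurable.comp (hy.prodMk hb)

@[fun_prop]
lemma measurable_detM {X : Type*} [MeasurableSpace X] {y : X → Matrix (Fin n) (Fin n) ℂ}
    (hy : Measurable y) : Measurable fun x => (y x).det := by
  have : Continuous fun p : (Matrix (Fin n) (Fin n) ℂ) => p.det := continuous_id.matrix_det
  exact this.measurable.comp hy

@[fun_prop]
lemma measurable_rho' {X : Type*} [MeasurableSpace X] {y : X → Matrix (Fin n) (Fin n) ℂ}
    (hy : Measurable y) : Measurable fun x => rho (y x) := measurable_rho.comp hy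

/-- indicator of `a ≤ b` -/
noncomputable def ile (a b : ℝ≥0∞) : ℝ≥0∞ := if a ≤ b then 1 else 0

@[fun_prop]
lemma measurable_ile {X : Type*} [MeasurableSpace X] {a b : X → ℝ≥0∞}
    (ha : Measurable a) (hb : Measurable b) : Measurable fun x => ile (a x) (b x) := by
  unfold ile
  exact Measurable.ite (measurableSet_le ha hb) measurable_const measurable_const

/-- deflation weight -/
noncomputable def dw (l : ℂ) (C : Matrix (Fin n) (Fin n) ℂ) : ℝ≥0∞ :=
  ile (rho C) ‖l‖ₑ * ENNReal.ofReal (‖(l • 1 - C).det‖ ^ 2)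

@[fun_prop]
lemma measurable_dw {X : Type*} [MeasurableSpace X] {l : X → ℂ} {C : X → Matrix (Fin n) (Fin n) ℂ}
    (hl : Measurable l) (hC : Measurable C) : Measurable fun x => dw (l x) (C x) := by
  unfold dw
  fun_prop

lemma dw_conj {P Q : Matrix (Fin n) (Fin n) ℂ} (h : P * Q = 1) (l : ℂ) (C : Matrix (Fin n) (Fin n) ℂ) :
    dw l (P * C * Q) = dw l C := by
  unfold dw; rw [rho_conj h, det_conj_sub h]

lemma top_vec (a : ℂ) (b c : Fin n → ℂ) (D : Matrix (Fin n) (Fin n) ℂ) (h : (kry (bl a b c D)).det ≠ 0) :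
    ∃ y : Fin n → ℂ, rho (D - Matrix.vecMulVec y b) ≤ ‖a + b ⬝ᵥ y‖ₑ ∧ c = (a + b ⬝ᵥ y) • y - D.mulVec y := by
  obtain ⟨z, hz, hzr⟩ := exists_top (bl a b c D)
  obtain ⟨w, hw, hw0⟩ := Matrix.exists_mulVec_eq_zero_iff.2 hz
  have hB : (bl a b c D).mulVec w = z • w := by
    rw [Matrix.sub_mulVec, Matrix.smul_mulVec, Matrix.one_mulVec, sub_eq_zero] at hw0
    exact hw0.symm
  have h0 : w 0 ≠ 0 := fun h0 => h (kry_eig hw hB h0)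
  let y : Fin n → ℂ := fun i => w i.succ / w 0
  have hy : ∀ i : Fin n, w i.succ = y i * w 0 := fun i => (div_mul_cancel₀ _ h0).symm
  have h1 : a + b ⬝ᵥ y = z := by
    have := congrFun hB 0
    simp only [Matrix.mulVec, dotProduct, Fin.sum_univ_succ, bl_00, bl_0s, Pi.smul_apply, smul_eq_mul, hy] at this
    apply mul_right_cancel₀ h0
    rw [← this, add_mul, dotProduct, Finset.sum_mul]
    simp [mul_assoc]
  have h2 : c = z • y - D.mulVec y := by
    funext i
    have := congrFun hB i.succ
    simp only [Matrix.mulVec, dotProduct, Fin.sum_univ_succ, bl_s0, bl_ss, Pi.smul_apply, smul_eq_mul, hy] at this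
    apply mul_right_cancel₀ h0
    simp only [Pi.sub_apply, Pi.smul_apply, smul_eq_mul, sub_mul, Matrix.mulVec, dotProduct, Finset.sum_mul]
    rw [eq_sub_iff_add_eq, mul_assoc, ← this]
    simp [mul_assoc]
  refine ⟨y, ?_, by rw [h1]; exact h2⟩
  rw [h1, hzr, rho_le_iff]
  intro x hx
  refine (rho_le_iff (bl a b c D) _).1 le_rfl x ?_
  have h3 : bl a b c D = shear y * bl z b 0 (D - Matrix.vecMulVec y b) * shear (-y) := by
    rw [shear_conj, ← h1]
    simp only [add_sub_cancel_right, add_sub_cancel]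
    rw [h1, ← h2]
  rw [h3, det_conj_sub (shear_mul' y), det_sub_bl, hx, mul_zero]

/-- The map `y ↦ c(y)`. -/
def cmap (a : ℂ) (b : Fin n → ℂ) (D : Matrix (Fin n) (Fin n) ℂ) (y : Fin n → ℂ) : Fin n → ℂ :=
  (a + b ⬝ᵥ y) • y - D.mulVec y

/-- Its derivative -/
noncomputable def cmap' (a : ℂ) (b : Fin n → ℂ) (D : Matrix (Fin n) (Fin n) ℂ) (y : Fin n → ℂ) :
    (Fin n → ℂ) →L[ℂ] (Fin n → ℂ) :=
  LinearMap.toContinuousLinearMap (Matrix.toLin' ((a + b ⬝ᵥ y) • 1 - (D - Matrix.vecMulVec y b)))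

lemma cmap_deriv (a : ℂ) (b : Fin n → ℂ) (D : Matrix (Fin n) (Fin n) ℂ) (y : Fin n → ℂ) :
    HasFDerivAt (cmap a b D) ((cmap' a b D y).restrictScalars ℝ) y := by
  apply HasFDerivAt.restrictScalars
  let l : (Fin n → ℂ) →L[ℂ] ℂ := LinearMap.toContinuousLinearMap
    { toFun := fun y => b ⬝ᵥ y, map_add' := dotProduct_add b, map_smul' := fun t y => dotProduct_smul t b y }
  let M : (Fin n → ℂ) →L[ℂ] (Fin n → ℂ) := LinearMap.toContinuousLinearMap (Matrix.toLin' D)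
  have h1 := (((hasFDerivAt_const a y).add (l.hasFDerivAt (x := y))).smul (hasFDerivAt_id y)).sub
    (M.hasFDerivAt (x := y))
  refine h1.congr_fderiv ?_
  refine ContinuousLinearMap.ext fun h => ?_
  have e1 : ∀ x, l x = b ⬝ᵥ x := fun x => rfl
  have e2 : ∀ x, M x = D.mulVec x := fun x => by simp [M, Matrix.toLin'_apply]
  have e3 : ∀ x, cmap' a b D y x = ((a + b ⬝ᵥ y) • 1 - (D - Matrix.vecMulVec y b)).mulVec x :=
    fun x => by simp [cmap', Matrix.toLin'_apply, Matrix.sub_mulVec, Matrix.smul_mulVec]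
  rw [e3]
  simp only [sub_apply, add_apply, e1, e2,
    smul_apply, ContinuousLinearMap.smulRight_apply,
    Matrix.sub_mulVec, Matrix.smul_mulVec, Matrix.one_mulVec, Matrix.vecMulVec_mulVec]
  simp [e1]
  abel

lemma cmap_det (a : ℂ) (b : Fin n → ℂ) (D : Matrix (Fin n) (Fin n) ℂ) (y : Fin n → ℂ) :
    |((cmap' a b D y).restrictScalars ℝ).det| =
      ‖((a + b ⬝ᵥ y) • 1 - (D - Matrix.vecMulVec y b)).det‖ ^ 2 := by
  have := abs_det_real (Matrix.toLin' ((a + b ⬝ᵥ y) • 1 - (D - Matrix.vecMulVec y b)))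
  rw [LinearMap.det_toLin'] at this
  exact this

lemma inner_ineq (F : Matrix (Fin (n+1)) (Fin (n+1)) ℂ → ℝ≥0∞) (hF : Measurable F)
    (hk : ∀ B, (kry B).det = 0 → F B = 0) (a : ℂ) (b : Fin n → ℂ) (D : Matrix (Fin n) (Fin n) ℂ) :
    ∫⁻ c, F (bl a b c D) ≤ ∫⁻ y : Fin n → ℂ, dw (a + b ⬝ᵥ y) (D - Matrix.vecMulVec y b) *
      F (shear y * bl (a + b ⬝ᵥ y) b 0 (D - Matrix.vecMulVec y b) * shear (-y)) := by
  set s : Set (Fin n → ℂ) := {y | rho (D - Matrix.vecMulVec y b) ≤ ‖a + b ⬝ᵥ y‖ₑ}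
  have hs : MeasurableSet s := measurableSet_le (by fun_prop) (by fun_prop)
  have h1 := image_ineq (volume : Measure (Fin n → ℂ)) (cmap a b D)
    (fun y => (cmap' a b D y).restrictScalars ℝ) s hs (cmap_deriv a b D)
    (by simp only [cmap_det]; fun_prop) (fun c => F (bl a b c D)) (by fun_prop) (by
      intro c hc
      obtain ⟨y, hy1, hy2⟩ := top_vec a b c D (fun h => hc (hk _ h))
      exact ⟨y, hy1, hy2.symm⟩)
  refine h1.trans ?_
  rw [← lintegral_indicator hs]
  refine lintegral_mono fun y => ?_
  by_cases hy : y ∈ s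
  · rw [Set.indicator_of_mem hy]
    simp only [cmap_det]
    have : ile (rho (D - Matrix.vecMulVec y b)) ‖a + b ⬝ᵥ y‖ₑ = 1 := if_pos hy
    rw [dw, this, one_mul, shear_conj]
    simp only [add_sub_cancel_right, add_sub_cancel]
    rfl
  · rw [Set.indicator_of_notMem hy]; exact zero_le

end part6


section part7
variable {n : ℕ}

@[fun_prop]
lemma measurable_ghat {X : Type*} [MeasurableSpace X] {F : Matrix (Fin (n+1)) (Fin (n+1)) ℂ → ℝ≥0∞}
    (hF : Measurable F) {l : X → ℂ} {C : X → Matrix (Fin n) (Fin n) ℂ}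
    (hl : Measurable l) (hC : Measurable C) : Measurable fun x => ghat F (l x) (C x) := by
  unfold ghat
  fun_prop

lemma shear_integral (F : Matrix (Fin (n+1)) (Fin (n+1)) ℂ → ℝ≥0∞)
    (hinv : ConjInv F) (y : Fin n → ℂ) (l : ℂ) :
    ∫⁻ C, dw l C * ∫⁻ b, F (shear y * bl l b 0 C * shear (-y)) ∂volume ∂(volM n) =
      (ENNReal.ofReal ((1 + ∑ i, ‖y i‖ ^ 2) ^ (n+1)))⁻¹ * ∫⁻ C, dw l C * ghat F l C ∂(volM n) := by
  obtain ⟨p, q, P, Q, hp, hp2, hPQ, hdet, hF⟩ := conj_shear y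
  have hdP : ‖P.det‖ * ‖Q.det‖ = 1 := by rw [← norm_mul, ← Matrix.det_mul, hPQ]; simp
  have hdQ : ‖Q.det‖ = p := by
    have h0 : ‖P.det‖ ≠ 0 := by intro h; rw [h] at hdP; simp at hdP
    apply mul_left_cancel₀ h0
    rw [hdP, ← hdet, mul_comm]
  have hpc : (p : ℂ) ≠ 0 := by exact_mod_cast hp.ne'
  set K : ℝ≥0∞ := ENNReal.ofReal ((1 + ∑ i, ‖y i‖ ^ 2) ^ (n+1)) with hK
  have hK0 : K ≠ 0 := by
    rw [hK]; simp only [ne_eq, ENNReal.ofReal_eq_zero, not_le]; positivity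
  have hKt : K ≠ ∞ := ENNReal.ofReal_ne_top
  have hb : ∀ C, ∫⁻ b, F (shear y * bl l b 0 C * shear (-y)) = K⁻¹ * ghat F l (P * C * Q) := by
    intro C
    simp only [hF F hinv]
    set t : Fin n → ℂ := Matrix.vecMul (Matrix.vecMul q C - l • q) Q
    have e1 : ∀ b : Fin n → ℂ, Matrix.vecMul ((p : ℂ) • b + Matrix.vecMul q C - l • q) Q =
        Matrix.vecMul b ((p : ℂ) • Q) + t := by
      intro b
      rw [add_sub_assoc, Matrix.add_vecMul, Matrix.smul_vecMul, Matrix.vecMul_smul]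
    simp only [e1]
    have hdet' : ‖((p : ℂ) • Q).det‖ ^ 2 = (1 + ∑ i, ‖y i‖ ^ 2) ^ (n+1) := by
      rw [Matrix.det_smul, norm_mul, norm_pow, Complex.norm_real, Real.norm_eq_abs, abs_of_pos hp, hdQ,
        ← hp2, Fintype.card_fin]
      ring
    have h1 := lintegral_vecMul ((p : ℂ) • Q) (by
      intro h0; rw [h0] at hdet'
      have : 0 < (1 + ∑ i, ‖y i‖ ^ 2) ^ (n+1) := by positivity
      rw [← hdet'] at this; simp at this) (fun b => F (bl l (b + t) 0 (P * C * Q)))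
    rw [hdet', lintegral_add_right_eq_self (fun b => F (bl l b 0 (P * C * Q))) t] at h1
    rw [ghat, h1, ← mul_assoc, ENNReal.inv_mul_cancel hK0 hKt, one_mul]
  simp only [hb]
  rw [← lintegral_LR P Q (by rw [mul_comm]; exact hdP) (fun C => dw l C * ghat F l C),
    ← lintegral_const_mul' _ _ (ENNReal.inv_ne_top.2 hK0)]
  refine lintegral_congr fun C => ?_
  rw [dw_conj hPQ]
  ring

/-- integrand after the change of variables -/
noncomputable def psi (F : Matrix (Fin (n+1)) (Fin (n+1)) ℂ → ℝ≥0∞) (y : Fin n → ℂ) (l : ℂ) (b : Fin n → ℂ)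
    (C : Matrix (Fin n) (Fin n) ℂ) : ℝ≥0∞ := dw l C * F (shear y * bl l b 0 C * shear (-y))

@[fun_prop]
lemma measurable_psi {X : Type*} [MeasurableSpace X] {F : Matrix (Fin (n+1)) (Fin (n+1)) ℂ → ℝ≥0∞}
    (hF : Measurable F) {y b : X → Fin n → ℂ} {l : X → ℂ} {C : X → Matrix (Fin n) (Fin n) ℂ}
    (hy : Measurable y) (hb : Measurable b) (hl : Measurable l) (hC : Measurable C) :
    Measurable fun x => psi F (y x) (l x) (b x) (C x) := by
  unfold psi; fun_prop

lemma deflate (F : Matrix (Fin (n+1)) (Fin (n+1)) ℂ → ℝ≥0∞) (hF : Measurable F)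
    (hinv : ConjInv F) :
    ∫⁻ B, F B ∂(volM (n+1)) ≤ kbl n * cn n * ∫⁻ l : ℂ, ∫⁻ C, dw l C * ghat F l C ∂(volM n) := by
  let F₁ : Matrix (Fin (n+1)) (Fin (n+1)) ℂ → ℝ≥0∞ := {B | (kry B).det ≠ 0}.indicator F
  have hset : MeasurableSet {B : Matrix (Fin (n+1)) (Fin (n+1)) ℂ | (kry B).det ≠ 0} :=
    (isOpen_ne_fun continuous_kry continuous_const).measurableSet
  have hF₁ : Measurable F₁ := hF.indicator hset
  have hle : ∀ B, F₁ B ≤ F B := fun B => Set.indicator_le_self _ _ _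
  have h0 : ∫⁻ B, F B ∂(volM (n+1)) = ∫⁻ B, F₁ B ∂(volM (n+1)) := by
    refine lintegral_congr_ae ?_
    filter_upwards [kry_ae] with B hB
    exact (Set.indicator_of_mem (s := {B | (kry B).det ≠ 0}) hB F).symm
  rw [h0, lintegral_bl, mul_assoc]
  gcongr
  calc ∫⁻ p : (ℂ × (Fin n → ℂ)) × ((Fin n → ℂ) × Matrix (Fin n) (Fin n) ℂ),
      F₁ (bl p.1.1 p.2.1 p.1.2 p.2.2) ∂((volume.prod volume).prod (volume.prod (volM n)))
      = ∫⁻ q : (Fin n → ℂ) × Matrix (Fin n) (Fin n) ℂ, ∫⁻ a : ℂ, ∫⁻ c : Fin n → ℂ,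
          F₁ (bl a q.1 c q.2) ∂volume ∂volume ∂(volume.prod (volM n)) := by
        rw [lintegral_prod_symm _ (by fun_prop)]
        refine lintegral_congr fun q => ?_
        rw [lintegral_prod _ (by fun_prop)]
    _ ≤ ∫⁻ q : (Fin n → ℂ) × Matrix (Fin n) (Fin n) ℂ, ∫⁻ a : ℂ, ∫⁻ y : Fin n → ℂ,
          psi F y (a + q.1 ⬝ᵥ y) q.1 (q.2 - Matrix.vecMulVec y q.1) ∂volume ∂volume ∂(volume.prod (volM n)) := by
        refine lintegral_mono fun q => lintegral_mono fun a => ?_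
        refine (inner_ineq F₁ hF₁ (fun B hB => Set.indicator_of_notMem (by simpa using hB) F) a q.1 q.2).trans ?_
        refine lintegral_mono fun y => ?_
        simp only [psi]
        gcongr
        exact hle _
    _ = ∫⁻ q : (Fin n → ℂ) × Matrix (Fin n) (Fin n) ℂ, ∫⁻ y : Fin n → ℂ, ∫⁻ l : ℂ,
          psi F y l q.1 (q.2 - Matrix.vecMulVec y q.1) ∂volume ∂volume ∂(volume.prod (volM n)) := by
        refine lintegral_congr fun q => ?_
        rw [lintegral_lintegral_swap]
        · refine lintegral_congr fun y => ?_
          exact lintegral_add_right_eq_self (fun l => psi F y l q.1 (q.2 - Matrix.vecMulVec y q.1)) (q.1 ⬝ᵥ y)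
        · fun_prop
    _ = ∫⁻ y : Fin n → ℂ, ∫⁻ q : (Fin n → ℂ) × Matrix (Fin n) (Fin n) ℂ, ∫⁻ l : ℂ,
          psi F y l q.1 (q.2 - Matrix.vecMulVec y q.1) ∂volume ∂(volume.prod (volM n)) ∂volume := by
        rw [lintegral_lintegral_swap]
        fun_prop
    _ = ∫⁻ y : Fin n → ℂ, ∫⁻ l : ℂ, ∫⁻ C, dw l C * ∫⁻ b, F (shear y * bl l b 0 C * shear (-y)) ∂volume ∂(volM n) ∂volume ∂volume := by
        refine lintegral_congr fun y => ?_
        rw [lintegral_lintegral_swap (by fun_prop)]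
        refine lintegral_congr fun l => ?_
        rw [lintegral_prod _ (by fun_prop)]
        calc _ = ∫⁻ b : Fin n → ℂ, ∫⁻ C, psi F y l b C ∂(volM n) := by
              refine lintegral_congr fun b => ?_
              exact lintegral_sub_right_eq_self (fun C => psi F y l b C) (Matrix.vecMulVec y b)
          _ = ∫⁻ C, ∫⁻ b : Fin n → ℂ, psi F y l b C ∂volume ∂(volM n) := by
              rw [lintegral_lintegral_swap (by fun_prop)]
          _ = _ := by
              refine lintegral_congr fun C => ?_
              exact lintegral_const_mul _ (by fun_prop)
    _ = cn n * ∫⁻ l : ℂ, ∫⁻ C, dw l C * ghat F l C ∂(volM n) := by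
        rw [cn, ← lintegral_mul_const _ (by fun_prop)]
        refine lintegral_congr fun y => ?_
        rw [← lintegral_const_mul _ (by fun_prop)]
        refine lintegral_congr fun l => ?_
        exact shear_integral F hinv y l

end part7


section part8
variable {n : ℕ}

lemma lintegral_smul_pi {ι : Type*} [Fintype ι] (a : ℂ) (ha : a ≠ 0) (f : (ι → ℂ) → ℝ≥0∞) :
    ∫⁻ x, f x = ENNReal.ofReal (‖a‖ ^ (2 * Fintype.card ι)) * ∫⁻ x, f (a • x) := by
  have := lintegral_lin (volume : Measure (ι → ℂ)) (a • LinearMap.id) (by simp [ha]) f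
  rw [this]
  congr 2
  rw [LinearMap.det_smul]
  simp [← pow_mul, mul_comm]

lemma polar (k : ℝ → ℝ≥0∞) (hk : Measurable k) :
    ∫⁻ x : ℂ × (Fin n → ℂ), k (‖x.1‖ ^ 2 + ∑ i, ‖x.2 i‖ ^ 2) ∂(volume.prod volume) =
      cn n * ∫⁻ l : ℂ, ENNReal.ofReal (‖l‖ ^ (2 * n)) * k (‖l‖ ^ 2) := by
  rw [lintegral_prod _ (by fun_prop)]
  have h1 : ∀ᵐ a : ℂ, ∫⁻ c : Fin n → ℂ, k (‖a‖ ^ 2 + ∑ i, ‖c i‖ ^ 2) =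
      ∫⁻ y : Fin n → ℂ, ENNReal.ofReal (‖a‖ ^ (2 * n)) * k (‖a‖ ^ 2 * (1 + ∑ i, ‖y i‖ ^ 2)) := by
    have : ∀ᵐ a : ℂ, a ≠ 0 := by simp [ae_iff]
    filter_upwards [this] with a ha
    rw [lintegral_smul_pi a ha, lintegral_const_mul _ (by fun_prop), Fintype.card_fin]
    congr 1
    refine lintegral_congr fun y => ?_
    simp only [Pi.smul_apply, smul_eq_mul, norm_mul, mul_pow, ← Finset.mul_sum]
    congr 1; ring
  rw [lintegral_congr_ae h1, lintegral_lintegral_swap (by fun_prop), cn, ← lintegral_mul_const _ (by fun_prop)]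
  refine lintegral_congr fun y => ?_
  have hpos : 0 < 1 + ∑ i, ‖y i‖ ^ 2 := by positivity
  set p : ℝ := Real.sqrt (1 + ∑ i, ‖y i‖ ^ 2) with hp
  have hp0 : 0 < p := Real.sqrt_pos.2 hpos
  have hp2 : p ^ 2 = 1 + ∑ i, ‖y i‖ ^ 2 := Real.sq_sqrt hpos.le
  rw [← hp2]
  have hpc : (p : ℂ) ≠ 0 := by exact_mod_cast hp0.ne'
  rw [lintegral_lin (volume : Measure ℂ) ((p : ℂ) • LinearMap.id) (by simp [hpc])
    (fun l => ENNReal.ofReal (‖l‖ ^ (2 * n)) * k (‖l‖ ^ 2))]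
  have hd : ‖LinearMap.det ((p : ℂ) • (LinearMap.id : ℂ →ₗ[ℂ] ℂ))‖ ^ 2 = p ^ 2 := by
    rw [LinearMap.det_smul]; simp
  rw [hd]
  have e : ∀ a : ℂ, ENNReal.ofReal (‖((p : ℂ) • (LinearMap.id : ℂ →ₗ[ℂ] ℂ)) a‖ ^ (2 * n)) *
      k (‖((p : ℂ) • (LinearMap.id : ℂ →ₗ[ℂ] ℂ)) a‖ ^ 2) = ENNReal.ofReal (p ^ (2 * n)) *
      (ENNReal.ofReal (‖a‖ ^ (2 * n)) * k (‖a‖ ^ 2 * p ^ 2)) := by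
    intro a
    simp only [LinearMap.smul_apply, LinearMap.id_apply, smul_eq_mul, norm_mul, Complex.norm_real,
      Real.norm_eq_abs, sq_abs, mul_pow, abs_of_pos hp0]
    rw [ENNReal.ofReal_mul (by positivity), mul_assoc, mul_comm (p ^ 2)]
  simp only [e]
  rw [lintegral_const_mul _ (by fun_prop), ← mul_assoc, ← mul_assoc, mul_assoc _ (ENNReal.ofReal (p ^ 2)),
    ← ENNReal.ofReal_mul (by positivity)]
  have : p ^ 2 * p ^ (2 * n) = (p ^ 2) ^ (n + 1) := by ring
  rw [this, ENNReal.inv_mul_cancel, one_mul]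
  · simp only [ne_eq, ENNReal.ofReal_eq_zero, not_le]; positivity
  · exact ENNReal.ofReal_ne_top

/-- left unitary invariance -/
def LInv (F : Matrix (Fin n) (Fin n) ℂ → ℝ≥0∞) : Prop :=
  ∀ U : Matrix (Fin n) (Fin n) ℂ, star U * U = 1 → ∀ B, F (U * B) = F B

/-- integral over the last columns -/
noncomputable def colI (F : Matrix (Fin (n+1)) (Fin (n+1)) ℂ → ℝ≥0∞) (a : ℂ) (c : Fin n → ℂ) : ℝ≥0∞ :=
  ∫⁻ q : (Fin n → ℂ) × Matrix (Fin n) (Fin n) ℂ, F (bl a q.1 c q.2) ∂(volume.prod (volM n))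

@[fun_prop]
lemma measurable_colI {X : Type*} [MeasurableSpace X] {F : Matrix (Fin (n+1)) (Fin (n+1)) ℂ → ℝ≥0∞}
    (hF : Measurable F) {l : X → ℂ} {c : X → Fin n → ℂ}
    (hl : Measurable l) (hc : Measurable c) : Measurable fun x => colI F (l x) (c x) := by
  unfold colI
  fun_prop

lemma colI_eq {F : Matrix (Fin (n+1)) (Fin (n+1)) ℂ → ℝ≥0∞} (hF : Measurable F) (hinv : LInv F)
    (a : ℂ) (c : Fin n → ℂ) :
    colI F a c = colI F (Real.sqrt (‖a‖ ^ 2 + ∑ i, ‖c i‖ ^ 2) : ℝ) 0 := by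
  set p : ℝ := Real.sqrt (‖a‖ ^ 2 + ∑ i, ‖c i‖ ^ 2) with hp
  have hp2 : p ^ 2 = ‖a‖ ^ 2 + ∑ i, ‖c i‖ ^ 2 := Real.sq_sqrt (by positivity)
  rcases eq_or_ne p 0 with h0 | h0
  · rw [h0] at hp2
    have h1 : ‖a‖ ^ 2 = 0 := le_antisymm (by
      have : 0 ≤ ∑ i, ‖c i‖ ^ 2 := by positivity
      nlinarith) (by positivity)
    have h2 : ∑ i, ‖c i‖ ^ 2 = 0 := by rw [h1] at hp2; linarith
    have ha : a = 0 := by simpa using h1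
    have hc : c = 0 := by
      funext i
      have := (Finset.sum_eq_zero_iff_of_nonneg (fun i _ => by positivity)).1 h2 i (Finset.mem_univ i)
      simpa using this
    rw [ha, hc, h0]; simp
  · have hpc : (p : ℂ) ≠ 0 := by exact_mod_cast h0
    obtain ⟨V, hV, hV0⟩ := exists_unitary_col (fun i => (Fin.cons a c : Fin (n+1) → ℂ) i / p) (by
      rw [Fin.sum_univ_succ]
      simp only [Fin.cons_zero, Fin.cons_succ, norm_div, div_pow, Complex.norm_real,
        Real.norm_eq_abs, sq_abs]
      rw [← Finset.sum_div, ← add_div, hp2, div_self]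
      rw [← hp2]; positivity)
    have key : ∀ q : (Fin n → ℂ) × Matrix (Fin n) (Fin n) ℂ, F (bl (p : ℂ) q.1 0 q.2) =
        F (bl a (colAct V q).1 c (colAct V q).2) := by
      intro q
      rw [← hinv V hV, colAct_bl]
      have hm : ∀ i, V.mulVec (Fin.cons (p : ℂ) 0 : Fin (n+1) → ℂ) i = (Fin.cons a c : Fin (n+1) → ℂ) i := by
        intro i
        simp only [Matrix.mulVec, dotProduct, Fin.sum_univ_succ, Fin.cons_zero, Fin.cons_succ, hV0]
        simp [div_mul_cancel₀ _ hpc]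
      simp only [hm, Fin.cons_zero, Fin.cons_succ]
    unfold colI
    simp only [key]
    rw [(pres_colAct hV).lintegral_comp (f := fun q => F (bl a q.1 c q.2)) (by fun_prop)]

lemma column {F : Matrix (Fin (n+1)) (Fin (n+1)) ℂ → ℝ≥0∞} (hF : Measurable F) (hinv : LInv F)
    (h : ℝ → ℝ≥0∞) (hh : Measurable h) :
    ∫⁻ B, h (∑ i, ‖B i 0‖ ^ 2) * F B ∂(volM (n+1)) =
      kbl n * cn n * ∫⁻ l : ℂ, ENNReal.ofReal (‖l‖ ^ (2 * n)) * (h (‖l‖ ^ 2) * ∫⁻ C, ghat F l C ∂(volM n)) := by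
  rw [lintegral_bl, mul_assoc]
  congr 1
  rw [lintegral_prod _ (by simp only [Fin.sum_univ_succ, bl_00, bl_s0]; fun_prop)]
  simp only [Fin.sum_univ_succ, bl_00, bl_s0]
  have h1 : ∀ x : ℂ × (Fin n → ℂ), ∫⁻ q : (Fin n → ℂ) × Matrix (Fin n) (Fin n) ℂ,
      h (‖x.1‖ ^ 2 + ∑ i, ‖x.2 i‖ ^ 2) * F (bl x.1 q.1 x.2 q.2) ∂(volume.prod (volM n)) =
      (fun t => h t * colI F (Real.sqrt t : ℝ) 0) (‖x.1‖ ^ 2 + ∑ i, ‖x.2 i‖ ^ 2) := by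
    intro x
    rw [lintegral_const_mul _ (by fun_prop)]
    simp only
    rw [← colI_eq hF hinv]
    rfl
  simp only [h1]
  rw [polar (fun t => h t * colI F (Real.sqrt t : ℝ) 0) (by fun_prop)]
  congr 1
  refine lintegral_congr fun l => ?_
  congr 2
  have := colI_eq hF hinv l 0
  simp only [Pi.zero_apply, norm_zero, ne_eq, OfNat.ofNat_ne_zero, not_false_eq_true, zero_pow,
    Finset.sum_const_zero, add_zero] at this
  rw [← this]
  unfold colI ghat
  rw [lintegral_prod_symm _ (by fun_prop)]

end part8


section part9
variable {n : ℕ}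

/-- indicator of `a < b` -/
noncomputable def ilt (a b : ℝ≥0∞) : ℝ≥0∞ := if a < b then 1 else 0

@[fun_prop]
lemma measurable_ilt {X : Type*} [MeasurableSpace X] {a b : X → ℝ≥0∞}
    (ha : Measurable a) (hb : Measurable b) : Measurable fun x => ilt (a x) (b x) := by
  unfold ilt
  exact Measurable.ite (measurableSet_lt ha hb) measurable_const measurable_const

/-- strict deflation weight -/
noncomputable def dws (l : ℂ) (C : Matrix (Fin n) (Fin n) ℂ) : ℝ≥0∞ :=
  ilt (rho C) ‖l‖ₑ * ENNReal.ofReal (‖(l • 1 - C).det‖ ^ 2)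

@[fun_prop]
lemma measurable_dws {X : Type*} [MeasurableSpace X] {l : X → ℂ} {C : X → Matrix (Fin n) (Fin n) ℂ}
    (hl : Measurable l) (hC : Measurable C) : Measurable fun x => dws (l x) (C x) := by
  unfold dws
  fun_prop

lemma dws_conj {P Q : Matrix (Fin n) (Fin n) ℂ} (h : P * Q = 1) (l : ℂ) (C : Matrix (Fin n) (Fin n) ℂ) :
    dws l (P * C * Q) = dws l C := by
  unfold dws; rw [rho_conj h, det_conj_sub h]

lemma deflate' (F : Matrix (Fin (n+1)) (Fin (n+1)) ℂ → ℝ≥0∞) (hF : Measurable F)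
    (hinv : ConjInv F) :
    ∫⁻ B, F B ∂(volM (n+1)) ≤ kbl n * cn n * ∫⁻ l : ℂ, ∫⁻ C, dws l C * ghat F l C ∂(volM n) := by
  refine (deflate F hF hinv).trans (le_of_eq ?_)
  congr 1
  refine (lintegral_lintegral_swap (by fun_prop)).trans
    (Eq.trans ?_ (lintegral_lintegral_swap (f := fun l C => dws l C * ghat F l C) (by fun_prop)).symm)
  refine lintegral_congr fun C => lintegral_congr_ae ?_
  have h0 : ∀ᵐ l : ℂ, ‖l‖ₑ ≠ rho C := by
    rw [ae_iff]
    refine measure_mono_null ?_ (Measure.addHaar_sphere volume (0 : ℂ) (rho C).toReal)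
    intro l hl
    simp only [ne_eq, not_not, Set.mem_setOf_eq] at hl
    simp [← hl]
  filter_upwards [h0] with l hl
  congr 1
  unfold dw dws ile ilt
  congr 1
  simp only [le_iff_lt_or_eq, hl.symm, or_false]

lemma bl_act (u : ℂ) (U V : Matrix (Fin n) (Fin n) ℂ) (a : ℂ) (b : Fin n → ℂ) (C : Matrix (Fin n) (Fin n) ℂ) :
    bl u 0 0 U * bl a b 0 C * bl 1 0 0 V = bl (u * a) (u • Matrix.vecMul b V) 0 (U * C * V) := by
  rw [bl_mul, bl_mul]
  simp [Matrix.smul_vecMul]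

lemma bl_diag_unitary {u : ℂ} {U : Matrix (Fin n) (Fin n) ℂ} (hu : star u * u = 1) (hU : star U * U = 1) :
    star (bl u 0 0 U) * bl u 0 0 U = 1 := by
  rw [bl_star, bl_mul, bl_one]; simp_all

lemma det_unitary_ne {V : Matrix (Fin n) (Fin n) ℂ} (hV : star V * V = 1) : V.det ≠ 0 := by
  intro h
  have := congrArg Matrix.det hV
  rw [Matrix.det_mul, h] at this
  simp at this

lemma norm_det_unitary' {V : Matrix (Fin n) (Fin n) ℂ} (hV : star V * V = 1) : ‖V.det‖ = 1 := by
  have := congrArg (fun M => ‖Matrix.det M‖) hV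
  simp only [Matrix.det_mul, Matrix.star_eq_conjTranspose, Matrix.det_conjTranspose, norm_mul, norm_star,
    Matrix.det_one, norm_one] at this
  nlinarith [norm_nonneg V.det]

lemma ghat_unit (F : Matrix (Fin (n+1)) (Fin (n+1)) ℂ → ℝ≥0∞) {u : ℂ} {U V : Matrix (Fin n) (Fin n) ℂ}
    (hu : star u * u = 1) (hV : star V * V = 1)
    (hF : ∀ B, F (bl u 0 0 U * B * bl 1 0 0 V) = F B) (a : ℂ) (C : Matrix (Fin n) (Fin n) ℂ) :
    ghat F (u * a) (U * C * V) = ghat F a C := by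
  have hu1 : ‖u‖ = 1 := by
    have := congrArg norm hu
    simp only [norm_mul, norm_star, norm_one] at this
    nlinarith [norm_nonneg u]
  have hu0 : u ≠ 0 := by intro h; simp [h] at hu1
  unfold ghat
  rw [lintegral_smul_pi u hu0, lintegral_vecMul V (det_unitary_ne hV), norm_det_unitary' hV, hu1]
  simp only [one_pow, ENNReal.ofReal_one, one_mul]
  refine lintegral_congr fun b => ?_
  rw [← bl_act, hF]

lemma ghat_conjInv {F : Matrix (Fin (n+1)) (Fin (n+1)) ℂ → ℝ≥0∞} (hF : ConjInv F) (a : ℂ) :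
    ConjInv (ghat F a) := by
  intro U hU C
  have := ghat_unit F (u := 1) (U := star U) (V := U) (by simp) hU (fun B => by
    have h := hF (bl 1 0 0 U) (bl_diag_unitary (by simp) hU) B
    rw [bl_star] at h
    simpa using h) a C
  rwa [one_mul] at this

lemma ghat_biInv {F : Matrix (Fin (n+1)) (Fin (n+1)) ℂ → ℝ≥0∞} (hF : BiInv F) (a : ℂ) :
    BiInv (ghat F a) := by
  intro U V hU hV C
  have := ghat_unit F (u := 1) (U := U) (V := V) (by simp) hV (fun B =>
    hF (bl 1 0 0 U) (bl 1 0 0 V) (bl_diag_unitary (by simp) hU) (bl_diag_unitary (by simp) hV) B) a C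
  rwa [one_mul] at this

lemma ghat_phase {F : Matrix (Fin (n+1)) (Fin (n+1)) ℂ → ℝ≥0∞} (hF : BiInv F) {u : ℂ} (hu : star u * u = 1)
    (a : ℂ) : ghat F (u * a) = ghat F a := by
  funext C
  have := ghat_unit F (u := u) (U := 1) (V := 1) hu (by simp) (fun B =>
    hF (bl u 0 0 1) (bl 1 0 0 1) (bl_diag_unitary hu (by simp)) (bl_diag_unitary (by simp) (by simp)) B) a C
  simpa using this

/-- iterated integration over strictly upper triangular parts -/
noncomputable def wn : (n : ℕ) → (Matrix (Fin n) (Fin n) ℂ → ℝ≥0∞) → (Fin n → ℂ) → ℝ≥0∞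
  | 0, F, _ => F 0
  | n+1, F, l => wn n (ghat F (l 0)) (Fin.tail l)

lemma measurable_wn {X : Type*} [MeasurableSpace X] : ∀ (n : ℕ) (G : X → Matrix (Fin n) (Fin n) ℂ → ℝ≥0∞)
    (_ : Measurable (Function.uncurry G)) (l : X → Fin n → ℂ) (_ : Measurable l),
    Measurable fun x => wn n (G x) (l x)
  | 0, G, hG, l, hl => by
      simp only [wn]
      exact hG.comp (measurable_id.prodMk measurable_const)
  | n+1, G, hG, l, hl => by
      simp only [wn]
      refine measurable_wn n (fun x => ghat (G x) (l x 0)) ?_ (fun x => Fin.tail (l x)) ?_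
      · unfold ghat Function.uncurry
        refine Measurable.lintegral_prod_right' (f := fun q : (X × Matrix (Fin n) (Fin n) ℂ) × (Fin n → ℂ) =>
          G q.1.1 (bl (l q.1.1 0) q.2 0 q.1.2)) ?_
        exact hG.comp (f := fun q : (X × Matrix (Fin n) (Fin n) ℂ) × (Fin n → ℂ) =>
          (q.1.1, bl (l q.1.1 0) q.2 0 q.1.2)) (by fun_prop)
      · unfold Fin.tail; fun_prop

@[fun_prop]
lemma measurable_wn' {X : Type*} [MeasurableSpace X] {F : Matrix (Fin n) (Fin n) ℂ → ℝ≥0∞} (hF : Measurable F)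
    {l : X → Fin n → ℂ} (hl : Measurable l) : Measurable fun x => wn n F (l x) :=
  measurable_wn n (fun _ => F) (hF.comp measurable_snd) l hl

/-- triangular with prescribed diagonal -/
def Tr (l : Fin n → ℂ) (C : Matrix (Fin n) (Fin n) ℂ) : Prop := (∀ i, C i i = l i) ∧ ∀ i j, j < i → C i j = 0

lemma Tr_bl {l : Fin (n+1) → ℂ} {C : Matrix (Fin n) (Fin n) ℂ} (h : Tr (Fin.tail l) C) (b : Fin n → ℂ) :
    Tr l (bl (l 0) b 0 C) := by
  constructor
  · intro i
    refine Fin.cases ?_ (fun i => ?_) i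
    · simp
    · simpa [Fin.tail] using h.1 i
  · intro i j
    refine Fin.cases ?_ (fun i => ?_) i
    · intro h; exact absurd h (Fin.not_lt_zero _)
    · refine Fin.cases ?_ (fun j => ?_) j
      · simp
      · intro hij; simpa using h.2 i j (by simpa using hij)

lemma Tr_det {l : Fin n → ℂ} {C : Matrix (Fin n) (Fin n) ℂ} (h : Tr l C) (z : ℂ) :
    (z • 1 - C).det = ∏ i, (z - l i) := by
  rw [Matrix.det_of_isUpperTriangular]
  · simp [h.1]
  · intro i j hij
    have hij' : j < i := hij
    simp [h.2 i j hij', Matrix.one_apply, hij'.ne']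

lemma Tr_rho {l : Fin n → ℂ} {C : Matrix (Fin n) (Fin n) ℂ} (h : Tr l C) (i : Fin n) : ‖l i‖ₑ ≤ rho C := by
  refine (rho_le_iff C _).1 le_rfl _ ?_
  rw [Tr_det h]
  exact Finset.prod_eq_zero (Finset.mem_univ i) (by simp)

lemma wn_le : ∀ {n : ℕ} {F G : Matrix (Fin n) (Fin n) ℂ → ℝ≥0∞} {l : Fin n → ℂ} {c : ℝ≥0∞} (_ : c ≠ ∞)
    (_ : ∀ C, Tr l C → F C ≤ c * G C), wn n F l ≤ c * wn n G l
  | 0, F, G, l, c, hc, h => h 0 ⟨fun i => i.elim0, fun i => i.elim0⟩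
  | n+1, F, G, l, c, hc, h => by
      simp only [wn]
      refine wn_le hc fun C hC => ?_
      unfold ghat
      rw [← lintegral_const_mul' _ _ hc]
      exact lintegral_mono fun b => h _ (Tr_bl hC b)

/-- constants -/
noncomputable def Cn : ℕ → ℝ≥0∞
  | 0 => volM 0 Set.univ
  | n+1 => kbl n * cn n * Cn n

/-- strict order indicator -/
noncomputable def sa (l : Fin n → ℂ) : ℝ≥0∞ := if StrictAnti (fun i => ‖l i‖) then 1 else 0

/-- Vandermonde square -/
noncomputable def vd (l : Fin n → ℂ) : ℝ≥0∞ := ENNReal.ofReal (‖(Matrix.vandermonde l).det‖ ^ 2)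

@[fun_prop]
lemma measurable_sa {X : Type*} [MeasurableSpace X] {l : X → Fin n → ℂ} (hl : Measurable l) :
    Measurable fun x => sa (l x) := by
  unfold sa
  refine Measurable.ite ?_ measurable_const measurable_const
  simp only [StrictAnti, Set.ofPred_forall]
  refine MeasurableSet.iInter fun i => MeasurableSet.iInter fun j => MeasurableSet.iInter fun h => ?_
  exact measurableSet_lt (by fun_prop) (by fun_prop)

@[fun_prop]
lemma measurable_vd {X : Type*} [MeasurableSpace X] {l : X → Fin n → ℂ} (hl : Measurable l) :
    Measurable fun x => vd (l x) := by
  unfold vd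
  simp only [Matrix.det_vandermonde]
  fun_prop

lemma lintegral_cons (f : (Fin (n+1) → ℂ) → ℝ≥0∞) (hf : Measurable f) :
    ∫⁻ l, f l = ∫⁻ a : ℂ, ∫⁻ m : Fin n → ℂ, f (Fin.cons a m) := by
  have h := (volume_preserving_piFinSuccAbove (fun _ : Fin (n+1) => ℂ) 0).symm
  rw [← h.lintegral_comp hf]
  rw [Measure.volume_eq_prod, lintegral_prod (fun a => f ((MeasurableEquiv.piFinSuccAbove (fun x => ℂ) 0).symm a))
    (hf.comp h.measurable).aemeasurable]
  refine lintegral_congr fun a => lintegral_congr fun m => ?_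
  congr 1
  rw [MeasurableEquiv.piFinSuccAbove_symm_apply]
  simp
  rfl

lemma en_lt (x y : ℂ) : ‖x‖ₑ < ‖y‖ₑ ↔ ‖x‖ < ‖y‖ := by
  rw [enorm_eq_nnnorm, enorm_eq_nnnorm, ENNReal.coe_lt_coe]; rfl

lemma sa_cons (a : ℂ) (m : Fin n → ℂ) : sa (Fin.cons a m : Fin (n+1) → ℂ) =
    (if ∀ i, ‖m i‖ₑ < ‖a‖ₑ then 1 else 0) * sa m := by
  unfold sa
  have : StrictAnti (fun i => ‖(Fin.cons a m : Fin (n+1) → ℂ) i‖) ↔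
      (∀ i, ‖m i‖ₑ < ‖a‖ₑ) ∧ StrictAnti (fun i => ‖m i‖) := by
    constructor
    · intro h
      refine ⟨fun i => ?_, fun i j hij => ?_⟩
      · have := h (Fin.succ_pos i)
        simpa [en_lt] using this
      · have := h (Fin.succ_lt_succ_iff.2 hij)
        simpa using this
    · rintro ⟨h1, h2⟩ i j
      refine Fin.cases ?_ (fun i => ?_) i <;> refine Fin.cases ?_ (fun j => ?_) j
      · simp
      · intro _
        simpa [en_lt] using h1 j
      · simp
      · intro hij
        simpa using h2 (Fin.succ_lt_succ_iff.1 hij)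
  simp only [this]
  by_cases hA : ∀ i, ‖m i‖ₑ < ‖a‖ₑ <;> by_cases hB : StrictAnti (fun i => ‖m i‖) <;> simp [hA, hB]

lemma vd_cons (a : ℂ) (m : Fin n → ℂ) : vd (Fin.cons a m : Fin (n+1) → ℂ) =
    ENNReal.ofReal (‖∏ i, (a - m i)‖ ^ 2) * vd m := by
  unfold vd
  rw [← ENNReal.ofReal_mul (by positivity), Matrix.det_vandermonde, Matrix.det_vandermonde, Fin.prod_univ_succ,
    Fin.prod_Ioi_zero]
  simp only [Fin.prod_Ioi_succ, Fin.cons_zero, Fin.cons_succ, norm_mul, mul_pow, norm_prod, norm_sub_rev a]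

lemma iter : ∀ (n : ℕ) (F : Matrix (Fin n) (Fin n) ℂ → ℝ≥0∞), Measurable F → ConjInv F →
    ∫⁻ B, F B ∂(volM n) ≤ Cn n * ∫⁻ l : Fin n → ℂ, sa l * vd l * wn n F l
  | 0, F, hF, hc => by
      have h1 : ∀ B : Matrix (Fin 0) (Fin 0) ℂ, F B = F 0 := fun B => by rw [Subsingleton.elim B 0]
      simp only [h1, lintegral_const, Cn, wn]
      have h2 : ∀ l : Fin 0 → ℂ, sa l * vd l = 1 := by
        intro l
        have : StrictAnti (fun i => ‖l i‖) := fun i => i.elim0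
        simp [sa, vd, this]
      simp [h2, mul_comm, volume_pi]
  | n+1, F, hF, hc => by
      refine (deflate' F hF hc).trans ?_
      rw [Cn, mul_assoc (kbl n * cn n)]
      refine mul_le_mul' le_rfl ?_
      rw [lintegral_cons _ (by fun_prop), ← lintegral_const_mul _ (by fun_prop)]
      refine lintegral_mono fun a => ?_
      refine (iter n (fun C => dws a C * ghat F a C) (by fun_prop) ?_).trans ?_
      · intro U hU C
        simp only
        rw [dws_conj hU, ghat_conjInv hc a U hU C]
      refine mul_le_mul' le_rfl (lintegral_mono fun m => ?_)
      simp only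
      rw [sa_cons, vd_cons]
      have h1 : wn n (fun C => dws a C * ghat F a C) m ≤
          ((if ∀ i, ‖m i‖ₑ < ‖a‖ₑ then 1 else 0) * ENNReal.ofReal (‖∏ i, (a - m i)‖ ^ 2)) * wn n (ghat F a) m := by
        refine wn_le (ENNReal.mul_ne_top (by split_ifs <;> simp) ENNReal.ofReal_ne_top) fun C hC => ?_
        gcongr
        unfold dws
        rw [Tr_det hC]
        gcongr
        unfold ilt
        by_cases h : rho C < ‖a‖ₑ
        · rw [if_pos h, if_pos]
          exact fun i => (Tr_rho hC i).trans_lt h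
        · rw [if_neg h]; exact zero_le
      have h2 : wn (n+1) F (Fin.cons a m) = wn n (ghat F a) m := by simp [wn]
      rw [h2]
      calc sa m * vd m * wn n (fun C => dws a C * ghat F a C) m ≤ sa m * vd m * (((if ∀ i, ‖m i‖ₑ < ‖a‖ₑ then 1 else 0) *
            ENNReal.ofReal (‖∏ i, (a - m i)‖ ^ 2)) * wn n (ghat F a) m) := by gcongr
        _ = _ := by ring

end part9


section part10
variable {n : ℕ}

/-- two step block matrix -/
def bl2 (a β γ a' : ℂ) (x y : Fin n → ℂ) (C : Matrix (Fin n) (Fin n) ℂ) :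
    Matrix (Fin (n+1+1)) (Fin (n+1+1)) ℂ := bl a (Fin.cons β x) (Fin.cons γ 0) (bl a' y 0 C)

lemma bl2_left (p q r s : ℂ) (a β γ a' : ℂ) (x y : Fin n → ℂ) (C : Matrix (Fin n) (Fin n) ℂ) :
    bl2 p q r s 0 0 1 * bl2 a β γ a' x y C =
      bl2 (p * a + q * γ) (p * β + q * a') (r * a + s * γ) (r * β + s * a') (p • x + q • y) (r • x + s • y) C := by
  unfold bl2
  ext i j
  refine Fin.cases ?_ (fun i => ?_) i <;> [skip; refine Fin.cases ?_ (fun i => ?_) i] <;>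
    (refine Fin.cases ?_ (fun j => ?_) j <;> [skip; refine Fin.cases ?_ (fun j => ?_) j]) <;>
    simp [-Fin.succ_zero_eq_one, -Fin.succ_zero_eq_one', Matrix.mul_apply, Fin.sum_univ_succ, Matrix.one_apply]

lemma bl2_right (p q r s : ℂ) (a β γ a' : ℂ) (x y : Fin n → ℂ) (C : Matrix (Fin n) (Fin n) ℂ) :
    bl2 a β γ a' x y C * bl2 p q r s 0 0 1 =
      bl2 (a * p + β * r) (a * q + β * s) (γ * p + a' * r) (γ * q + a' * s) x y C := by
  unfold bl2
  ext i j
  refine Fin.cases ?_ (fun i => ?_) i <;> [skip; refine Fin.cases ?_ (fun i => ?_) i] <;>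
    (refine Fin.cases ?_ (fun j => ?_) j <;> [skip; refine Fin.cases ?_ (fun j => ?_) j]) <;>
    simp [-Fin.succ_zero_eq_one, -Fin.succ_zero_eq_one', Matrix.mul_apply, Fin.sum_univ_succ, Matrix.one_apply]

lemma bl2_star (p q r s : ℂ) : star (bl2 p q r s 0 0 (1 : Matrix (Fin n) (Fin n) ℂ)) =
    bl2 (star p) (star r) (star q) (star s) 0 0 1 := by
  unfold bl2
  ext i j
  refine Fin.cases ?_ (fun i => ?_) i <;> [skip; refine Fin.cases ?_ (fun i => ?_) i] <;>
    (refine Fin.cases ?_ (fun j => ?_) j <;> [skip; refine Fin.cases ?_ (fun j => ?_) j]) <;>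
    simp [-Fin.succ_zero_eq_one, -Fin.succ_zero_eq_one', Matrix.star_apply, Matrix.one_apply, eq_comm]

lemma bl2_one : bl2 1 0 0 1 0 0 (1 : Matrix (Fin n) (Fin n) ℂ) = 1 := by
  unfold bl2
  ext i j
  refine Fin.cases ?_ (fun i => ?_) i <;> [skip; refine Fin.cases ?_ (fun i => ?_) i] <;>
    (refine Fin.cases ?_ (fun j => ?_) j <;> [skip; refine Fin.cases ?_ (fun j => ?_) j]) <;>
    simp [-Fin.succ_zero_eq_one, -Fin.succ_zero_eq_one', Matrix.one_apply, Fin.succ_ne_zero, (Fin.succ_ne_zero _).symm]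

/-- row rotation -/
def rotL (n : ℕ) (p q : ℂ) : ((Fin n → ℂ) × (Fin n → ℂ)) →ₗ[ℝ] ((Fin n → ℂ) × (Fin n → ℂ)) where
  toFun x := (star p • x.1 + star q • x.2, (-q) • x.1 + p • x.2)
  map_add' x y := by
    ext i <;> simp <;> ring
  map_smul' t x := by
    ext i <;> simp <;> ring

lemma rot_norm (p q x y : ℂ) (h : ‖p‖ ^ 2 + ‖q‖ ^ 2 = 1) :
    ‖star p * x + star q * y‖ ^ 2 + ‖-q * x + p * y‖ ^ 2 = ‖x‖ ^ 2 + ‖y‖ ^ 2 := by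
  simp only [Complex.sq_norm, Complex.normSq_apply] at h ⊢
  simp
  linear_combination (x.re * x.re + x.im * x.im + (y.re * y.re + y.im * y.im)) * h

lemma pres_rot (p q : ℂ) (h : ‖p‖ ^ 2 + ‖q‖ ^ 2 = 1) :
    MeasurePreserving (rotL n p q) ((volume : Measure (Fin n → ℂ)).prod (volume : Measure (Fin n → ℂ)))
      ((volume : Measure (Fin n → ℂ)).prod (volume : Measure (Fin n → ℂ))) := by
  have : ((volume : Measure (Fin n → ℂ)).prod (volume : Measure (Fin n → ℂ))).IsAddHaarMeasure :=
    Measure.prod.instIsAddHaarMeasure _ _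
  refine pres_of_quad _ (rotL n p q) (fun x => ∑ j, (‖x.1 j‖ ^ 2 + ‖x.2 j‖ ^ 2)) (by fun_prop) ?_ (by simp) ?_
  · intro x
    refine Finset.sum_congr rfl fun j _ => ?_
    rw [← rot_norm p q (x.1 j) (x.2 j) h]
    simp [rotL]
  · intro x
    rw [Finset.sum_add_distrib, Prod.norm_def]
    have h1 := norm_sq_le_sum x.1
    have h2 := norm_sq_le_sum x.2
    have h3 : 0 ≤ ∑ j, ‖x.1 j‖ ^ 2 := by positivity
    have h4 : 0 ≤ ∑ j, ‖x.2 j‖ ^ 2 := by positivity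
    rcases max_cases ‖x.1‖ ‖x.2‖ with ⟨e, _⟩ | ⟨e, _⟩ <;> rw [e] <;> linarith

/-- integral over two rows -/
noncomputable def rowI (g : Matrix (Fin (n+1+1)) (Fin (n+1+1)) ℂ → ℝ≥0∞) (C : Matrix (Fin n) (Fin n) ℂ)
    (a a' β : ℂ) : ℝ≥0∞ :=
  ∫⁻ x : (Fin n → ℂ) × (Fin n → ℂ), g (bl2 a β 0 a' x.1 x.2 C) ∂(volume.prod volume)

lemma measurable_cons {X : Type*} [MeasurableSpace X] {a : X → ℂ} {b : X → Fin n → ℂ} (ha : Measurable a)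
    (hb : Measurable b) : Measurable fun x => (Fin.cons (a x) (b x) : Fin (n+1) → ℂ) := by
  rw [measurable_pi_iff]
  intro i
  refine Fin.cases ?_ (fun i => ?_) i
  · simpa using ha
  · simp only [Fin.cons_succ]; fun_prop

@[fun_prop]
lemma measurable_bl2 {X : Type*} [MeasurableSpace X] {a b c d : X → ℂ} {x y : X → Fin n → ℂ}
    {C : X → Matrix (Fin n) (Fin n) ℂ}
    (ha : Measurable a) (hb : Measurable b) (hc : Measurable c) (hd : Measurable d)
    (hx : Measurable x) (hy : Measurable y) (hC : Measurable C) :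
    Measurable fun t => bl2 (a t) (b t) (c t) (d t) (x t) (y t) (C t) := by
  unfold bl2
  exact measurable_bl' ha (measurable_cons hb hx) (measurable_cons hc measurable_const)
    (measurable_bl' hd hy measurable_const hC)

lemma rowI_swap {g : Matrix (Fin (n+1+1)) (Fin (n+1+1)) ℂ → ℝ≥0∞} (hg : Measurable g) (hi : BiInv g)
    (C : Matrix (Fin n) (Fin n) ℂ) (a a' β : ℂ) : rowI g C a a' β = rowI g C a' a (star β) := by
  by_cases h0 : β = 0 ∧ a' = a
  · rw [h0.1, h0.2]; simp
  set d := a' - a with hd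
  set N : ℝ := Real.sqrt (‖β‖ ^ 2 + ‖d‖ ^ 2) with hN
  have hpos : 0 < ‖β‖ ^ 2 + ‖d‖ ^ 2 := by
    by_cases h1 : β = 0
    · have : d ≠ 0 := fun h => h0 ⟨h1, sub_eq_zero.1 h⟩
      positivity
    · positivity
  have hN0 : 0 < N := Real.sqrt_pos.2 hpos
  have hN2 : N ^ 2 = ‖β‖ ^ 2 + ‖d‖ ^ 2 := Real.sq_sqrt hpos.le
  have hNc : (N : ℂ) ≠ 0 := by exact_mod_cast hN0.ne'
  set p : ℂ := β / N with hp
  set q : ℂ := d / N with hq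
  have hpβ : β = N * p := by rw [hp]; field_simp
  have hqd : d = N * q := by rw [hq]; field_simp
  have hpq : ‖p‖ ^ 2 + ‖q‖ ^ 2 = 1 := by
    rw [hp, hq]
    simp only [norm_div, Complex.norm_real, Real.norm_eq_abs, div_pow, sq_abs]
    rw [← add_div, ← hN2, div_self (by positivity)]
  have hpq' : star p * p + star q * q = 1 := by
    have e : ∀ z : ℂ, star z * z = ((‖z‖ ^ 2 : ℝ) : ℂ) := fun z => by
      rw [Complex.star_def, Complex.conj_mul']; push_cast; rfl
    rw [e, e, ← Complex.ofReal_add, hpq]; simp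
  have ha' : a' = a + N * q := by rw [← hqd, hd]; ring
  have hV : star (bl2 p (-star q) q (star p) 0 0 (1 : Matrix (Fin n) (Fin n) ℂ)) *
      bl2 p (-star q) q (star p) 0 0 1 = 1 := by
    rw [bl2_star, bl2_left, ← bl2_one]
    simp only [star_neg, star_star, smul_zero, add_zero]
    congr 1
    · ring
    · ring
    · linear_combination hpq'
  have hV' : star (star (bl2 p (-star q) q (star p) 0 0 (1 : Matrix (Fin n) (Fin n) ℂ))) *
      star (bl2 p (-star q) q (star p) 0 0 1) = 1 := by
    rw [star_star]; exact mul_eq_one_comm.1 hV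
  have key : ∀ x : (Fin n → ℂ) × (Fin n → ℂ), g (bl2 a β 0 a' x.1 x.2 C) =
      g (bl2 a' (star β) 0 a (rotL n p q x).1 (rotL n p q x).2 C) := by
    intro x
    rw [← hi _ _ hV' hV, bl2_star, bl2_left, bl2_right]
    simp only [star_neg, star_star, rotL, LinearMap.coe_mk, AddHom.coe_mk]
    have hsβ : star β = N * star p := by rw [hpβ]; simp
    congr 1
    rw [hsβ, ha', hpβ]
    congr 1
    · linear_combination (a + N * q) * hpq'
    · linear_combination (N * star p) * hpq'
    · ring
    · linear_combination a * hpq'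
  unfold rowI
  simp only [key]
  exact (pres_rot p q hpq).lintegral_comp (f := fun x => g (bl2 a' (star β) 0 a x.1 x.2 C)) (by fun_prop)

lemma ghat_ghat {g : Matrix (Fin (n+1+1)) (Fin (n+1+1)) ℂ → ℝ≥0∞} (hg : Measurable g)
    (C : Matrix (Fin n) (Fin n) ℂ) (a a' : ℂ) : ghat (ghat g a) a' C = ∫⁻ β : ℂ, rowI g C a a' β := by
  have h1 : ∀ y : Fin n → ℂ, ghat g a (bl a' y 0 C) =
      ∫⁻ β : ℂ, ∫⁻ x : Fin n → ℂ, g (bl2 a β 0 a' x y C) := by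
    intro y
    unfold ghat
    rw [lintegral_cons _ (by fun_prop)]
    unfold bl2
    have : (Fin.cons 0 0 : Fin (n+1) → ℂ) = 0 := by
      funext i; refine Fin.cases ?_ (fun i => ?_) i <;> simp
    rw [this]
  rw [ghat]
  simp only [h1]
  rw [lintegral_lintegral_swap (by fun_prop)]
  refine lintegral_congr fun β => ?_
  unfold rowI
  rw [lintegral_prod_symm _ (by fun_prop)]

lemma lintegral_star (f : ℂ → ℝ≥0∞) : ∫⁻ z, f (star z) = ∫⁻ z, f z :=
  (Complex.conjLIE.measurePreserving).lintegral_comp_emb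
    (Complex.conjLIE.toHomeomorph.measurableEmbedding) f

lemma ghat_comm {g : Matrix (Fin (n+1+1)) (Fin (n+1+1)) ℂ → ℝ≥0∞} (hg : Measurable g) (hi : BiInv g)
    (a a' : ℂ) : ghat (ghat g a) a' = ghat (ghat g a') a := by
  funext C
  rw [ghat_ghat hg, ghat_ghat hg, ← lintegral_star]
  refine lintegral_congr fun β => ?_
  rw [rowI_swap hg hi, star_star]

lemma wn_adj : ∀ (n : ℕ) (g : Matrix (Fin (n+1)) (Fin (n+1)) ℂ → ℝ≥0∞), Measurable g → BiInv g → ∀ (i : Fin n)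
    (l : Fin (n+1) → ℂ), wn (n+1) g (l ∘ Equiv.swap i.castSucc i.succ) = wn (n+1) g l
  | 0, g, hg, hi, i, l => i.elim0
  | n+1, g, hg, hi, i, l => by
      refine Fin.cases ?_ (fun i => ?_) i
      · simp only [wn]
        have h0 : (l ∘ Equiv.swap (Fin.castSucc 0) (Fin.succ 0)) 0 = l 1 := by simp
        have h1 : Fin.tail (l ∘ Equiv.swap (Fin.castSucc (0 : Fin (n+1))) (Fin.succ 0)) 0 = l 0 := by simp [Fin.tail]
        have h2 : Fin.tail (Fin.tail (l ∘ Equiv.swap (Fin.castSucc (0 : Fin (n+1))) (Fin.succ 0))) = Fin.tail (Fin.tail l) := by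
          funext j
          simp only [Fin.tail, Function.comp]
          rw [Equiv.swap_apply_of_ne_of_ne]
          · simp
          · intro h
            have := congrArg Fin.val h
            simp at this
        rw [h0, h1, h2, ghat_comm hg hi]
        rfl
      · rw [wn, wn]
        have h0 : (l ∘ Equiv.swap (Fin.castSucc i.succ) (Fin.succ i.succ)) 0 = l 0 := by
          simp only [Function.comp]
          rw [Equiv.swap_apply_of_ne_of_ne]
          · intro h
            have := congrArg Fin.val h
            simp at this
          · exact (Fin.succ_ne_zero _).symm
        have h1 : Fin.tail (l ∘ Equiv.swap (Fin.castSucc i.succ) (Fin.succ i.succ)) =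
            Fin.tail l ∘ Equiv.swap i.castSucc i.succ := by
          funext j
          simp only [Fin.tail, Function.comp, ← Fin.succ_castSucc]
          rw [Function.Injective.map_swap (Fin.succ_injective _)]
        rw [h0, h1]
        exact wn_adj n _ (by fun_prop) (ghat_biInv hi _) i _

lemma wn_perm {n : ℕ} {g : Matrix (Fin n) (Fin n) ℂ → ℝ≥0∞} (hg : Measurable g) (hi : BiInv g)
    (π : Equiv.Perm (Fin n)) : ∀ l : Fin n → ℂ, wn n g (l ∘ π) = wn n g l := by
  cases n with
  | zero => intro l; rfl
  | succ n =>
    have h : π ∈ Submonoid.closure (Set.range fun i : Fin n ↦ Equiv.swap i.castSucc i.succ) := by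
      rw [Equiv.Perm.mclosure_swap_castSucc_succ]; trivial
    induction h using Submonoid.closure_induction with
    | mem x hx =>
      obtain ⟨i, rfl⟩ := hx
      exact wn_adj n g hg hi i
    | one => intro l; rfl
    | mul x y _ _ hx hy =>
      intro l
      rw [Equiv.Perm.coe_mul, ← Function.comp_assoc, hy, hx]

lemma wn_phase : ∀ (n : ℕ) (g : Matrix (Fin n) (Fin n) ℂ → ℝ≥0∞), BiInv g → ∀ (l u : Fin n → ℂ),
    (∀ i, star (u i) * u i = 1) → wn n g (u * l) = wn n g l
  | 0, g, hi, l, u, hu => rfl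
  | n+1, g, hi, l, u, hu => by
      simp only [wn]
      rw [Pi.mul_apply, ghat_phase hi (hu 0)]
      exact wn_phase n _ (ghat_biInv hi _) (Fin.tail l) (Fin.tail u) (fun i => hu i.succ)

/-- monomial weight -/
noncomputable def mo (l : Fin n → ℂ) : ℝ≥0∞ := ∏ i, ENNReal.ofReal (‖l i‖ ^ (2 * (i.rev : ℕ)))

@[fun_prop]
lemma measurable_mo {X : Type*} [MeasurableSpace X] {l : X → Fin n → ℂ} (hl : Measurable l) :
    Measurable fun x => mo (l x) := by
  unfold mo; fun_prop

lemma mo_cons (a : ℂ) (m : Fin n → ℂ) : mo (Fin.cons a m : Fin (n+1) → ℂ) =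
    ENNReal.ofReal (‖a‖ ^ (2 * n)) * mo m := by
  unfold mo
  rw [Fin.prod_univ_succ]
  simp [Fin.rev_succ]

lemma BiInv.linv {g : Matrix (Fin n) (Fin n) ℂ → ℝ≥0∞} (hi : BiInv g) : LInv g := by
  intro U hU B
  have := hi U 1 hU (by simp) B
  simpa using this

lemma col_iter : ∀ (n : ℕ) (g : Matrix (Fin n) (Fin n) ℂ → ℝ≥0∞), Measurable g → BiInv g →
    ∫⁻ B, g B ∂(volM n) = Cn n * ∫⁻ l : Fin n → ℂ, mo l * wn n g l
  | 0, g, hg, hi => by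
      have h1 : ∀ B : Matrix (Fin 0) (Fin 0) ℂ, g B = g 0 := fun B => by rw [Subsingleton.elim B 0]
      simp only [h1, lintegral_const, Cn, wn]
      simp [mo, mul_comm, volume_pi]
  | n+1, g, hg, hi => by
      have := column hg hi.linv (fun _ => 1) measurable_const
      simp only [one_mul] at this
      rw [this, Cn, mul_assoc (kbl n * cn n), lintegral_cons _ (by fun_prop)]
      congr 1
      rw [← lintegral_const_mul _ (by fun_prop)]
      refine lintegral_congr fun a => ?_
      rw [col_iter n _ (by fun_prop) (ghat_biInv hi a), mul_left_comm, ← lintegral_const_mul _ (by fun_prop)]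
      congr 1
      refine lintegral_congr fun m => ?_
      rw [mo_cons, mul_assoc]
      rfl

lemma col_first {g : Matrix (Fin (n+1)) (Fin (n+1)) ℂ → ℝ≥0∞} (hg : Measurable g) (hi : BiInv g)
    (h : ℝ → ℝ≥0∞) (hh : Measurable h) :
    ∫⁻ B, h (∑ i, ‖B i 0‖ ^ 2) * g B ∂(volM (n+1)) =
      Cn (n+1) * ∫⁻ l : Fin (n+1) → ℂ, h (‖l 0‖ ^ 2) * (mo l * wn (n+1) g l) := by
  rw [column hg hi.linv h hh, Cn, mul_assoc (kbl n * cn n), lintegral_cons _ (by fun_prop)]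
  congr 1
  rw [← lintegral_const_mul _ (by fun_prop)]
  refine lintegral_congr fun a => ?_
  rw [col_iter n _ (by fun_prop) (ghat_biInv hi a), mul_left_comm, mul_left_comm (ENNReal.ofReal _), mul_left_comm (h _),
    ← lintegral_const_mul _ (by fun_prop), ← lintegral_const_mul _ (by fun_prop)]
  congr 1
  refine lintegral_congr fun m => ?_
  rw [mo_cons, mul_assoc]
  rfl

end part10


section part11
variable {n : ℕ}

lemma root_orth {N : ℕ} {ζ : ℂ} (hζ : IsPrimitiveRoot ζ N) (hζ1 : star ζ * ζ = 1) (a b : Fin N) :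
    ∑ j : Fin N, (ζ ^ (j : ℕ)) ^ (a : ℕ) * star ((ζ ^ (j : ℕ)) ^ (b : ℕ)) = if a = b then (N : ℂ) else 0 := by
  have e : ∀ j : Fin N, (ζ ^ (j : ℕ)) ^ (a : ℕ) * star ((ζ ^ (j : ℕ)) ^ (b : ℕ)) =
      (ζ ^ (a : ℕ) * (star ζ) ^ (b : ℕ)) ^ (j : ℕ) := by
    intro j
    rw [star_pow, star_pow, mul_pow, ← pow_mul, ← pow_mul, ← pow_mul, ← pow_mul, mul_comm (a : ℕ), mul_comm (b : ℕ)]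
  simp only [e]
  split_ifs with hab
  · subst hab
    rw [← mul_pow, mul_comm, hζ1]; simp
  · set z := ζ ^ (a : ℕ) * (star ζ) ^ (b : ℕ) with hz
    have hzN : z ^ N = 1 := by
      rw [hz, mul_pow, ← pow_mul, ← pow_mul, mul_comm (a : ℕ), mul_comm (b : ℕ), pow_mul, pow_mul, ← star_pow,
        hζ.pow_eq_one]
      simp
    have hz1 : z ≠ 1 := by
      intro h
      apply hab
      have : ζ ^ (a : ℕ) = ζ ^ (b : ℕ) := by
        calc ζ ^ (a : ℕ) = ζ ^ (a : ℕ) * (star ζ * ζ) ^ (b : ℕ) := by rw [hζ1]; simp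
          _ = z * ζ ^ (b : ℕ) := by rw [hz, mul_pow]; ring
          _ = _ := by rw [h, one_mul]
      exact Fin.ext (hζ.pow_inj a.2 b.2 this)
    rw [Fin.sum_univ_eq_sum_range (fun j => z ^ j) N]
    have := mul_geom_sum z N
    rw [hzN, sub_self] at this
    exact (mul_eq_zero.1 this).resolve_left (sub_ne_zero.2 hz1)

lemma vand_expand {N : ℕ} (v : Fin N → ℂ) : (Matrix.vandermonde v).det =
    ∑ σ : Equiv.Perm (Fin N), ((Equiv.Perm.sign σ : ℤ) : ℂ) * ∏ i, v i ^ (σ i : ℕ) := by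
  rw [← Matrix.det_transpose, Matrix.det_apply']
  rfl

lemma vand_avg {N : ℕ} {ζ : ℂ} (hζ : IsPrimitiveRoot ζ N) (hζ1 : star ζ * ζ = 1) (l : Fin N → ℂ) :
    ∑ k : Fin N → Fin N, ‖(Matrix.vandermonde ((fun i => ζ ^ (k i : ℕ)) * l)).det‖ ^ 2 =
      (N : ℝ) ^ N * ∑ σ : Equiv.Perm (Fin N), ∏ i, ‖l i‖ ^ (2 * (σ i : ℕ)) := by
  have e : ∀ z : ℂ, ((‖z‖ ^ 2 : ℝ) : ℂ) = z * star z := fun z => by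
    rw [Complex.star_def, Complex.mul_conj']; push_cast; rfl
  apply Complex.ofReal_injective
  rw [Complex.ofReal_sum]
  simp only [e, vand_expand]
  let A : Equiv.Perm (Fin N) → ℂ := fun σ => ((Equiv.Perm.sign σ : ℤ) : ℂ) * ∏ i, l i ^ (σ i : ℕ)
  have h1 : ∀ (k : Fin N → Fin N) (σ : Equiv.Perm (Fin N)), ((Equiv.Perm.sign σ : ℤ) : ℂ) *
      ∏ i, ((fun i => ζ ^ (k i : ℕ)) * l) i ^ (σ i : ℕ) = A σ * ∏ i, (ζ ^ (k i : ℕ)) ^ (σ i : ℕ) := by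
    intro k σ
    simp only [A, Pi.mul_apply, mul_pow, Finset.prod_mul_distrib]
    ring
  simp only [h1, star_sum, Finset.sum_mul_sum, star_mul, star_prod]
  rw [Finset.sum_comm]
  have h2 : ∀ σ τ : Equiv.Perm (Fin N), ∑ k : Fin N → Fin N, (A σ * ∏ i, (ζ ^ (k i : ℕ)) ^ (σ i : ℕ)) *
      ((∏ i, star ((ζ ^ (k i : ℕ)) ^ (τ i : ℕ))) * star (A τ)) = if τ = σ then (N : ℂ) ^ N * (A σ * star (A σ)) else 0 := by
    intro σ τ
    have : ∀ k : Fin N → Fin N, (A σ * ∏ i, (ζ ^ (k i : ℕ)) ^ (σ i : ℕ)) *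
      ((∏ i, star ((ζ ^ (k i : ℕ)) ^ (τ i : ℕ))) * star (A τ)) =
      (A σ * star (A τ)) * ∏ i, ((ζ ^ (k i : ℕ)) ^ (σ i : ℕ) * star ((ζ ^ (k i : ℕ)) ^ (τ i : ℕ))) := by
      intro k; rw [Finset.prod_mul_distrib]; ring
    simp only [this]
    rw [← Finset.mul_sum, ← Fintype.prod_sum (fun i (j : Fin N) => ((ζ ^ (j : ℕ)) ^ (σ i : ℕ) * star ((ζ ^ (j : ℕ)) ^ (τ i : ℕ))))]
    simp only [root_orth hζ hζ1]
    split_ifs with h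
    · subst h; simp; ring
    · obtain ⟨i, hi⟩ : ∃ i, σ i ≠ τ i := by
        by_contra hc; push Not at hc; exact h (Equiv.ext fun i => (hc i).symm)
      rw [Finset.prod_eq_zero (Finset.mem_univ i) (if_neg hi), mul_zero]
  have h3 : ∀ σ : Equiv.Perm (Fin N), A σ * star (A σ) = ((∏ i, ‖l i‖ ^ (2 * (σ i : ℕ)) : ℝ) : ℂ) := by
    intro σ
    rw [← e]
    simp only [A, norm_mul, norm_prod, norm_pow]
    have hs : ‖((Equiv.Perm.sign σ : ℤ) : ℂ)‖ = 1 := by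
      rcases Int.units_eq_one_or (Equiv.Perm.sign σ) with h | h <;> rw [h] <;> simp
    rw [hs, one_mul, ← Finset.prod_pow]
    congr 1
    refine Finset.prod_congr rfl fun i _ => ?_
    rw [← pow_mul, mul_comm]
  calc _ = ∑ σ : Equiv.Perm (Fin N), ∑ τ : Equiv.Perm (Fin N), ∑ k : Fin N → Fin N, (A σ * ∏ i, (ζ ^ (k i : ℕ)) ^ (σ i : ℕ)) *
      ((∏ i, star ((ζ ^ (k i : ℕ)) ^ (τ i : ℕ))) * star (A τ)) :=
        Finset.sum_congr rfl fun σ _ => Finset.sum_comm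
    _ = _ := by
      simp only [h2, h3, Finset.sum_ite_eq', Finset.sum_ite_eq, Finset.mem_univ, if_true, ← Finset.mul_sum]
      push_cast
      rfl

lemma pres_mul {u : Fin n → ℂ} (hu : ∀ i, star (u i) * u i = 1) :
    MeasurePreserving (fun l : Fin n → ℂ => u * l) volume volume := by
  have : ∀ i, MeasurePreserving (fun z : ℂ => u i * z) volume volume := by
    intro i
    have hu1 : ‖u i‖ = 1 := by
      have := congrArg norm (hu i)
      simp only [norm_mul, norm_star, norm_one] at this
      nlinarith [norm_nonneg (u i)]
    exact pres_of_quad volume (LinearMap.mulLeft ℝ (u i)) (fun z => ‖z‖ ^ 2) (by fun_prop)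
      (fun z => by simp [hu1]) (by simp) (fun z => le_rfl)
  exact volume_preserving_pi this

/-- symmetric weight -/
noncomputable def sw (l : Fin n → ℂ) : ℝ≥0∞ :=
  ∑ σ : Equiv.Perm (Fin n), ∏ i, ENNReal.ofReal (‖l i‖ ^ (2 * (σ i : ℕ)))

lemma phase_avg (hn : n ≠ 0) (Φ : (Fin n → ℂ) → ℝ≥0∞) (hΦ : Measurable Φ)
    (hp : ∀ u l : Fin n → ℂ, (∀ i, star (u i) * u i = 1) → Φ (u * l) = Φ l) :
    ∫⁻ l, vd l * Φ l = ∫⁻ l, sw l * Φ l := by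
  have : NeZero n := ⟨hn⟩
  obtain ⟨ζ, hζ⟩ : ∃ ζ : ℂ, IsPrimitiveRoot ζ n := ⟨_, Complex.isPrimitiveRoot_exp n hn⟩
  have hζ1 : star ζ * ζ = 1 := by
    rw [Complex.star_def, Complex.conj_mul', hζ.norm'_eq_one hn]; simp
  have h1 : ∀ k : Fin n → Fin n, ∫⁻ l, vd l * Φ l = ∫⁻ l, vd ((fun i => ζ ^ (k i : ℕ)) * l) * Φ l := by
    intro k
    have hu : ∀ i, star (ζ ^ (k i : ℕ)) * ζ ^ (k i : ℕ) = 1 := by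
      intro i; rw [star_pow, ← mul_pow, hζ1, one_pow]
    rw [← (pres_mul (u := fun i => ζ ^ (k i : ℕ)) hu).lintegral_comp (f := fun l => vd l * Φ l) (by fun_prop)]
    refine lintegral_congr fun l => ?_
    rw [hp _ _ hu]
  have h2 : ∑ k : Fin n → Fin n, ∫⁻ l, vd l * Φ l = ∑ k : Fin n → Fin n, ∫⁻ l, vd ((fun i => ζ ^ (k i : ℕ)) * l) * Φ l :=
    Finset.sum_congr rfl fun k _ => h1 k
  rw [← lintegral_finsetSum (f := fun (k : Fin n → Fin n) l => vd ((fun i => ζ ^ (k i : ℕ)) * l) * Φ l) _ (fun k _ => by fun_prop)] at h2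
  have h3 : ∀ l : Fin n → ℂ, ∑ k : Fin n → Fin n, vd ((fun i => ζ ^ (k i : ℕ)) * l) = (n : ℝ≥0∞) ^ n * sw l := by
    intro l
    unfold vd sw
    rw [← ENNReal.ofReal_sum_of_nonneg (fun _ _ => by positivity), vand_avg hζ hζ1,
      ENNReal.ofReal_mul (by positivity), ENNReal.ofReal_sum_of_nonneg (fun _ _ => by positivity)]
    congr 1
    · rw [ENNReal.ofReal_pow (by positivity), ENNReal.ofReal_natCast]
    · refine Finset.sum_congr rfl fun σ _ => ?_
      rw [ENNReal.ofReal_prod_of_nonneg (fun _ _ => by positivity)]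
  have h4 : ∀ l : Fin n → ℂ, ∑ k : Fin n → Fin n, vd ((fun i => ζ ^ (k i : ℕ)) * l) * Φ l =
      (n : ℝ≥0∞) ^ n * (sw l * Φ l) := by
    intro l; rw [← Finset.sum_mul, h3, mul_assoc]
  rw [lintegral_congr h4] at h2
  rw [lintegral_const_mul _ (by unfold sw; fun_prop), Finset.sum_const, Finset.card_univ] at h2
  simp only [Fintype.card_pi, Fintype.card_fin, Finset.prod_const, Finset.card_univ, nsmul_eq_mul, Nat.cast_pow] at h2
  refine (ENNReal.mul_right_inj ?_ ?_).1 h2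
  · exact pow_ne_zero _ (by exact_mod_cast hn)
  · exact ENNReal.pow_ne_top (ENNReal.natCast_ne_top n)

lemma pres_perm (e : Equiv.Perm (Fin n)) : MeasurePreserving (fun l : Fin n → ℂ => l ∘ e) volume volume := by
  have := volume_measurePreserving_piCongrLeft (fun _ : Fin n => ℂ) e.symm
  convert this using 1
  funext l i
  have h := Equiv.piCongrLeft_apply_apply (fun _ : Fin n => ℂ) e.symm l (e i)
  simp only [Equiv.symm_apply_apply] at h
  exact h.symm

lemma sa_sum (l : Fin n → ℂ) : ∑ e : Equiv.Perm (Fin n), sa (l ∘ e) ≤ 1 := by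
  classical
  unfold sa
  rw [Finset.sum_boole]
  have : (Finset.univ.filter fun e : Equiv.Perm (Fin n) => StrictAnti fun i => ‖(l ∘ e) i‖).card ≤ 1 := by
    rw [Finset.card_le_one]
    intro e he e' he'
    simp only [Finset.mem_filter, Finset.mem_univ, true_and, Function.comp] at he he'
    have hm : StrictMono (e'.trans e.symm) := by
      intro i j hij
      have h := he' hij
      have h' : ‖l (e (e.symm (e' j)))‖ < ‖l (e (e.symm (e' i)))‖ := by simpa using h
      exact (StrictAnti.lt_iff_gt he).1 h'
    have h2 : (e'.trans e.symm : Fin n → Fin n) = id := by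
      refine (StrictMono.range_inj hm strictMono_id).1 ?_
      rw [(e'.trans e.symm).surjective.range_eq, Set.range_id]
    ext i
    have := congrFun h2 i
    simp only [Equiv.trans_apply, id, Equiv.symm_apply_eq] at this
    rw [this]
  exact_mod_cast this

lemma perm_avg (K : (Fin n → ℂ) → ℝ≥0∞) (hK : Measurable K) (hs : ∀ (e : Equiv.Perm (Fin n)) l, K (l ∘ e) = K l) :
    ∫⁻ l, sw l * (sa l * K l) ≤ ∫⁻ l, mo l * K l := by
  unfold sw
  simp only [Finset.sum_mul]
  rw [lintegral_finsetSum _ (fun k _ => by fun_prop)]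
  have h1 : ∀ σ : Equiv.Perm (Fin n), ∫⁻ l : Fin n → ℂ, (∏ i, ENNReal.ofReal (‖l i‖ ^ (2 * (σ i : ℕ)))) * (sa l * K l) =
      ∫⁻ l, sa (l ∘ (σ.trans Fin.revPerm)) * (mo l * K l) := by
    intro σ
    rw [← (pres_perm (σ.trans Fin.revPerm)).lintegral_comp
      (f := fun l : Fin n → ℂ => (∏ i, ENNReal.ofReal (‖l i‖ ^ (2 * (σ i : ℕ)))) * (sa l * K l)) (by fun_prop)]
    refine lintegral_congr fun l => ?_
    rw [hs]
    have : ∏ i, ENNReal.ofReal (‖(l ∘ (σ.trans Fin.revPerm)) i‖ ^ (2 * (σ i : ℕ))) = mo l := by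
      unfold mo
      rw [← Equiv.prod_comp (σ.trans Fin.revPerm) (fun i => ENNReal.ofReal (‖l i‖ ^ (2 * (i.rev : ℕ))))]
      refine Finset.prod_congr rfl fun i _ => ?_
      simp
    rw [this]; ring
  simp only [h1]
  rw [← lintegral_finsetSum _ (fun k _ => by fun_prop)]
  refine lintegral_mono fun l => ?_
  simp only
  rw [← Finset.sum_mul]
  calc _ ≤ 1 * (mo l * K l) := by
        gcongr
        have : ∑ σ : Equiv.Perm (Fin n), sa (l ∘ (σ.trans Fin.revPerm)) = ∑ e : Equiv.Perm (Fin n), sa (l ∘ e) := by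
          refine Fintype.sum_bijective (fun σ : Equiv.Perm (Fin n) => σ.trans Fin.revPerm) ?_ _ _ (fun σ => rfl)
          exact (Equiv.mulLeft (Fin.revPerm : Equiv.Perm (Fin n))).bijective
        rw [this]
        exact sa_sum l
    _ = _ := one_mul _

/-- box indicator -/
noncomputable def bx (s : ℝ≥0∞) (l : Fin n → ℂ) : ℝ≥0∞ := if ∀ i, ‖l i‖ₑ ≤ s then 1 else 0

@[fun_prop]
lemma measurable_bx (s : ℝ≥0∞) : Measurable (bx s : (Fin n → ℂ) → ℝ≥0∞) := by
  unfold bx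
  refine Measurable.ite ?_ measurable_const measurable_const
  simp only [Set.ofPred_forall]
  exact MeasurableSet.iInter fun i => measurableSet_le (by fun_prop) (by fun_prop)

lemma core {g : Matrix (Fin (n+1)) (Fin (n+1)) ℂ → ℝ≥0∞} (hg : Measurable g) (hi : BiInv g)
    (s : ℝ) (hs0 : 0 ≤ s) :
    ∫⁻ B, ile (rho B) (ENNReal.ofReal s) * g B ∂(volM (n+1)) ≤
      ∫⁻ B, (Set.Iic (s ^ 2)).indicator 1 (∑ i, ‖B i 0‖ ^ 2) * g B ∂(volM (n+1)) := by
  rw [col_first hg hi _ (measurable_one.indicator measurableSet_Iic)]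
  refine (iter (n+1) (fun B => ile (rho B) (ENNReal.ofReal s) * g B) (by fun_prop) ?_).trans ?_
  · intro U hU B
    simp only
    rw [rho_conj hU, hi (star U) U (by rw [star_star]; exact mul_eq_one_comm.1 hU) hU]
  refine mul_le_mul' le_rfl ?_
  have hw : ∀ l : Fin (n+1) → ℂ, wn (n+1) (fun B => ile (rho B) (ENNReal.ofReal s) * g B) l ≤
      bx (ENNReal.ofReal s) l * wn (n+1) g l := by
    intro l
    refine wn_le (by unfold bx; split_ifs <;> simp) fun C hC => ?_
    gcongr
    unfold ile bx
    by_cases h : rho C ≤ ENNReal.ofReal s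
    · rw [if_pos h, if_pos]
      exact fun i => (Tr_rho hC i).trans h
    · rw [if_neg h]; exact zero_le
  have hphase : ∀ u l : Fin (n+1) → ℂ, (∀ i, star (u i) * u i = 1) → ∀ i, ‖(u * l) i‖ = ‖l i‖ := by
    intro u l hu i
    have hu1 : ‖u i‖ = 1 := by
      have := congrArg norm (hu i)
      simp only [norm_mul, norm_star, norm_one] at this
      nlinarith [norm_nonneg (u i)]
    rw [Pi.mul_apply, norm_mul, hu1, one_mul]
  calc ∫⁻ l : Fin (n+1) → ℂ, sa l * vd l * wn (n+1) (fun B => ile (rho B) (ENNReal.ofReal s) * g B) l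
      ≤ ∫⁻ l : Fin (n+1) → ℂ, vd l * (sa l * (bx (ENNReal.ofReal s) l * wn (n+1) g l)) := by
        refine lintegral_mono fun l => ?_
        calc _ ≤ sa l * vd l * (bx (ENNReal.ofReal s) l * wn (n+1) g l) := by gcongr; exact hw l
          _ = _ := by ring
    _ = ∫⁻ l : Fin (n+1) → ℂ, sw l * (sa l * (bx (ENNReal.ofReal s) l * wn (n+1) g l)) := by
        refine phase_avg (by simp) _ (by fun_prop) fun u l hu => ?_
        have h := hphase u l hu
        have h' : ∀ i, ‖(u * l) i‖ₑ = ‖l i‖ₑ := fun i => by rw [← ofReal_norm, h, ofReal_norm]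
        rw [wn_phase _ g hi l u hu]
        unfold sa bx
        simp only [h, h']
    _ ≤ ∫⁻ l : Fin (n+1) → ℂ, mo l * (bx (ENNReal.ofReal s) l * wn (n+1) g l) := by
        refine perm_avg (fun l => bx (ENNReal.ofReal s) l * wn (n+1) g l) (by fun_prop) fun e l => ?_
        rw [wn_perm hg hi]
        congr 1
        unfold bx
        have : (∀ i, ‖(l ∘ e) i‖ₑ ≤ ENNReal.ofReal s) ↔ ∀ i, ‖l i‖ₑ ≤ ENNReal.ofReal s :=
          ⟨fun h i => by simpa using h (e.symm i), fun h i => h (e i)⟩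
        simp only [this]
    _ ≤ _ := by
        refine lintegral_mono fun l => ?_
        calc mo l * (bx (ENNReal.ofReal s) l * wn (n+1) g l) = bx (ENNReal.ofReal s) l * (mo l * wn (n+1) g l) := by ring
          _ ≤ _ := by
            gcongr
            unfold bx
            split_ifs with h
            · have h0 := h 0
              rw [← ofReal_norm, ENNReal.ofReal_le_ofReal_iff hs0] at h0
              rw [Set.indicator_of_mem]
              · rfl
              · exact pow_le_pow_left₀ (norm_nonneg _) h0 2
            · exact zero_le

end part11


section part12
variable {n : ℕ}

lemma compact_unitary (n : ℕ) : CompactSpace (Matrix.unitaryGroup (Fin n) ℂ) := by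
  have hc : IsClosed (Matrix.unitaryGroup (Fin n) ℂ : Set (Matrix (Fin n) (Fin n) ℂ)) :=
    isClosed_unitary
  have hk : IsCompact (Set.pi Set.univ fun _ : Fin n => Set.pi Set.univ fun _ : Fin n =>
      Metric.closedBall (0:ℂ) 1) :=
    isCompact_univ_pi fun _ => isCompact_univ_pi fun _ => isCompact_closedBall _ _
  refine isCompact_iff_compactSpace.1 (IsCompact.of_isClosed_subset hk hc ?_)
  intro U hU i _ j _
  simpa using entry_norm_bound_of_unitary hU i j

lemma exists_haar (n : ℕ) : ∃ ν : Measure (Matrix (Fin n) (Fin n) ℂ), IsProbabilityMeasure ν ∧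
    (∀ᵐ W ∂ν, star W * W = 1) ∧
    ∀ U : Matrix (Fin n) (Fin n) ℂ, star U * U = 1 → Measure.map (fun A => U * A) ν = ν := by
  have := compact_unitary n
  have : BorelSpace (Matrix.unitaryGroup (Fin n) ℂ) := Subtype.borelSpace _
  let h : Measure (Matrix.unitaryGroup (Fin n) ℂ) := Measure.haarMeasure ⊤
  have hp : IsProbabilityMeasure h := ⟨by
    have := Measure.haarMeasure_self (G := Matrix.unitaryGroup (Fin n) ℂ) (K₀ := ⊤)
    simpa using this⟩
  have hm : Measurable (Subtype.val : Matrix.unitaryGroup (Fin n) ℂ → _) := measurable_subtype_coe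
  refine ⟨Measure.map Subtype.val h, Measure.isProbabilityMeasure_map hm.aemeasurable, ?_, ?_⟩
  · rw [ae_map_iff hm.aemeasurable]
    · exact Filter.Eventually.of_forall fun W => W.2.1
    · refine IsClosed.measurableSet ?_
      exact isClosed_eq (by fun_prop) (by fun_prop)
  · intro U hU
    let U' : Matrix.unitaryGroup (Fin n) ℂ := ⟨U, hU, by
      exact mul_eq_one_comm.1 hU⟩
    have hUm : Measurable fun A : Matrix (Fin n) (Fin n) ℂ => U * A :=
      (by fun_prop : Continuous fun A : Matrix (Fin n) (Fin n) ℂ => U * A).measurable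
    have h1 : Measure.map (fun W => U' * W) h = h := map_mul_left_eq_self h U'
    rw [Measure.map_map hUm hm]
    conv_rhs => rw [← h1]
    rw [Measure.map_map hm (by fun_prop)]
    rfl

/-- Norm of the first column. -/
noncomputable def cN (A : Matrix (Fin (n+1)) (Fin (n+1)) ℂ) : ℝ := ‖WithLp.toLp 2 (fun i => A i 0)‖

lemma cN_sq (A : Matrix (Fin (n+1)) (Fin (n+1)) ℂ) : cN A ^ 2 = ∑ i, ‖A i 0‖ ^ 2 := by
  rw [cN, EuclideanSpace.norm_eq, Real.sq_sqrt (by positivity)]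

lemma cN_nonneg (A : Matrix (Fin (n+1)) (Fin (n+1)) ℂ) : 0 ≤ cN A := norm_nonneg _

lemma continuous_cN : Continuous (cN : Matrix (Fin (n+1)) (Fin (n+1)) ℂ → ℝ) := by
  unfold cN
  refine Continuous.norm ?_
  refine (PiLp.continuous_toLp 2 _).comp ?_
  exact continuous_pi fun i => continuous_id.matrix_elem i 0

lemma cN_le (A B : Matrix (Fin (n+1)) (Fin (n+1)) ℂ) : cN A ≤ cN B + ‖A - B‖ := by
  have h1 : cN A ≤ cN B + cN (A - B) := by
    unfold cN
    have : (WithLp.toLp 2 (fun i => A i 0) : EuclideanSpace ℂ (Fin (n+1))) =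
      WithLp.toLp 2 (fun i => B i 0) + WithLp.toLp 2 (fun i => (A - B) i 0) := by
      ext i; simp
    rw [this]; exact norm_add_le _ _
  have h2 : cN (A - B) ≤ ‖A - B‖ := by
    refine abs_le_of_sq_le_sq' ?_ (norm_nonneg _) |>.2
    rw [cN_sq, frob_sq]
    refine Finset.sum_le_sum fun i _ => ?_
    exact Finset.single_le_sum (f := fun j => ‖(A - B) i j‖ ^ 2) (fun _ _ => by positivity) (Finset.mem_univ 0)
  linarith

lemma frob_unitary_left {U : Matrix (Fin n) (Fin n) ℂ} (hU : star U * U = 1) (D : Matrix (Fin n) (Fin n) ℂ) :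
    ‖U * D‖ = ‖D‖ := by
  have : ‖U * D‖ ^ 2 = ‖D‖ ^ 2 := by
    rw [frob_sq, frob_sq, Finset.sum_comm]
    conv_rhs => rw [Finset.sum_comm]
    refine Finset.sum_congr rfl fun j _ => ?_
    have := sum_sq_mulVec_unitary hU (fun i => D i j)
    rw [← this]
    simp [Matrix.mul_apply, Matrix.mulVec, dotProduct]
  exact (sq_eq_sq₀ (norm_nonneg _) (norm_nonneg _)).1 this

lemma star_unitary {U : Matrix (Fin n) (Fin n) ℂ} (hU : star U * U = 1) : star (star U) * star U = 1 := by
  rw [star_star]; exact mul_eq_one_comm.1 hU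

lemma frob_unitary_right {U : Matrix (Fin n) (Fin n) ℂ} (hU : star U * U = 1) (D : Matrix (Fin n) (Fin n) ℂ) :
    ‖D * U‖ = ‖D‖ := by
  have h1 : ∀ X : Matrix (Fin n) (Fin n) ℂ, ‖star X‖ = ‖X‖ := fun X => Matrix.frobenius_norm_conjTranspose X
  rw [← h1 (D * U), star_mul, frob_unitary_left (star_unitary hU), h1]

lemma meas_norm1 : Measurable fun A : Matrix (Fin n) (Fin n) ℂ => ‖A‖ := continuous_norm.measurable
lemma meas_norm2 : Measurable fun p : Matrix (Fin n) (Fin n) ℂ × Matrix (Fin n) (Fin n) ℂ => p.1 - p.2 := by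
  fun_prop
lemma meas_norm3 : Measurable fun p : Matrix (Fin n) (Fin n) ℂ × Matrix (Fin n) (Fin n) ℂ => ‖p.1 - p.2‖ := by
  exact meas_norm1.comp meas_norm2

/-- kernel: indicator of `‖A - B‖ < ε` -/
noncomputable def kk (ε : ℝ) (A B : Matrix (Fin (n+1)) (Fin (n+1)) ℂ) : ℝ≥0∞ :=
  (Set.Iio ε).indicator 1 ‖A - B‖

lemma measurable_kk0 (ε : ℝ) : Measurable fun p : Matrix (Fin (n+1)) (Fin (n+1)) ℂ × Matrix (Fin (n+1)) (Fin (n+1)) ℂ => kk ε p.1 p.2 := by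
  have hind : Measurable ((Set.Iio ε).indicator (1 : ℝ → ℝ≥0∞)) := measurable_one.indicator measurableSet_Iio
  have h := hind.comp (meas_norm3 (n := n+1))
  exact h

lemma measurable_kk {α : Type*} [MeasurableSpace α] (ε : ℝ)
    {f g : α → Matrix (Fin (n+1)) (Fin (n+1)) ℂ} (hf : Measurable f) (hg : Measurable g) :
    Measurable fun a => kk ε (f a) (g a) := by
  have h1 := hf.prodMk hg
  have h2 := Measurable.comp (measurable_kk0 (n := n) ε) h1
  exact h2

/-- smoothed density -/
noncomputable def gk (η : Measure (Matrix (Fin (n+1)) (Fin (n+1)) ℂ)) (ε : ℝ)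
    (B : Matrix (Fin (n+1)) (Fin (n+1)) ℂ) : ℝ≥0∞ := ∫⁻ A, kk ε A B ∂η

lemma measurable_gk (η : Measure (Matrix (Fin (n+1)) (Fin (n+1)) ℂ)) [IsProbabilityMeasure η] (ε : ℝ) :
    Measurable (gk η ε) := by
  have h : Measurable fun p : Matrix (Fin (n+1)) (Fin (n+1)) ℂ × Matrix (Fin (n+1)) (Fin (n+1)) ℂ => kk ε p.2 p.1 :=
    measurable_kk ε measurable_snd measurable_fst
  exact Measurable.lintegral_prod_right' (f := fun p : Matrix (Fin (n+1)) (Fin (n+1)) ℂ × Matrix (Fin (n+1)) (Fin (n+1)) ℂ => kk ε p.2 p.1) h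

lemma biinv_gk (η : Measure (Matrix (Fin (n+1)) (Fin (n+1)) ℂ)) [IsProbabilityMeasure η]
    (hη : ∀ U V : Matrix (Fin (n+1)) (Fin (n+1)) ℂ, star U * U = 1 → star V * V = 1 →
      Measure.map (fun A => U * A * V) η = η) (ε : ℝ) : BiInv (gk η ε) := by
  intro U V hU hV B
  unfold gk
  conv_lhs => rw [← hη U V hU hV]
  rw [lintegral_map]
  · congr 1; ext A
    unfold kk
    rw [← sub_mul, ← mul_sub, frob_unitary_right hV, frob_unitary_left hU]
  · exact measurable_kk ε measurable_id measurable_const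
  · exact (by fun_prop : Continuous fun A : Matrix (Fin (n+1)) (Fin (n+1)) ℂ => U * A * V).measurable

/-- ball volume -/
noncomputable def bv (n : ℕ) (ε : ℝ) : ℝ≥0∞ := volM (n+1) (Metric.ball 0 ε)

lemma lintegral_kk (ε : ℝ) (A : Matrix (Fin (n+1)) (Fin (n+1)) ℂ) : ∫⁻ B, kk ε A B ∂(volM (n+1)) = bv n ε := by
  have : (fun B => kk ε A B) = (Metric.ball A ε).indicator 1 := by
    ext B
    simp only [kk, Set.indicator, Metric.mem_ball, Set.mem_Iio, dist_eq_norm]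
    rw [norm_sub_rev]; rfl
  rw [this, lintegral_indicator_one Metric.isOpen_ball.measurableSet]
  exact Measure.addHaar_ball_center _ _ _

lemma bv_ne_zero {ε : ℝ} (hε : 0 < ε) : bv n ε ≠ 0 := (Metric.measure_ball_pos _ _ hε).ne'

lemma bv_ne_top (ε : ℝ) : bv n ε ≠ ∞ := measure_ball_lt_top.ne

lemma gk_swap (η : Measure (Matrix (Fin (n+1)) (Fin (n+1)) ℂ)) [IsProbabilityMeasure η] (ε : ℝ)
    (φ : Matrix (Fin (n+1)) (Fin (n+1)) ℂ → ℝ≥0∞) (hφ : Measurable φ) :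
      ∫⁻ B, φ B * gk η ε B ∂(volM (n+1)) = ∫⁻ A, ∫⁻ B, φ B * kk ε A B ∂(volM (n+1)) ∂η := by
  rw [lintegral_lintegral_swap]
  · refine lintegral_congr fun B => ?_
    rw [lintegral_const_mul]
    · rfl
    · exact measurable_kk ε measurable_id measurable_const
  · exact ((hφ.comp measurable_snd).mul (measurable_kk ε measurable_fst measurable_snd)).aemeasurable

lemma kk_left (η : Measure (Matrix (Fin (n+1)) (Fin (n+1)) ℂ)) (s : ℝ≥0∞) (ε : ℝ) :
    bv n ε * η (Metric.thickening ε {B | s < rho B})ᶜ ≤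
      ∫⁻ A, ∫⁻ B, ile (rho B) s * kk ε A B ∂(volM (n+1)) ∂η := by
  have hT : MeasurableSet (Metric.thickening ε {B : Matrix (Fin (n+1)) (Fin (n+1)) ℂ | s < rho B})ᶜ :=
    Metric.isOpen_thickening.measurableSet.compl
  rw [← lintegral_indicator_one hT, ← lintegral_const_mul _ (measurable_one.indicator hT)]
  refine lintegral_mono fun A => ?_
  by_cases hA : A ∈ (Metric.thickening ε {B : Matrix (Fin (n+1)) (Fin (n+1)) ℂ | s < rho B})ᶜ
  · simp only [Set.indicator_of_mem hA, Pi.one_apply, mul_one]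
    rw [← lintegral_kk ε A]
    refine lintegral_mono fun B => ?_
    by_cases hB : ‖A - B‖ < ε
    · have : rho B ≤ s := by
        by_contra hcon
        apply hA
        rw [Metric.mem_thickening_iff]
        exact ⟨B, not_le.1 hcon, by rwa [dist_eq_norm]⟩
      simp [ile, this]
    · simp [kk, hB]
  · simp [Set.indicator_of_notMem hA]

lemma kk_right (η : Measure (Matrix (Fin (n+1)) (Fin (n+1)) ℂ)) (s : ℝ) (hs : 0 ≤ s) (ε : ℝ) :
    ∫⁻ A, ∫⁻ B, (Set.Iic (s ^ 2)).indicator (1 : ℝ → ℝ≥0∞) (∑ i, ‖B i 0‖ ^ 2) * kk ε A B ∂(volM (n+1)) ∂η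
      ≤ bv n ε * η {B | cN B ≤ s + ε} := by
  have hS : MeasurableSet {B : Matrix (Fin (n+1)) (Fin (n+1)) ℂ | cN B ≤ s + ε} :=
    measurableSet_le continuous_cN.measurable measurable_const
  rw [← lintegral_indicator_one hS, ← lintegral_const_mul _ (measurable_one.indicator hS)]
  refine lintegral_mono fun A => ?_
  by_cases hA : A ∈ {B : Matrix (Fin (n+1)) (Fin (n+1)) ℂ | cN B ≤ s + ε}
  · simp only [Set.indicator_of_mem hA, Pi.one_apply, mul_one]
    rw [← lintegral_kk ε A]
    refine lintegral_mono fun B => ?_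
    have h1 : (Set.Iic (s ^ 2)).indicator (1 : ℝ → ℝ≥0∞) (∑ i, ‖B i 0‖ ^ 2) ≤ 1 :=
      Set.indicator_le_self' (fun _ _ => zero_le) _
    calc _ ≤ 1 * kk ε A B := by gcongr
      _ = _ := one_mul _
  · have : ∀ B, (Set.Iic (s ^ 2)).indicator (1 : ℝ → ℝ≥0∞) (∑ i, ‖B i 0‖ ^ 2) * kk ε A B = 0 := by
      intro B
      by_cases hB : ‖A - B‖ < ε
      · have h1 := cN_le A B
        have h2 : ¬ cN A ≤ s + ε := hA
        have h3 : s < cN B := by linarith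
        have h4 : ¬ (∑ i, ‖B i 0‖ ^ 2 ≤ s ^ 2) := by
          rw [← cN_sq]; nlinarith
        simp [Set.indicator, h4]
      · simp [kk, hB]
    simp [this]

lemma biinv_dist (η : Measure (Matrix (Fin (n+1)) (Fin (n+1)) ℂ)) [IsProbabilityMeasure η]
    (hη : ∀ U V : Matrix (Fin (n+1)) (Fin (n+1)) ℂ, star U * U = 1 → star V * V = 1 →
      Measure.map (fun A => U * A * V) η = η) (s : ℝ) (hs : 0 ≤ s) (ε : ℝ) (hε : 0 < ε) :
    η (Metric.thickening ε {B | ENNReal.ofReal s < rho B})ᶜ ≤ η {B | cN B ≤ s + ε} := by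
  have hφ1 : Measurable fun B : Matrix (Fin (n+1)) (Fin (n+1)) ℂ => ile (rho B) (ENNReal.ofReal s) := by
    have := measurable_rho (n := n+1)
    fun_prop
  have hφ2 : Measurable fun B : Matrix (Fin (n+1)) (Fin (n+1)) ℂ => (Set.Iic (s ^ 2)).indicator (1 : ℝ → ℝ≥0∞) (∑ i, ‖B i 0‖ ^ 2) := by
    refine (measurable_one.indicator measurableSet_Iic).comp ?_
    exact (continuous_finsetSum _ fun i _ => (continuous_id.matrix_elem i 0).norm.pow 2).measurable
  have hcore := core (measurable_gk η ε) (biinv_gk η hη ε) s hs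
  rw [gk_swap η ε _ hφ1, gk_swap η ε _ hφ2] at hcore
  have := (kk_left η _ ε).trans (hcore.trans (kk_right η s hs ε))
  exact (ENNReal.mul_le_mul_iff_right (bv_ne_zero hε) (bv_ne_top ε)).1 this

lemma biinv_dist' (η : Measure (Matrix (Fin (n+1)) (Fin (n+1)) ℂ)) [IsProbabilityMeasure η]
    (hη : ∀ U V : Matrix (Fin (n+1)) (Fin (n+1)) ℂ, star U * U = 1 → star V * V = 1 →
      Measure.map (fun A => U * A * V) η = η) (s : ℝ) (hs : 0 ≤ s) :
    η {B | rho B < ENNReal.ofReal s} ≤ η {B | cN B ≤ s} := by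
  set e : ℕ → ℝ := fun k => 1 / ((k:ℝ) + 1) with he
  have hpos : ∀ k, 0 < e k := fun k => by positivity
  have hanti : Antitone e := fun a b h => one_div_le_one_div_of_le (by positivity) (by
    have : (a:ℝ) ≤ b := by exact_mod_cast h
    linarith)
  have h0 : Filter.Tendsto e Filter.atTop (nhds 0) := tendsto_one_div_add_atTop_nhds_zero_nat
  have t1 := tendsto_measure_iUnion_atTop (μ := η)
    (s := fun k => (Metric.thickening (e k) {B : Matrix (Fin (n+1)) (Fin (n+1)) ℂ | ENNReal.ofReal s < rho B})ᶜ)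
    (fun a b h => Set.compl_subset_compl.2 (Metric.thickening_mono (hanti h) _))
  have t2 := tendsto_measure_iInter_atTop (μ := η)
    (s := fun k => {B : Matrix (Fin (n+1)) (Fin (n+1)) ℂ | cN B ≤ s + e k})
    (fun k => (measurableSet_le continuous_cN.measurable measurable_const).nullMeasurableSet)
    (fun a b h B hB => by
      have := hanti h
      simp only [Set.mem_ofPred_eq] at hB ⊢
      linarith) ⟨0, measure_ne_top _ _⟩
  have hle := le_of_tendsto_of_tendsto' t1 t2 (fun k => biinv_dist η hη s hs (e k) (hpos k))
  refine (measure_mono ?_).trans (hle.trans (measure_mono ?_))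
  · intro B hB
    obtain ⟨r, hr, hr'⟩ := Metric.isOpen_iff.1 (isOpen_rho_lt (n := n+1) (ENNReal.ofReal s)) B hB
    obtain ⟨k, hk⟩ := (h0.eventually (gt_mem_nhds hr)).exists
    refine Set.mem_iUnion.2 ⟨k, ?_⟩
    intro hmem
    rw [Metric.mem_thickening_iff] at hmem
    obtain ⟨C, hC, hd⟩ := hmem
    have : C ∈ Metric.ball B r := by
      rw [Metric.mem_ball, dist_comm]; linarith
    have h1 : rho C < ENNReal.ofReal s := hr' this
    have h2 : ENNReal.ofReal s < rho C := hC
    exact lt_asymm h1 h2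
  · intro B hB
    rw [Set.mem_iInter] at hB
    have : Filter.Tendsto (fun k => s + e k) Filter.atTop (nhds (s + 0)) := h0.const_add s
    rw [add_zero] at this
    exact ge_of_tendsto' this hB

end part12


section part13
variable {n : ℕ}

/-- `‖A v‖` -/
noncomputable def Fn (A : Matrix (Fin n) (Fin n) ℂ) (v : EuclideanSpace ℂ (Fin n)) : ℝ :=
  ‖Matrix.toEuclideanLin A v‖

lemma continuous_Fn : Continuous fun p : Matrix (Fin n) (Fin n) ℂ × EuclideanSpace ℂ (Fin n) => Fn p.1 p.2 := by
  unfold Fn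
  refine Continuous.norm ?_
  simp only [Matrix.toEuclideanLin_apply]
  refine (PiLp.continuous_toLp 2 _).comp ?_
  exact Continuous.matrix_mulVec continuous_fst ((PiLp.continuous_ofLp 2 _).comp continuous_snd)

lemma measurable_Fn : Measurable fun p : Matrix (Fin n) (Fin n) ℂ × EuclideanSpace ℂ (Fin n) => Fn p.1 p.2 :=
  continuous_Fn.measurable

lemma measurable_mulStar : Measurable fun p : Matrix (Fin n) (Fin n) ℂ × Matrix (Fin n) (Fin n) ℂ => p.1 * star p.2 :=
  (continuous_fst.matrix_mul continuous_snd.star).measurable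

lemma measurable_lmul (U : Matrix (Fin n) (Fin n) ℂ) : Measurable fun A : Matrix (Fin n) (Fin n) ℂ => U * A :=
  (continuous_const.matrix_mul continuous_id).measurable

lemma Fn_mul (A B : Matrix (Fin n) (Fin n) ℂ) (v : EuclideanSpace ℂ (Fin n)) :
    Fn (A * B) v = Fn A (Matrix.toEuclideanLin B v) := by
  unfold Fn
  simp [Matrix.toEuclideanLin_apply, Matrix.mulVec_mulVec]

lemma Fn_col (A U : Matrix (Fin (n+1)) (Fin (n+1)) ℂ) (v : EuclideanSpace ℂ (Fin (n+1)))
    (h : ∀ i, U i 0 = v i) : Fn A v = cN (A * U) := by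
  unfold Fn cN
  congr 1
  ext i
  simp [Matrix.toEuclideanLin_apply, Matrix.mulVec, dotProduct, Matrix.mul_apply, h]

lemma law_col (A : Matrix (Fin (n+1)) (Fin (n+1)) ℂ)
    (ν : Measure (Matrix (Fin (n+1)) (Fin (n+1)) ℂ)) [IsProbabilityMeasure ν]
    (hν1 : ∀ᵐ W ∂ν, star W * W = 1)
    (hν2 : ∀ U : Matrix (Fin (n+1)) (Fin (n+1)) ℂ, star U * U = 1 → Measure.map (fun A => U * A) ν = ν)
    (σ : Measure (EuclideanSpace ℂ (Fin (n+1)))) [IsProbabilityMeasure σ]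
    (hσsphere : ∀ᵐ v ∂σ, ‖v‖ = 1)
    (hσinv : ∀ U : Matrix (Fin (n+1)) (Fin (n+1)) ℂ, star U * U = 1 →
      Measure.map (fun v => Matrix.toEuclideanLin U v) σ = σ) (s : ℝ) :
    ν {W | cN (A * star W) ≤ s} = σ {v | Fn A v ≤ s} := by
  have hG : Continuous fun p : Matrix (Fin (n+1)) (Fin (n+1)) ℂ × EuclideanSpace ℂ (Fin (n+1)) =>
      Fn (A * star p.1) p.2 := by
    have h1 : Continuous fun p : Matrix (Fin (n+1)) (Fin (n+1)) ℂ × EuclideanSpace ℂ (Fin (n+1)) =>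
      (A * star p.1, p.2) := (continuous_const.matrix_mul continuous_fst.star).prodMk continuous_snd
    have h := Continuous.comp (continuous_Fn (n := n+1)) h1
    exact h
  have hS : MeasurableSet {p : Matrix (Fin (n+1)) (Fin (n+1)) ℂ × EuclideanSpace ℂ (Fin (n+1)) |
      Fn (A * star p.1) p.2 ≤ s} := measurableSet_le hG.measurable measurable_const
  have hS1 : MeasurableSet {v | Fn A v ≤ s} := by
    have h1 : Continuous fun v : EuclideanSpace ℂ (Fin (n+1)) => Fn A v := by
      have h0 : Continuous fun v : EuclideanSpace ℂ (Fin (n+1)) => (A, v) := continuous_const.prodMk continuous_id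
      have h := Continuous.comp (continuous_Fn (n := n+1)) h0
      exact h
    exact measurableSet_le h1.measurable measurable_const
  have hS2 : MeasurableSet {W : Matrix (Fin (n+1)) (Fin (n+1)) ℂ | cN (A * star W) ≤ s} := by
    have h1 : Continuous fun W : Matrix (Fin (n+1)) (Fin (n+1)) ℂ => cN (A * star W) := by
      have h0 : Continuous fun W : Matrix (Fin (n+1)) (Fin (n+1)) ℂ => A * star W :=
        continuous_const.matrix_mul continuous_id.star
      have h := Continuous.comp (continuous_cN (n := n)) h0
      exact h
    exact measurableSet_le h1.measurable measurable_const
  have e1 : (ν.prod σ) {p | Fn (A * star p.1) p.2 ≤ s} = σ {v | Fn A v ≤ s} := by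
    rw [Measure.prod_apply hS]
    have : ∀ᵐ W ∂ν, σ (Prod.mk W ⁻¹' {p | Fn (A * star p.1) p.2 ≤ s}) = σ {v | Fn A v ≤ s} := by
      filter_upwards [hν1] with W hW
      conv_rhs => rw [← hσinv (star W) (star_unitary hW)]
      have hm : Measurable fun v : EuclideanSpace ℂ (Fin (n+1)) => Matrix.toEuclideanLin (star W) v :=
        (LinearMap.continuous_of_finiteDimensional _).measurable
      rw [Measure.map_apply hm hS1]
      congr 1
      ext v
      simp [Fn_mul]
    rw [lintegral_congr_ae this]
    simp
  have e2 : (ν.prod σ) {p | Fn (A * star p.1) p.2 ≤ s} = ν {W | cN (A * star W) ≤ s} := by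
    rw [Measure.prod_apply_symm hS]
    have : ∀ᵐ v ∂σ, ν ((fun W => (W, v)) ⁻¹' {p | Fn (A * star p.1) p.2 ≤ s}) = ν {W | cN (A * star W) ≤ s} := by
      filter_upwards [hσsphere] with v hv
      obtain ⟨U, hU, hUv⟩ := exists_unitary_col (n := n) v (by
        have := EuclideanSpace.norm_sq_eq v
        rw [hv] at this
        simpa using this.symm)
      conv_rhs => rw [← hν2 (star U) (star_unitary hU)]
      rw [Measure.map_apply (measurable_lmul _) hS2]
      congr 1
      ext W
      simp only [Set.mem_preimage, Set.mem_ofPred_eq]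
      rw [Fn_col _ U v hUv, star_mul, star_star, mul_assoc]
    rw [lintegral_congr_ae this]
    simp
  rw [← e2, e1]

theorem dist_ineq (μ : Measure (Matrix (Fin (n+1)) (Fin (n+1)) ℂ)) [IsProbabilityMeasure μ]
    (hμ : ∀ U : Matrix (Fin (n+1)) (Fin (n+1)) ℂ, star U * U = 1 → Measure.map (fun A => U * A) μ = μ)
    (σ : Measure (EuclideanSpace ℂ (Fin (n+1)))) [IsProbabilityMeasure σ]
    (hσsphere : ∀ᵐ v ∂σ, ‖v‖ = 1)
    (hσinv : ∀ U : Matrix (Fin (n+1)) (Fin (n+1)) ℂ, star U * U = 1 →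
      Measure.map (fun v => Matrix.toEuclideanLin U v) σ = σ) (s : ℝ) (hs : 0 ≤ s) :
    μ {A | rho A < ENNReal.ofReal s} ≤ (μ.prod σ) {p | Fn p.1 p.2 ≤ s} := by
  obtain ⟨ν, hp, hν1, hν2⟩ := exists_haar (n+1)
  have hprob : IsProbabilityMeasure (Measure.map (fun p : Matrix (Fin (n+1)) (Fin (n+1)) ℂ × Matrix (Fin (n+1)) (Fin (n+1)) ℂ => p.1 * star p.2) (μ.prod ν)) :=
    Measure.isProbabilityMeasure_map measurable_mulStar.aemeasurable
  have key := biinv_dist' (Measure.map (fun p : Matrix (Fin (n+1)) (Fin (n+1)) ℂ × Matrix (Fin (n+1)) (Fin (n+1)) ℂ => p.1 * star p.2) (μ.prod ν)) (by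
    intro U V hU hV
    have hm1 : Measurable fun A : Matrix (Fin (n+1)) (Fin (n+1)) ℂ => U * A * V :=
      ((continuous_const.matrix_mul continuous_id).matrix_mul continuous_const).measurable
    have hpr : MeasurePreserving (Prod.map (fun A => U * A) (fun W => star V * W)) (μ.prod ν) (μ.prod ν) :=
      MeasurePreserving.prod ⟨measurable_lmul U, hμ U hU⟩ ⟨measurable_lmul _, hν2 _ (star_unitary hV)⟩
    rw [Measure.map_map hm1 measurable_mulStar]
    conv_rhs => rw [← hpr.map_eq, Measure.map_map measurable_mulStar hpr.measurable]
    congr 1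
    ext1 p
    simp [mul_assoc]) s hs
  have hR : MeasurableSet {A : Matrix (Fin (n+1)) (Fin (n+1)) ℂ | rho A < ENNReal.ofReal s} :=
    (isOpen_rho_lt _).measurableSet
  have hC : MeasurableSet {A : Matrix (Fin (n+1)) (Fin (n+1)) ℂ | cN A ≤ s} :=
    measurableSet_le continuous_cN.measurable measurable_const
  have hF : MeasurableSet {p : Matrix (Fin (n+1)) (Fin (n+1)) ℂ × EuclideanSpace ℂ (Fin (n+1)) | Fn p.1 p.2 ≤ s} :=
    measurableSet_le measurable_Fn measurable_const
  rw [Measure.map_apply measurable_mulStar hR, Measure.map_apply measurable_mulStar hC,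
    Measure.prod_apply_symm (measurable_mulStar hR), Measure.prod_apply (measurable_mulStar hC)] at key
  have e1 : ∀ᵐ W ∂ν, μ ((fun A => (A, W)) ⁻¹' ((fun p : Matrix (Fin (n+1)) (Fin (n+1)) ℂ × Matrix (Fin (n+1)) (Fin (n+1)) ℂ => p.1 * star p.2) ⁻¹' {A | rho A < ENNReal.ofReal s})) = μ {A | rho A < ENNReal.ofReal s} := by
    filter_upwards [hν1] with W hW
    conv_rhs => rw [← hμ (star W) (star_unitary hW)]
    rw [Measure.map_apply (measurable_lmul _) hR]
    congr 1
    ext A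
    simp only [Set.mem_preimage, Set.mem_ofPred_eq]
    rw [← rho_conj (C := A * star W) hW]
    rw [mul_assoc, mul_assoc, hW, mul_one]
  rw [lintegral_congr_ae e1] at key
  rw [Measure.prod_apply hF]
  have e2 : ∀ A, ν (Prod.mk A ⁻¹' ((fun p : Matrix (Fin (n+1)) (Fin (n+1)) ℂ × Matrix (Fin (n+1)) (Fin (n+1)) ℂ => p.1 * star p.2) ⁻¹' {A | cN A ≤ s})) =
      σ (Prod.mk A ⁻¹' {p | Fn p.1 p.2 ≤ s}) := fun A => law_col A ν hν1 hν2 σ hσsphere hσinv s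
  simp only [e2] at key
  simpa using key

end part13


section part14
variable {n : ℕ}

lemma dominance {Ω Ω' : Type*} [MeasurableSpace Ω] [MeasurableSpace Ω'] (P : Measure Ω) (Q : Measure Ω')
    [IsProbabilityMeasure P] [IsProbabilityMeasure Q] (X : Ω → ℝ) (Y : Ω' → ℝ) (hXm : Measurable X)
    (hYm : Measurable Y) (hX : Integrable X P) (hY : Integrable Y Q)
    (h : ∀ t : ℝ, P {a | X a < t} ≤ Q {a | Y a ≤ t}) : ∫ a, Y a ∂Q ≤ ∫ a, X a ∂P := by
  have key1 : ∫⁻ a, ENNReal.ofReal (Y a) ∂Q ≤ ∫⁻ a, ENNReal.ofReal (X a) ∂P := by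
    have e1 : ∀ a, ENNReal.ofReal (Y a) = ENNReal.ofReal (max (Y a) 0) := fun a => by simp
    have e2 : ∀ a, ENNReal.ofReal (X a) = ENNReal.ofReal (max (X a) 0) := fun a => by simp
    simp only [e1, e2]
    rw [lintegral_eq_lintegral_meas_lt (f := fun a => max (Y a) 0) Q (Filter.Eventually.of_forall fun a => le_max_right _ _)
        (hYm.max measurable_const).aemeasurable,
      lintegral_eq_lintegral_meas_le (f := fun a => max (X a) 0) P (Filter.Eventually.of_forall fun a => le_max_right _ _)
        (hXm.max measurable_const).aemeasurable]
    refine setLIntegral_mono' measurableSet_Ioi fun t ht => ?_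
    have ht' : (0:ℝ) < t := ht
    have s1 : {a | t < max (Y a) 0} = {a | Y a ≤ t}ᶜ := by
      ext a; simp [not_lt.2 ht'.le]
    have s2 : {a | t ≤ max (X a) 0} = {a | X a < t}ᶜ := by
      ext a; simp [not_le.2 ht']
    rw [s1, s2, prob_compl_eq_one_sub (measurableSet_le hYm measurable_const),
      prob_compl_eq_one_sub (measurableSet_lt hXm measurable_const)]
    exact tsub_le_tsub_left (h t) _
  have key2 : ∫⁻ a, ENNReal.ofReal (-X a) ∂P ≤ ∫⁻ a, ENNReal.ofReal (-Y a) ∂Q := by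
    have e1 : ∀ a, ENNReal.ofReal (-Y a) = ENNReal.ofReal (max (-Y a) 0) := fun a => by simp
    have e2 : ∀ a, ENNReal.ofReal (-X a) = ENNReal.ofReal (max (-X a) 0) := fun a => by simp
    simp only [e1, e2]
    rw [lintegral_eq_lintegral_meas_lt (f := fun a => max (-X a) 0) P (Filter.Eventually.of_forall fun a => le_max_right _ _)
        (hXm.neg.max measurable_const).aemeasurable,
      lintegral_eq_lintegral_meas_le (f := fun a => max (-Y a) 0) Q (Filter.Eventually.of_forall fun a => le_max_right _ _)
        (hYm.neg.max measurable_const).aemeasurable]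
    refine setLIntegral_mono' measurableSet_Ioi fun t ht => ?_
    have ht' : (0:ℝ) < t := ht
    have s1 : {a | t < max (-X a) 0} = {a | X a < -t} := by
      ext a; simp [not_lt.2 ht'.le, lt_neg]
    have s2 : {a | t ≤ max (-Y a) 0} = {a | Y a ≤ -t} := by
      ext a; simp [not_le.2 ht', le_neg]
    rw [s1, s2]
    exact h (-t)
  rw [integral_eq_lintegral_pos_part_sub_lintegral_neg_part hX,
    integral_eq_lintegral_pos_part_sub_lintegral_neg_part hY]
  have f1 := hX.lintegral_lt_top.ne
  have f2 := hY.neg.lintegral_lt_top.ne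
  exact sub_le_sub (ENNReal.toReal_mono f1 key1) (ENNReal.toReal_mono f2 key2)

lemma Fn_le (A : Matrix (Fin n) (Fin n) ℂ) (v : EuclideanSpace ℂ (Fin n)) : Fn A v ≤ opNormC A * ‖v‖ :=
  (Matrix.toEuclideanCLM (𝕜 := ℂ) A).le_opNorm v

lemma one_le_mul_Fn {A : Matrix (Fin n) (Fin n) ℂ} (hA : IsUnit A) {v : EuclideanSpace ℂ (Fin n)} (hv : ‖v‖ = 1) :
    1 ≤ opNormC A⁻¹ * Fn A v := by
  have h1 := Fn_le A⁻¹ (Matrix.toEuclideanLin A v)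
  rw [← Fn_mul, Matrix.nonsing_inv_mul _ ((Matrix.isUnit_iff_isUnit_det _).1 hA)] at h1
  have h2 : Fn (1 : Matrix (Fin n) (Fin n) ℂ) v = 1 := by
    rw [← hv]; unfold Fn; congr 1
    simp [Matrix.toLpLin_apply]
  rw [h2] at h1
  exact h1

lemma Fn_pos {A : Matrix (Fin n) (Fin n) ℂ} (hA : IsUnit A) {v : EuclideanSpace ℂ (Fin n)} (hv : ‖v‖ = 1) :
    0 < Fn A v := by
  have h := one_le_mul_Fn hA hv
  rcases (show 0 ≤ Fn A v from norm_nonneg _).lt_or_eq with h1 | h1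
  · exact h1
  · rw [← h1] at h; simp at h; linarith

lemma log_Fn_bound {A : Matrix (Fin n) (Fin n) ℂ} (hA : IsUnit A) {v : EuclideanSpace ℂ (Fin n)} (hv : ‖v‖ = 1) :
    ‖Real.log (Fn A v)‖ ≤ max (Real.log (opNormC A)) 0 + max (Real.log (opNormC A⁻¹)) 0 := by
  have h0 := Fn_pos hA hv
  have h1 := one_le_mul_Fn hA hv
  have h2 := Fn_le A v
  rw [hv, mul_one] at h2
  have h3 : 0 < opNormC A⁻¹ := by
    rcases (show 0 ≤ opNormC A⁻¹ from norm_nonneg _).lt_or_eq with h | h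
    · exact h
    · rw [← h] at h1; simp at h1; linarith
  have h4 := Real.log_le_log h0 h2
  have h5 := Real.log_le_log one_pos h1
  rw [Real.log_one, Real.log_mul h3.ne' h0.ne'] at h5
  have h6 := le_max_left (Real.log (opNormC A)) 0
  have h7 := le_max_right (Real.log (opNormC A)) 0
  have h8 := le_max_left (Real.log (opNormC A⁻¹)) 0
  have h9 := le_max_right (Real.log (opNormC A⁻¹)) 0
  rw [Real.norm_eq_abs, abs_le]
  constructor <;> linarith

lemma spec_eq_Fn (A : Matrix (Fin (n+1)) (Fin (n+1)) ℂ) :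
    ∃ v : EuclideanSpace ℂ (Fin (n+1)), ‖v‖ = 1 ∧ specRadC A = Fn A v := by
  obtain ⟨z, hz, hzr⟩ := exists_top A
  obtain ⟨w, hw, hw'⟩ := Matrix.exists_mulVec_eq_zero_iff.2 hz
  have hAw : A.mulVec w = z • w := by
    rw [Matrix.sub_mulVec, Matrix.smul_mulVec, Matrix.one_mulVec, sub_eq_zero] at hw'
    exact hw'.symm
  set u : EuclideanSpace ℂ (Fin (n+1)) := WithLp.toLp 2 w with hu
  have hu0 : u ≠ 0 := by
    intro h
    apply hw
    have := congrArg WithLp.ofLp h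
    simpa [hu] using this
  have hAu : Matrix.toEuclideanLin A u = z • u := by
    ext i
    have := congrFun hAw i
    simpa [hu, Matrix.toLpLin_apply] using this
  refine ⟨((‖u‖⁻¹ : ℝ) : ℂ) • u, ?_, ?_⟩
  · rw [norm_smul]
    have := norm_ne_zero_iff.2 hu0
    simp [this]
  · unfold Fn
    rw [map_smul, hAu, norm_smul, norm_smul]
    have h1 := norm_ne_zero_iff.2 hu0
    have h2 : specRadC A = ‖z‖ := by
      have : specRadC A = (rho A).toReal := rfl
      rw [this, ← hzr]; simp
    rw [h2]
    simp
    field_simp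

theorem main_succ (μ : Measure (Matrix (Fin (n+1)) (Fin (n+1)) ℂ)) [IsProbabilityMeasure μ]
    (hinv : ∀ᵐ A ∂μ, IsUnit A)
    (hlog1 : Integrable (fun A => max (Real.log (opNormC A)) 0) μ)
    (hlog2 : Integrable (fun A => max (Real.log (opNormC A⁻¹)) 0) μ)
    (hμ : ∀ U : Matrix (Fin (n+1)) (Fin (n+1)) ℂ, star U * U = 1 → Measure.map (fun A => U * A) μ = μ)
    (σ : Measure (EuclideanSpace ℂ (Fin (n+1)))) [IsProbabilityMeasure σ]
    (hσsphere : ∀ᵐ v ∂σ, ‖v‖ = 1)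
    (hσinv : ∀ U : Matrix (Fin (n+1)) (Fin (n+1)) ℂ, star U * U = 1 →
      Measure.map (fun v => Matrix.toEuclideanLin U v) σ = σ) :
    ∫ A, (∫ v, Real.log (Fn A v) ∂σ) ∂μ ≤ ∫ A, Real.log (specRadC A) ∂μ := by
  have hXm : Measurable fun A : Matrix (Fin (n+1)) (Fin (n+1)) ℂ => Real.log (specRadC A) := by
    have h1 : Measurable fun A : Matrix (Fin (n+1)) (Fin (n+1)) ℂ => (rho A).toReal := measurable_rho.ennreal_toReal
    exact h1.log
  have hYm : Measurable fun p : Matrix (Fin (n+1)) (Fin (n+1)) ℂ × EuclideanSpace ℂ (Fin (n+1)) =>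
      Real.log (Fn p.1 p.2) := measurable_Fn.log
  have hb := hlog1.add hlog2
  have hX : Integrable (fun A : Matrix (Fin (n+1)) (Fin (n+1)) ℂ => Real.log (specRadC A)) μ := by
    refine hb.mono' hXm.aestronglyMeasurable ?_
    filter_upwards [hinv] with A hA
    obtain ⟨v, hv, hs⟩ := spec_eq_Fn A
    rw [hs]
    exact log_Fn_bound hA hv
  have hae : ∀ᵐ p ∂(μ.prod σ), IsUnit p.1 ∧ ‖p.2‖ = 1 := by
    have h1 : ∀ᵐ p ∂(μ.prod σ), IsUnit p.1 := Measure.quasiMeasurePreserving_fst.ae hinv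
    have h2 : ∀ᵐ p ∂(μ.prod σ), ‖p.2‖ = 1 := Measure.quasiMeasurePreserving_snd.ae hσsphere
    exact h1.and h2
  have hY : Integrable (fun p : Matrix (Fin (n+1)) (Fin (n+1)) ℂ × EuclideanSpace ℂ (Fin (n+1)) =>
      Real.log (Fn p.1 p.2)) (μ.prod σ) := by
    refine (hb.comp_fst σ).mono' hYm.aestronglyMeasurable ?_
    filter_upwards [hae] with p hp
    exact log_Fn_bound hp.1 hp.2
  have hdom := dominance μ (μ.prod σ) _ _ hXm hYm hX hY (by
    intro t
    have hd := dist_ineq μ hμ σ hσsphere hσinv (Real.exp t) (Real.exp_pos t).le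
    refine le_trans (measure_mono_ae ?_) (hd.trans (measure_mono_ae ?_))
    · filter_upwards [hinv] with A hA hlt
      obtain ⟨v, hv, hs⟩ := spec_eq_Fn A
      have hpos := Fn_pos hA hv
      rw [← hs] at hpos
      have h1 : Real.log (specRadC A) < t := hlt
      rw [Real.log_lt_iff_lt_exp hpos] at h1
      show rho A < ENNReal.ofReal (Real.exp t)
      rw [← ENNReal.ofReal_toReal (rho_ne_top A)]
      exact (ENNReal.ofReal_lt_ofReal_iff (Real.exp_pos t)).2 h1
    · filter_upwards [hae] with p hp hle
      have h1 : Fn p.1 p.2 ≤ Real.exp t := hle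
      show Real.log (Fn p.1 p.2) ≤ t
      exact (Real.log_le_iff_le_exp (Fn_pos hp.1 hp.2)).2 h1)
  rw [integral_prod _ hY] at hdom
  exact hdom

end part14

end mainproof

/-- (Dedieu–Shub) Let `μ` be a Borel probability measure on the invertible `n×n` complex
matrices with `log⁺‖A‖` and `log⁺‖A⁻¹‖` integrable, invariant under left multiplication
by every unitary matrix, and let `σ` be the unitarily invariant probability measure on the
unit sphere of `ℂⁿ`.  Then `∫ log ρ(A) dμ(A) ≥ ∫∫ log ‖A·v‖ dσ(v) dμ(A)`. -/
theorem dedieu_shub_unitarily_invariant (n : ℕ) (hn : 1 ≤ n)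
    (μ : Measure (Matrix (Fin n) (Fin n) ℂ)) [IsProbabilityMeasure μ]
    (hinvtble : μ {A | IsUnit A}ᶜ = 0)
    (hlog1 : Integrable (fun A => max (Real.log (opNormC A)) 0) μ)
    (hlog2 : Integrable (fun A => max (Real.log (opNormC A⁻¹)) 0) μ)
    (hunitary : ∀ U : Matrix (Fin n) (Fin n) ℂ, star U * U = 1 →
      Measure.map (fun A => U * A) μ = μ)
    (σ : Measure (EuclideanSpace ℂ (Fin n))) [IsProbabilityMeasure σ]
    (hσsphere : σ (Metric.sphere (0 : EuclideanSpace ℂ (Fin n)) 1)ᶜ = 0)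
    (hσinv : ∀ U : Matrix (Fin n) (Fin n) ℂ, star U * U = 1 →
      Measure.map (fun v => Matrix.toEuclideanLin U v) σ = σ) :
    ∫ A, Real.log (specRadC A) ∂μ ≥
      ∫ A, (∫ v, Real.log ‖Matrix.toEuclideanLin A v‖ ∂σ) ∂μ := by
  obtain ⟨m, rfl⟩ : ∃ m, n = m + 1 := ⟨n - 1, by omega⟩
  have h1 : ∀ᵐ A ∂μ, IsUnit A := hinvtble
  have h2 : ∀ᵐ v ∂σ, ‖v‖ = 1 := by
    have h : ∀ᵐ v ∂σ, v ∈ Metric.sphere (0 : EuclideanSpace ℂ (Fin (m + 1))) 1 := hσsphere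
    filter_upwards [h] with v hv
    simpa using hv
  exact main_succ μ h1 hlog1 hlog2 hunitary σ h2 hσinv
end
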